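/- Let T be a near-triangulation of order n ≥ 5 with boundary cycle C = (u_1, ..., u_h, u_1), and let u_i be a boundary vertex. If u_i has at least one neighbor not on C, then there exists an interior vertex v such that the edge (u_i, v) is contractible in T. -/

import Mathlib

/-!
Common definitions.

A *plane graph* is a finite graph whose vertices are points of the plane `ℝ × ℝ` and whose
edges are drawn as straight-line segments between their endpoints (by Fáry's theorem every
planar graph admits such a drawing).  A *near-triangulation* is a plane graph that is properly
embedded, biconnected, and all of whose bounded faces are triangles (the faces are the
connected components of the complement of the drawing).  The boundary cycle lists, cyclically,
the vertices on the outer (unbounded) face.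
-/

open scoped Classical

noncomputable section

/-- A finite graph drawn in the plane: the vertices are points of `ℝ × ℝ` and each edge is
drawn as the straight-line segment between its endpoints. -/
structure PlaneGraph where
  verts : Finset (ℝ × ℝ)
  Adj : ℝ × ℝ → ℝ × ℝ → Prop
  symm : ∀ p q, Adj p q → Adj q p
  loopless : ∀ p, ¬ Adj p p
  mem_of_adj : ∀ p q, Adj p q → p ∈ verts ∧ q ∈ verts

namespace PlaneGraph

variable (G : PlaneGraph)

/-- The union of the (closed) segments realizing the edges of the graph. -/
def drawing : Set (ℝ × ℝ) := {x | ∃ p q, G.Adj p q ∧ x ∈ segment ℝ p q}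

/-- The straight-line drawing is a proper plane embedding: two edges meet only in common
endpoints and no vertex lies on an edge of which it is not an endpoint. -/
def IsEmbedded : Prop :=
  (∀ p q r s, G.Adj p q → G.Adj r s → ∀ x, x ∈ segment ℝ p q → x ∈ segment ℝ r s →
      ({p, q} : Set (ℝ × ℝ)) = {r, s} ∨
        (x ∈ ({p, q} : Set (ℝ × ℝ)) ∧ x ∈ ({r, s} : Set (ℝ × ℝ)))) ∧
  (∀ p q v, G.Adj p q → v ∈ G.verts → v ∈ segment ℝ p q → v = p ∨ v = q)

/-- Reachability by walks in the graph. -/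
def Reachable (p q : ℝ × ℝ) : Prop := Relation.ReflTransGen G.Adj p q

/-- The graph is connected. -/
def Connected : Prop := G.verts.Nonempty ∧ ∀ p ∈ G.verts, ∀ q ∈ G.verts, G.Reachable p q

/-- Deletion of a set of vertices together with all incident edges. -/
def deleteVerts (S : Finset (ℝ × ℝ)) : PlaneGraph where
  verts := G.verts \ S
  Adj := fun p q => G.Adj p q ∧ p ∉ S ∧ q ∉ S
  symm := fun p q h => ⟨G.symm p q h.1, h.2.2, h.2.1⟩
  loopless := fun p h => G.loopless p h.1
  mem_of_adj := fun p q h => by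
    obtain ⟨h1, h2⟩ := G.mem_of_adj p q h.1
    exact ⟨Finset.mem_sdiff.mpr ⟨h1, h.2.1⟩, Finset.mem_sdiff.mpr ⟨h2, h.2.2⟩⟩

/-- Deletion of a single edge (keeping all vertices). -/
def deleteEdge (p q : ℝ × ℝ) : PlaneGraph where
  verts := G.verts
  Adj := fun a b => G.Adj a b ∧ ¬ ((a = p ∧ b = q) ∨ (a = q ∧ b = p))
  symm := fun a b h => ⟨G.symm a b h.1, by tauto⟩
  loopless := fun a h => G.loopless a h.1
  mem_of_adj := fun a b h => G.mem_of_adj a b h.1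

/-- The (abstract, simple) graph obtained by contracting the edge `(p, q)`:
the vertex `q` is merged into `p`, which becomes the new contracted vertex. -/
def contractEdge (p q : ℝ × ℝ) : PlaneGraph where
  verts := G.verts.erase q
  Adj := fun a b =>
    a ≠ b ∧ a ∈ G.verts.erase q ∧ b ∈ G.verts.erase q ∧
      (G.Adj a b ∨ (a = p ∧ G.Adj q b) ∨ (b = p ∧ G.Adj q a))
  symm := fun a b h => by
    obtain ⟨h1, h2, h3, h4⟩ := h
    refine ⟨h1.symm, h3, h2, ?_⟩
    rcases h4 with h4 | h4 | h4
    · exact Or.inl (G.symm _ _ h4)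
    · exact Or.inr (Or.inr h4)
    · exact Or.inr (Or.inl h4)
  loopless := fun a h => h.1 rfl
  mem_of_adj := fun a b h => ⟨h.2.1, h.2.2.1⟩

/-- Biconnectivity: at least three vertices, connected, and deleting any single vertex leaves
a connected graph. -/
def Biconnected : Prop :=
  3 ≤ G.verts.card ∧ G.Connected ∧ ∀ v ∈ G.verts, (G.deleteVerts {v}).Connected

/-- A face of the plane graph: a connected component of the complement of the drawing. -/
def IsFace (F : Set (ℝ × ℝ)) : Prop :=
  ∃ x, x ∉ G.drawing ∧ F = connectedComponentIn G.drawingᶜ x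

/-- The open triangle with the three given corners. -/
def openTriangle (a b c : ℝ × ℝ) : Set (ℝ × ℝ) :=
  interior (convexHull ℝ ({a, b, c} : Set (ℝ × ℝ)))

/-- Every bounded (inner) face of the drawing is a triangular face of the graph. -/
def InnerFacesTriangles : Prop :=
  ∀ F, G.IsFace F → Bornology.IsBounded F →
    ∃ a ∈ G.verts, ∃ b ∈ G.verts, ∃ c ∈ G.verts,
      G.Adj a b ∧ G.Adj b c ∧ G.Adj a c ∧ F = openTriangle a b c

/-- A near-triangulation: a properly embedded biconnected plane graph all of whose faces are
triangles, except possibly the outer (unbounded) face. -/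
def IsNearTriangulation : Prop :=
  G.IsEmbedded ∧ G.Biconnected ∧ G.InnerFacesTriangles

/-- The outer region: the union of the unbounded components of the complement of the
drawing (for a near-triangulation this is the outer face). -/
def outerRegion : Set (ℝ × ℝ) :=
  {x | x ∉ G.drawing ∧ ¬ Bornology.IsBounded (connectedComponentIn G.drawingᶜ x)}

/-- `u : ZMod h → ℝ × ℝ` is the boundary cycle of `G`: an injective cyclic sequence
`u 0, u 1, …, u (h-1)` of vertices, consecutive ones adjacent, whose edges bound the outer
face and which contains every vertex lying on the boundary of the outer face. -/
def IsBoundaryCycle {h : ℕ} (u : ZMod h → ℝ × ℝ) : Prop :=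
  3 ≤ h ∧ Function.Injective u ∧
  (∀ i, u i ∈ G.verts) ∧
  (∀ i, G.Adj (u i) (u (i + 1))) ∧
  (∀ i, segment ℝ (u i) (u (i + 1)) ⊆ frontier G.outerRegion) ∧
  (∀ v ∈ G.verts, (v : ℝ × ℝ) ∈ frontier G.outerRegion → v ∈ Set.range u)

/-- An interior vertex: a vertex not on the boundary cycle. -/
def IsInteriorVtx {h : ℕ} (u : ZMod h → ℝ × ℝ) (v : ℝ × ℝ) : Prop :=
  v ∈ G.verts ∧ v ∉ Set.range u

/-- The edge `(p, q)` is a diagonal: it joins two non-consecutive boundary vertices. -/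
def IsDiagonalEdge {h : ℕ} (u : ZMod h → ℝ × ℝ) (p q : ℝ × ℝ) : Prop :=
  G.Adj p q ∧ ∃ i j : ZMod h, p = u i ∧ q = u j ∧ j ≠ i + 1 ∧ i ≠ j + 1

/-- The graph has no diagonals: any edge between boundary vertices joins consecutive ones. -/
def HasNoDiagonals {h : ℕ} (u : ZMod h → ℝ × ℝ) : Prop :=
  ∀ i j : ZMod h, G.Adj (u i) (u j) → j = i + 1 ∨ i = j + 1

/-- The degree of a vertex. -/
def degree (v : ℝ × ℝ) : ℕ := (G.verts.filter (fun w => G.Adj v w)).card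

/-- The degree of a vertex in the subgraph induced on the set `S` of vertices. -/
def degreeOn (S : Set (ℝ × ℝ)) (v : ℝ × ℝ) : ℕ :=
  (G.verts.filter (fun w => G.Adj v w ∧ w ∈ S)).card

/-- A total dominating set: every vertex of the graph is adjacent to a member of `D`. -/
def IsTDS (D : Finset (ℝ × ℝ)) : Prop :=
  D ⊆ G.verts ∧ ∀ v ∈ G.verts, ∃ d ∈ D, G.Adj v d

/-- The total domination number `γₜ`. -/
def totalDominationNumber : ℕ :=
  sInf {k | ∃ D : Finset (ℝ × ℝ), G.IsTDS D ∧ D.card = k}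

/-- Isomorphism of plane graphs as abstract graphs. -/
def IsIsoTo (H : PlaneGraph) : Prop :=
  ∃ f : ℝ × ℝ → ℝ × ℝ,
    Set.BijOn f (↑G.verts) (↑H.verts) ∧
    ∀ p ∈ G.verts, ∀ q ∈ G.verts, (G.Adj p q ↔ H.Adj (f p) (f q))

/-- The edge `(p, q)` is contractible: the contracted graph `G/e` is (abstractly isomorphic
to) a near-triangulation. -/
def IsContractible (p q : ℝ × ℝ) : Prop :=
  G.Adj p q ∧ ∃ H : PlaneGraph, H.IsNearTriangulation ∧ (G.contractEdge p q).IsIsoTo H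

/-- A separating triangle: a triangle of the graph with some vertex strictly inside it and
some vertex outside it. -/
def IsSeparatingTriangle (a b c : ℝ × ℝ) : Prop :=
  a ∈ G.verts ∧ b ∈ G.verts ∧ c ∈ G.verts ∧
  G.Adj a b ∧ G.Adj b c ∧ G.Adj a c ∧
  (∃ v ∈ G.verts, v ∈ openTriangle a b c) ∧
  (∃ v ∈ G.verts, v ∉ convexHull ℝ ({a, b, c} : Set (ℝ × ℝ)))

/-- Edge list of the first exceptional 12-vertex maximal outerplanar graph `H₁`
(boundary 12-cycle, central triangle `{0,4,8}`, ear triangles `{1,2,3}`, `{5,6,7}`,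
`{9,10,11}`, and the three remaining quadrilateral diagonals, all with the same
orientation). -/
def exc1Edges : List (Fin 12 × Fin 12) :=
  [(0,1),(1,2),(2,3),(3,4),(4,5),(5,6),(6,7),(7,8),(8,9),(9,10),(10,11),(11,0),
   (0,4),(4,8),(0,8),(1,3),(5,7),(9,11),(0,3),(4,7),(8,11)]

/-- Edge list of the second exceptional 12-vertex maximal outerplanar graph `H₂`
(same as `H₁` except that one quadrilateral diagonal has the opposite orientation). -/
def exc2Edges : List (Fin 12 × Fin 12) :=
  [(0,1),(1,2),(2,3),(3,4),(4,5),(5,6),(6,7),(7,8),(8,9),(9,10),(10,11),(11,0),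
   (0,4),(4,8),(0,8),(1,3),(5,7),(9,11),(0,3),(4,7),(0,9)]

/-- The exceptional graph `H₁`. -/
def H1graph : SimpleGraph (Fin 12) := SimpleGraph.fromRel (fun a b => (a, b) ∈ exc1Edges)

/-- The exceptional graph `H₂`. -/
def H2graph : SimpleGraph (Fin 12) := SimpleGraph.fromRel (fun a b => (a, b) ∈ exc2Edges)

/-- Isomorphism between a plane graph and a simple graph on `Fin 12`. -/
def IsIsoToSG (H : SimpleGraph (Fin 12)) : Prop :=
  ∃ f : ℝ × ℝ → Fin 12,
    Set.BijOn f (↑G.verts) Set.univ ∧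
    ∀ p ∈ G.verts, ∀ q ∈ G.verts, (G.Adj p q ↔ H.Adj (f p) (f q))

/-- `G` is isomorphic to `H₁` or to `H₂`. -/
def IsExceptional : Prop := G.IsIsoToSG H1graph ∨ G.IsIsoToSG H2graph

/-- A maximal outerplanar graph (MOP): a near-triangulation all of whose vertices lie on the
boundary cycle. -/
def IsMOP : Prop :=
  G.IsNearTriangulation ∧
    ∃ (h : ℕ) (u : ZMod h → ℝ × ℝ), G.IsBoundaryCycle u ∧ ∀ v ∈ G.verts, v ∈ Set.range u

/-- The graph is Hamiltonian: it has a cycle through all of its vertices. -/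
def IsHamiltonian : Prop :=
  ∃ (m : ℕ) (c : ZMod m → ℝ × ℝ), 3 ≤ m ∧ Function.Injective c ∧
    (∀ i, G.Adj (c i) (c (i + 1))) ∧ ∀ v ∈ G.verts, v ∈ Set.range c

/-- An outerplane graph: a properly embedded plane graph all of whose vertices lie on the
boundary of the outer region. -/
def IsOuterplane : Prop :=
  G.IsEmbedded ∧ ∀ v ∈ G.verts, (v : ℝ × ℝ) ∈ closure G.outerRegion

/-- The union of the boundary-cycle segments. -/
def boundaryDrawing {h : ℕ} (u : ZMod h → ℝ × ℝ) : Set (ℝ × ℝ) :=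
  ⋃ i : ZMod h, segment ℝ (u i) (u (i + 1))

/-- The open interior of the boundary cycle, viewed as a simple closed polygon. -/
def polygonInterior {h : ℕ} (u : ZMod h → ℝ × ℝ) : Set (ℝ × ℝ) :=
  {x | x ∉ boundaryDrawing u ∧
    Bornology.IsBounded (connectedComponentIn (boundaryDrawing u)ᶜ x)}

/-- The union of the segments realizing the diagonals of `G[C]`. -/
def diagonalDrawing {h : ℕ} (u : ZMod h → ℝ × ℝ) : Set (ℝ × ℝ) :=
  {x | ∃ i j : ZMod h, G.Adj (u i) (u j) ∧ j ≠ i + 1 ∧ i ≠ j + 1 ∧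
    x ∈ segment ℝ (u i) (u j)}

/-- A region of the subdivision of the interior of the boundary cycle by the diagonals of
`G[C]`: a connected component of the interior of the cycle minus the diagonals. -/
def IsSubdivisionRegion {h : ℕ} (u : ZMod h → ℝ × ℝ) (R : Set (ℝ × ℝ)) : Prop :=
  ∃ x ∈ polygonInterior u \ G.diagonalDrawing u,
    R = connectedComponentIn (polygonInterior u \ G.diagonalDrawing u) x

/-- The diagonal `(u i, u j)` is a side of the region `R`. -/
def IsSideOf {h : ℕ} (u : ZMod h → ℝ × ℝ) (R : Set (ℝ × ℝ)) (i j : ZMod h) : Prop :=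
  G.Adj (u i) (u j) ∧ j ≠ i + 1 ∧ i ≠ j + 1 ∧
    segment ℝ (u i) (u j) \ {u i, u j} ⊆ frontier R

/-- `v` lies on the opposite side of the diagonal `(u i, u j)` from the region `R`:
inside the boundary polygon, `v` cannot be joined to `R` without crossing the diagonal. -/
def OppositeSideOf {h : ℕ} (u : ZMod h → ℝ × ℝ) (R : Set (ℝ × ℝ)) (i j : ZMod h)
    (v : ℝ × ℝ) : Prop :=
  ∀ x ∈ R, v ∉ connectedComponentIn (polygonInterior u \ segment ℝ (u i) (u j)) x

/-- A terminal polygon: a region of the subdivision containing some interior vertex such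
that at most one of its sides has interior vertices of `G` on its opposite side
(i.e. at most one of the outer parts `T_out(P,d)` contains interior vertices). -/
def IsTerminalPolygon {h : ℕ} (u : ZMod h → ℝ × ℝ) (R : Set (ℝ × ℝ)) : Prop :=
  G.IsSubdivisionRegion u R ∧
  (∃ v, G.IsInteriorVtx u v ∧ v ∈ R) ∧
  ∀ i j k l : ZMod h,
    G.IsSideOf u R i j → G.IsSideOf u R k l →
    (∃ w, G.IsInteriorVtx u w ∧ OppositeSideOf u R i j w) →
    (∃ w, G.IsInteriorVtx u w ∧ OppositeSideOf u R k l w) →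
    ({u i, u j} : Set (ℝ × ℝ)) = {u k, u l}

/-- An irreducible near-triangulation: it has interior vertices, and for every boundary edge
`(u i, u (i+1))` the third vertex of the inner triangular face containing this edge also lies
on the boundary cycle. -/
def Irreducible {h : ℕ} (u : ZMod h → ℝ × ℝ) : Prop :=
  (∃ v, G.IsInteriorVtx u v) ∧
  ∀ i : ZMod h, ∀ v ∈ G.verts,
    G.Adj (u i) v → G.Adj (u (i + 1)) v →
    G.IsFace (openTriangle (u i) (u (i + 1)) v) → v ∈ Set.range u

end PlaneGraph

section

/-- The directed edge `(x, y)` is a side of some face. -/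
def Side {α : Type*} (D : α → α → α → Prop) (x y : α) : Prop := ∃ z, D x y z

/-- `x` and `y` are joined by a side of some face. -/
def Nbr {α : Type*} (D : α → α → α → Prop) (x y : α) : Prop := Side D x y ∨ Side D y x

/-- The directed edge `(x, y)` has a face on its left but none on its right. -/
def Bd {α : Type*} (D : α → α → α → Prop) (x y : α) : Prop := Side D x y ∧ ¬ Side D y x

/-- A combinatorial triangulated disc: `D x y z` says that `x, y, z` is a face listed
counterclockwise.  Connectedness of the complex and of all vertex links and the vanishing of
the first cohomology are expressed by real valued cochains. -/
structure TriDisc {α : Type*} (V : Finset α) (D : α → α → α → Prop) : Prop where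
  mem : ∀ {x y z}, D x y z → x ∈ V
  rot : ∀ {x y z}, D x y z → D y z x
  ne : ∀ {x y z}, D x y z → x ≠ y
  uniq : ∀ {x y z z'}, D x y z → D x y z' → z = z'
  conn : ∀ f : α → ℝ, (∀ x y z, D x y z → f x = f y) → ∀ x ∈ V, ∀ y ∈ V, f x = f y
  link : ∀ (w : α) (g : α → ℝ), (∀ x y, D w x y → g x = g y) →
    ∀ x y, Nbr D w x → Nbr D w y → g x = g y
  pot : ∀ e : α → α → ℝ, (∀ x y, e y x = - e x y) →
    (∀ x y z, D x y z → e x y + e y z + e z x = 0) →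
    ∃ f : α → ℝ, ∀ x y z, D x y z → f y - f x = e x y

namespace TriDisc

variable {α : Type*} {V : Finset α} {D : α → α → α → Prop}

section
variable (K : TriDisc V D)
include K

theorem rot2 {x y z : α} (h : D x y z) : D z x y := K.rot (K.rot h)

theorem ne2 {x y z : α} (h : D x y z) : y ≠ z := K.ne (K.rot h)

theorem ne3 {x y z : α} (h : D x y z) : z ≠ x := K.ne (K.rot2 h)

theorem mem2 {x y z : α} (h : D x y z) : y ∈ V := K.mem (K.rot h)

theorem mem3 {x y z : α} (h : D x y z) : z ∈ V := K.mem (K.rot2 h)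

theorem uniq_pred {w x x' y : α} (h : D w x y) (h' : D w x' y) : x = x' :=
  K.uniq (K.rot2 h) (K.rot2 h')

theorem nbr_left {w x y : α} (h : D w x y) : Nbr D w x := Or.inl ⟨y, h⟩

theorem nbr_right {w x y : α} (h : D w x y) : Nbr D w y := Or.inr ⟨x, K.rot2 h⟩

theorem nbr_mem {w x : α} (h : Nbr D w x) : x ∈ V := by
  rcases h with ⟨y, h⟩ | ⟨y, h⟩
  · exact K.mem2 h
  · exact K.mem h

theorem nbr_ne {w x : α} (h : Nbr D w x) : x ≠ w := by
  rcases h with ⟨y, h⟩ | ⟨y, h⟩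
  · exact (K.ne h).symm
  · exact K.ne h

/-- A set of vertices closed under passing to adjacent link vertices contains all or none of
the neighbors. -/
theorem link_closed (w : α) (A : α → Prop) (hA : ∀ x y, D w x y → (A x ↔ A y)) {x y : α}
    (hx : Nbr D w x) (hy : Nbr D w y) (h : A x) : A y := by
  have := K.link w (fun t => if A t then 1 else 0)
    (fun x y hxy => by simp only [hA x y hxy]) x y hx hy
  by_contra hn
  simp [h, hn] at this

theorem conn_closed (A : α → Prop) (hA : ∀ x y z, D x y z → A x → A y) {x y : α}
    (hx : x ∈ V) (hy : y ∈ V) (h : A x) : A y := by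
  have := K.conn (fun t => if A t then 1 else 0)
    (fun x y z hxy => by
      have : A x ↔ A y := ⟨hA _ _ _ hxy, fun h => hA _ _ _ (K.rot2 hxy) (hA _ _ _ (K.rot hxy) h)⟩
      simp only [this]) x hx y hy
  by_contra hn
  simp [h, hn] at this

/-- Sums over all oriented faces are invariant under rotation. -/
theorem sum_rot (F : α → α → α → ℝ) :
    ∑ x ∈ V, ∑ y ∈ V, ∑ z ∈ V, (if D x y z then F x y z else 0) =
    ∑ x ∈ V, ∑ y ∈ V, ∑ z ∈ V, (if D x y z then F y z x else 0) := by
  have hrot : ∀ x y z, D x y z ↔ D z x y := fun x y z => ⟨K.rot2, K.rot⟩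
  calc _ = ∑ x ∈ V, ∑ y ∈ V, ∑ z ∈ V, (if D z x y then F x y z else 0) := by
        refine Finset.sum_congr rfl fun x _ => Finset.sum_congr rfl fun y _ =>
          Finset.sum_congr rfl fun z _ => if_congr (hrot x y z) rfl rfl
    _ = ∑ x ∈ V, ∑ z ∈ V, ∑ y ∈ V, (if D z x y then F x y z else 0) :=
        Finset.sum_congr rfl fun x _ => Finset.sum_comm
    _ = _ := Finset.sum_comm

theorem sum_third (F : α → α → ℝ) (x y : α) :
    ∑ z ∈ V, (if D x y z then F x y else 0) = if Side D x y then F x y else 0 := by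
  by_cases h : Side D x y
  · obtain ⟨z, hz⟩ := h
    rw [if_pos ⟨z, hz⟩, Finset.sum_eq_single z, if_pos hz]
    · intro b _ hb
      rw [if_neg]
      exact fun h => hb (K.uniq h hz)
    · intro hn
      exact absurd (K.mem3 hz) hn
  · rw [if_neg h]
    exact Finset.sum_eq_zero fun z _ => if_neg fun hz => h ⟨z, hz⟩

/-- The cyclic sum of an edge function over all faces is thrice its sum over the sides. -/
theorem sum_faces (F : α → α → ℝ) :
    ∑ x ∈ V, ∑ y ∈ V, ∑ z ∈ V, (if D x y z then F x y + F y z + F z x else 0) =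
    3 * ∑ x ∈ V, ∑ y ∈ V, (if Side D x y then F x y else 0) := by
  have h1 := K.sum_rot (fun x y _ => F x y)
  have h2 := K.sum_rot (fun _ y z => F y z)
  have h3 : ∑ x ∈ V, ∑ y ∈ V, ∑ z ∈ V, (if D x y z then F x y else 0) =
      ∑ x ∈ V, ∑ y ∈ V, (if Side D x y then F x y else 0) :=
    Finset.sum_congr rfl fun x _ => Finset.sum_congr rfl fun y _ => K.sum_third F x y
  have h4 : ∀ x y z, (if D x y z then F x y + F y z + F z x else 0) =
      (if D x y z then F x y else 0) + (if D x y z then F y z else 0) +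
      (if D x y z then F z x else 0) := by
    intro x y z; split_ifs <;> simp
  simp only [h4, Finset.sum_add_distrib]
  linarith

/-- For an antisymmetric edge function only the boundary contributes. -/
theorem sum_side_antisymm (F : α → α → ℝ) (hF : ∀ x y, F y x = - F x y) :
    ∑ x ∈ V, ∑ y ∈ V, (if Side D x y then F x y else 0) =
    ∑ x ∈ V, ∑ y ∈ V, (if Bd D x y then F x y else 0) := by
  have h0 : ∑ x ∈ V, ∑ y ∈ V, (if Side D x y ∧ Side D y x then F x y else 0) = 0 := by
    have h1 : ∑ x ∈ V, ∑ y ∈ V, (if Side D x y ∧ Side D y x then F x y else 0) =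
        ∑ x ∈ V, ∑ y ∈ V, (if Side D y x ∧ Side D x y then F y x else 0) := Finset.sum_comm
    have h2 : ∀ x y, (if Side D y x ∧ Side D x y then F y x else 0) =
        - (if Side D x y ∧ Side D y x then F x y else 0) := by
      intro x y
      by_cases h : Side D x y ∧ Side D y x
      · rw [if_pos h, if_pos h.symm, hF]
      · rw [if_neg h, if_neg (fun h' => h h'.symm), neg_zero]
    rw [Finset.sum_congr rfl fun x _ => Finset.sum_congr rfl fun y _ => h2 x y] at h1
    simp only [Finset.sum_neg_distrib] at h1
    linarith
  have h3 : ∀ x y, (if Side D x y then F x y else 0) =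
      (if Side D x y ∧ Side D y x then F x y else 0) + (if Bd D x y then F x y else 0) := by
    intro x y
    unfold Bd
    by_cases h : Side D x y <;> by_cases h' : Side D y x <;> simp [h, h']
  simp only [h3, Finset.sum_add_distrib]
  linarith

/-- The boundary is balanced: it has as many edges into as out of each vertex. -/
theorem sum_bd_diff (f : α → ℝ) :
    ∑ x ∈ V, ∑ y ∈ V, (if Bd D x y then f y - f x else 0) = 0 := by
  rw [← K.sum_side_antisymm (fun x y => f y - f x) (fun x y => by ring)]
  have := K.sum_faces (fun x y => f y - f x)
  have h0 : ∑ x ∈ V, ∑ y ∈ V, ∑ z ∈ V,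
      (if D x y z then (f y - f x) + (f z - f y) + (f x - f z) else 0) = 0 := by
    refine Finset.sum_eq_zero fun x _ => Finset.sum_eq_zero fun y _ =>
      Finset.sum_eq_zero fun z _ => ?_
    split_ifs
    · ring
    · rfl
  linarith

theorem bd_mem {x y : α} (h : Bd D x y) : x ∈ V ∧ y ∈ V := by
  obtain ⟨⟨z, hz⟩, _⟩ := h
  exact ⟨K.mem hz, K.mem2 hz⟩

theorem bd_ne {x y : α} (h : Bd D x y) : x ≠ y := by
  obtain ⟨⟨z, hz⟩, _⟩ := h
  exact K.ne hz

theorem bd_in_out_count (w : α) :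
    ∑ x ∈ V, (if Bd D x w then (1 : ℝ) else 0) = ∑ y ∈ V, (if Bd D w y then (1 : ℝ) else 0) := by
  have h := K.sum_bd_diff (fun t => if t = w then 1 else 0)
  have h1 : ∀ x y, (if Bd D x y then (if y = w then (1 : ℝ) else 0) - (if x = w then 1 else 0)
      else 0) = (if y = w then (if Bd D x y then 1 else 0) else 0) -
      (if x = w then (if Bd D x y then 1 else 0) else 0) := by
    intro x y; split_ifs <;> simp
  simp only [h1, Finset.sum_sub_distrib] at h
  have h2 : ∑ x ∈ V, ∑ y ∈ V, (if y = w then (if Bd D x y then (1 : ℝ) else 0) else 0) =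
      ∑ x ∈ V, (if Bd D x w then 1 else 0) := by
    refine Finset.sum_congr rfl fun x _ => ?_
    by_cases hw : w ∈ V
    · rw [Finset.sum_eq_single w] <;> simp +contextual [hw]
    · rw [if_neg (fun hb => hw (K.bd_mem hb).2)]
      exact Finset.sum_eq_zero fun y hy => if_neg (by rintro rfl; exact hw hy)
  have h3 : ∑ x ∈ V, ∑ y ∈ V, (if x = w then (if Bd D x y then (1 : ℝ) else 0) else 0) =
      ∑ y ∈ V, (if Bd D w y then 1 else 0) := by
    rw [Finset.sum_comm]
    refine Finset.sum_congr rfl fun x _ => ?_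
    by_cases hw : w ∈ V
    · rw [Finset.sum_eq_single w] <;> simp +contextual [hw]
    · rw [if_neg (fun hb => hw (K.bd_mem hb).1)]
      exact Finset.sum_eq_zero fun y hy => if_neg (by rintro rfl; exact hw hy)
  rw [h2, h3] at h
  linarith

theorem exists_bd_out {w t : α} (h : Bd D t w) : ∃ s, Bd D w s := by
  by_contra hn
  push Not at hn
  have := K.bd_in_out_count w
  simp only [hn, if_false, Finset.sum_const_zero] at this
  have h1 : (1 : ℝ) ≤ ∑ x ∈ V, (if Bd D x w then (1 : ℝ) else 0) := by
    have := Finset.single_le_sum (f := fun x => if Bd D x w then (1 : ℝ) else 0)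
      (fun i _ => by positivity) (K.bd_mem h).1
    simpa [h] using this
  linarith

theorem exists_bd_in {w t : α} (h : Bd D w t) : ∃ s, Bd D s w := by
  by_contra hn
  push Not at hn
  have := K.bd_in_out_count w
  simp only [hn, if_false, Finset.sum_const_zero] at this
  have h1 : (1 : ℝ) ≤ ∑ x ∈ V, (if Bd D w x then (1 : ℝ) else 0) := by
    have := Finset.single_le_sum (f := fun x => if Bd D w x then (1 : ℝ) else 0)
      (fun i _ => by positivity) (K.bd_mem h).2
    simpa [h] using this
  linarith

theorem bd_in_unique {w s t : α} (hs : Bd D s w) (ht : Bd D t w) : s = t := by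
  have hA : ∀ x y, D w x y → (Relation.ReflTransGen (D w) x t ↔ Relation.ReflTransGen (D w) y t) := by
    intro x y hxy
    constructor
    · intro h
      rcases h.cases_head with rfl | ⟨c, hc, h⟩
      · exact absurd ⟨y, hxy⟩ ht.2
      · rwa [K.uniq hxy hc]
    · exact fun h => h.head hxy
  have h := K.link_closed w _ hA (Or.inr ht.1) (Or.inr hs.1) Relation.ReflTransGen.refl
  rcases h.cases_head with h | ⟨c, hc, _⟩
  · exact h
  · exact absurd ⟨c, hc⟩ hs.2

theorem bd_out_unique {w s t : α} (hs : Bd D w s) (ht : Bd D w t) : s = t := by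
  have hA : ∀ x y, D w x y → (Relation.ReflTransGen (D w) t x ↔ Relation.ReflTransGen (D w) t y) := by
    intro x y hxy
    constructor
    · exact fun h => h.tail hxy
    · intro h
      rcases h.cases_tail with rfl | ⟨c, h, hc⟩
      · exact absurd ⟨x, K.rot2 hxy⟩ ht.2
      · rwa [K.uniq_pred hxy hc]
  have h := K.link_closed w _ hA (Or.inl ht.1) (Or.inl hs.1) Relation.ReflTransGen.refl
  rcases h.cases_tail with h | ⟨c, _, hc⟩
  · exact h
  · exact absurd ⟨c, K.rot2 hc⟩ hs.2

/-- The link of a boundary vertex is acyclic. -/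
theorem link_acyclic {w t : α} (ht : Bd D t w) (y : α) : ¬ Relation.TransGen (D w) y y := by
  intro hy
  have hA : ∀ x x', D w x x' → (Relation.TransGen (D w) x y ↔ Relation.TransGen (D w) x' y) := by
    intro x x' hx
    constructor
    · intro h
      rcases Relation.TransGen.head'_iff.1 h with ⟨c, hc, h⟩
      rw [← K.uniq hx hc] at h
      rcases h.cases_head with rfl | ⟨d, hd, h⟩
      · exact hy
      · exact Relation.TransGen.head' hd h
    · exact fun h => h.head hx
  obtain ⟨c, hc, _⟩ := Relation.TransGen.head'_iff.1 hy
  have := K.link_closed w _ hA (K.nbr_left hc) (Or.inr ht.1) hy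
  obtain ⟨c, hc, _⟩ := Relation.TransGen.head'_iff.1 this
  exact ht.2 ⟨c, hc⟩

/-- Removing a vertex from a link keeps it connected if the link is a cycle or the vertex is one
of its ends. -/
theorem link_erase {w z : α}
    (hz : ¬ Side D w z ∨ ¬ Side D z w ∨ ∀ x, Nbr D w x → Side D w x ∧ Side D x w)
    (g : α → ℝ) (hg : ∀ x y, D w x y → x ≠ z → y ≠ z → g x = g y) {x y : α}
    (hx : Nbr D w x) (hy : Nbr D w y) (hxz : x ≠ z) (hyz : y ≠ z) : g x = g y := by
  suffices h : ∃ c : ℝ, ∀ x y, D w x y → Function.update g z c x = Function.update g z c y by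
    obtain ⟨c, hc⟩ := h
    have := K.link w _ hc x y hx hy
    rwa [Function.update_of_ne hxz, Function.update_of_ne hyz] at this
  by_cases h1 : Side D w z
  · by_cases h2 : Side D z w
    · have hall : ∀ x, Nbr D w x → Side D w x ∧ Side D x w := by
        rcases hz with h | h | h
        · exact absurd h1 h
        · exact absurd h2 h
        · exact h
      obtain ⟨s, hs⟩ := h1
      obtain ⟨p, hp⟩ := h2
      replace hp : D w p z := K.rot hp
      refine ⟨g p, ?_⟩
      set g' := Function.update g z (g p) with hg'
      have hno : ∀ x y, D w x y → x ≠ z → g' x = g' y := by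
        intro x y hxy hx
        by_cases hy : y = z
        · subst hy
          rw [K.uniq_pred hxy hp, hg', Function.update_of_ne (K.ne2 hp), Function.update_self]
        · rw [hg', Function.update_of_ne hx, Function.update_of_ne hy]
          exact hg x y hxy hx hy
      have hsum : ∑ x ∈ V, ∑ y ∈ V, (if D w x y then g' y - g' x else 0) = 0 := by
        have e1 : ∀ x, ∑ y ∈ V, (if D w x y then g' x else 0) =
            if Nbr D w x then g' x else 0 := by
          intro x
          rw [K.sum_third (fun _ x => g' x) w x]
          by_cases h : Side D w x
          · rw [if_pos h, if_pos (show Nbr D w x from Or.inl h)]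
          · rw [if_neg h, if_neg (fun h' => h (hall x h').1)]
        have e2 : ∀ y, ∑ x ∈ V, (if D w x y then g' y else 0) =
            if Nbr D w y then g' y else 0 := by
          intro y
          have : ∀ x, D w x y ↔ D y w x := fun x => ⟨K.rot2, K.rot⟩
          simp only [this]
          rw [K.sum_third (fun y _ => g' y) y w]
          by_cases h : Side D y w
          · rw [if_pos h, if_pos (show Nbr D w y from Or.inr h)]
          · rw [if_neg h, if_neg (fun h' => h (hall y h').2)]
        have e3 : ∀ x y, (if D w x y then g' y - g' x else 0) =
            (if D w x y then g' y else 0) - (if D w x y then g' x else 0) := by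
          intro x y; split_ifs <;> simp
        simp only [e3, Finset.sum_sub_distrib, e1]
        rw [Finset.sum_comm]
        simp only [e2, sub_self]
      have hsingle : ∑ x ∈ V, ∑ y ∈ V, (if D w x y then g' y - g' x else 0) = g' s - g' z := by
        rw [Finset.sum_eq_single z, Finset.sum_eq_single s, if_pos hs]
        · intro b _ hb
          rw [if_neg]
          exact fun h => hb (K.uniq h hs)
        · exact fun h => absurd (K.mem3 hs) h
        · intro x _ hx
          refine Finset.sum_eq_zero fun y _ => ?_
          split_ifs with h
          · rw [hno x y h hx, sub_self]
          · rfl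
        · exact fun h => absurd (K.mem2 hs) h
      intro x y hxy
      by_cases hx : x = z
      · subst hx
        rw [K.uniq hxy hs]
        linarith
      · exact hno x y hxy hx
    · obtain ⟨s, hs⟩ := h1
      refine ⟨g s, fun x y hxy => ?_⟩
      have hy : y ≠ z := by
        rintro rfl
        exact h2 ⟨x, K.rot2 hxy⟩
      by_cases hx : x = z
      · subst hx
        rw [K.uniq hxy hs, Function.update_self, Function.update_of_ne (K.ne2 hs).symm]
      · rw [Function.update_of_ne hx, Function.update_of_ne hy]
        exact hg x y hxy hx hy
  · by_cases h2 : Side D z w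
    · obtain ⟨p, hp⟩ := h2
      replace hp : D w p z := K.rot hp
      refine ⟨g p, fun x y hxy => ?_⟩
      have hx : x ≠ z := by
        rintro rfl
        exact h1 ⟨y, hxy⟩
      by_cases hy : y = z
      · subst hy
        rw [K.uniq_pred hxy hp, Function.update_self, Function.update_of_ne (K.ne2 hp)]
      · rw [Function.update_of_ne hx, Function.update_of_ne hy]
        exact hg x y hxy hx hy
    · refine ⟨0, fun x y hxy => ?_⟩
      have hx : x ≠ z := by
        rintro rfl
        exact h1 ⟨y, hxy⟩
      have hy : y ≠ z := by
        rintro rfl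
        exact h2 ⟨x, K.rot2 hxy⟩
      rw [Function.update_of_ne hx, Function.update_of_ne hy]
      exact hg x y hxy hx hy

end

end TriDisc

end

section

namespace TriDisc

variable {α : Type*} {V : Finset α} {D : α → α → α → Prop}

/-- The faces cut off by a chord `w y` form a disc. Here `S` is the set of vertices strictly on
the left of the chord. -/
theorem cut (K : TriDisc V D) {w y z : α} {S : Finset α} (hSV : S ⊆ V) (hw : w ∉ S) (hy : y ∉ S)
    (hS : ∀ x x' x'', D x x' x'' → x ≠ w → x ≠ y → x' ≠ w → x' ≠ y → (x ∈ S ↔ x' ∈ S))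
    (hz : D w y z) (hzS : z ∈ S) :
    TriDisc (S ∪ {w, y}) (fun p q r => D p q r ∧ (p ∈ S ∨ q ∈ S ∨ r ∈ S)) := by
  have hwy : w ≠ y := K.ne hz
  have hmem : ∀ x x' x'', D x x' x'' → (x ∈ S ∨ x' ∈ S ∨ x'' ∈ S) → x ∉ S → x = w ∨ x = y := by
    intro x x' x'' h hS' hx
    by_contra hn
    push Not at hn
    have h1 : x' ∉ S := fun h' => hx
      ((hS _ _ _ h hn.1 hn.2 (fun e => hw (e ▸ h')) (fun e => hy (e ▸ h'))).2 h')
    have h2 : x'' ∉ S := fun h' => hx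
      ((hS _ _ _ (K.rot2 h) (fun e => hw (e ▸ h')) (fun e => hy (e ▸ h')) hn.1 hn.2).1 h')
    tauto
  refine ⟨?_, ?_, fun h => K.ne h.1, fun h h' => K.uniq h.1 h'.1, ?_, ?_, ?_⟩
  · intro p q r h
    by_cases hp : p ∈ S
    · simp [hp]
    · rcases hmem _ _ _ h.1 h.2 hp with h | h <;> simp [h]
  · intro p q r h
    exact ⟨K.rot h.1, by tauto⟩
  · intro f hf
    have hf0 : f w = f y := hf w y z ⟨hz, by tauto⟩
    set f' : α → ℝ := fun x => if x ∈ S then f x else f w with hf'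
    have hin : ∀ x ∈ S ∪ {w, y}, f' x = f x := by
      intro x hx
      simp only [Finset.mem_union, Finset.mem_insert, Finset.mem_singleton] at hx
      simp only [hf']
      split_ifs with h
      · rfl
      · rcases hx with hx | rfl | rfl
        · exact absurd hx h
        · rfl
        · exact hf0
    have hc := K.conn f' (fun x x' x'' h => by
      by_cases hS' : x ∈ S ∨ x' ∈ S ∨ x'' ∈ S
      · have e1 : f' x = f x := by
          by_cases hx : x ∈ S
          · exact hin x (by simp [hx])
          · exact hin x (by simpa [hx] using hmem _ _ _ h hS' hx)
        have e2 : f' x' = f x' := by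
          by_cases hx : x' ∈ S
          · exact hin x' (by simp [hx])
          · exact hin x' (by simpa [hx] using hmem _ _ _ (K.rot h) (by tauto) hx)
        rw [e1, e2]
        exact hf _ _ _ ⟨h, hS'⟩
      · push Not at hS'
        simp [hf', hS'])
    have hV : S ∪ {w, y} ⊆ V := by
      intro x hx
      simp only [Finset.mem_union, Finset.mem_insert, Finset.mem_singleton] at hx
      rcases hx with hx | rfl | rfl
      · exact hSV hx
      · exact K.mem hz
      · exact K.mem2 hz
    intro x hx x' hx'
    rw [← hin x hx, ← hin x' hx']
    exact hc x (hV hx) x' (hV hx')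
  · intro v g hg x x' hx hx'
    by_cases hv : v ∈ S
    · refine K.link v g (fun p q h => hg p q ⟨h, by tauto⟩) x x' ?_ ?_
      · exact hx.imp (fun ⟨t, h⟩ => ⟨t, h.1⟩) (fun ⟨t, h⟩ => ⟨t, h.1⟩)
      · exact hx'.imp (fun ⟨t, h⟩ => ⟨t, h.1⟩) (fun ⟨t, h⟩ => ⟨t, h.1⟩)
    · have hv' : v = w ∨ v = y := by
        rcases hx with ⟨t, h⟩ | ⟨t, h⟩
        · exact hmem _ _ _ h.1 h.2 hv
        · exact hmem _ _ _ (K.rot h.1) (by tauto) hv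
      obtain ⟨o, ho⟩ : ∃ o, ∀ p, (p = w ∨ p = y) → p ≠ v → p = o := by
        rcases hv' with rfl | rfl
        · exact ⟨y, fun p h h' => by tauto⟩
        · exact ⟨w, fun p h h' => by tauto⟩
      set g' : α → ℝ := fun x => if x ∈ S then g x else g o with hg'
      have key : ∀ p q, D v p q → (p ∈ S ∨ q ∈ S) → g' p = g p ∧ g' q = g q := by
        intro p q h hpq
        constructor
        · simp only [hg']
          split_ifs with hp
          · rfl
          · rw [ho p (hmem _ _ _ (K.rot h) (by tauto) hp) (K.ne h).symm]
        · simp only [hg']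
          split_ifs with hp
          · rfl
          · rw [ho q (hmem _ _ _ (K.rot2 h) (by tauto) hp) (K.ne3 h)]
      have hc := K.link v g' (fun p q h => by
        by_cases hpq : p ∈ S ∨ q ∈ S
        · rw [(key p q h hpq).1, (key p q h hpq).2]
          exact hg p q ⟨h, by tauto⟩
        · push Not at hpq
          simp [hg', hpq])
      have hval : ∀ x, Nbr (fun p q r => D p q r ∧ (p ∈ S ∨ q ∈ S ∨ r ∈ S)) v x →
          Nbr D v x ∧ g' x = g x := by
        rintro x (⟨t, h, h'⟩ | ⟨t, h, h'⟩)
        · exact ⟨Or.inl ⟨t, h⟩, (key x t h (by tauto)).1⟩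
        · exact ⟨Or.inr ⟨t, h⟩, (key t x (K.rot h) (by tauto)).2⟩
      rw [← (hval x hx).2, ← (hval x' hx').2]
      exact hc x x' (hval x hx).1 (hval x' hx').1
  · intro e he hclosed
    set g : α → ℝ := fun x => if x = w then 0 else e w y with hg
    set e' : α → α → ℝ := fun x x' => if x ∈ S ∨ x' ∈ S then e x x' else g x' - g x with he'
    have hee : ∀ x, e x x = 0 := fun x => by linarith [he x x]
    have hee' : ∀ x x' x'', D x x' x'' → (x ∈ S ∨ x' ∈ S ∨ x'' ∈ S) → e' x x' = e x x' := by
      intro x x' x'' h hS'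
      simp only [he']
      split_ifs with h1
      · rfl
      · push Not at h1
        rcases hmem _ _ _ h hS' h1.1 with rfl | rfl <;>
        rcases hmem _ _ _ (K.rot h) (by tauto) h1.2 with rfl | rfl
        · exact absurd rfl (K.ne h)
        · simp [hg, hwy.symm]
        · simp [hg, hwy.symm, he x' x]
        · exact absurd rfl (K.ne h)
    obtain ⟨f, hf⟩ := K.pot e' (fun x x' => by
        simp only [he']
        rw [if_congr (or_comm) rfl rfl]
        split_ifs
        · exact he _ _
        · ring) (fun x x' x'' h => by
        by_cases hS' : x ∈ S ∨ x' ∈ S ∨ x'' ∈ S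
        · rw [hee' _ _ _ h hS', hee' _ _ _ (K.rot h) (by tauto), hee' _ _ _ (K.rot2 h) (by tauto)]
          exact hclosed _ _ _ ⟨h, hS'⟩
        · push Not at hS'
          simp [he', hS'])
    exact ⟨f, fun x x' x'' h => by rw [hf _ _ _ h.1, hee' _ _ _ h.1 h.2]⟩

/-- A chord separates the disc. -/
theorem exists_separation (K : TriDisc V D) {w y z z' t t' : α} (hw : Bd D t w) (hy : Bd D t' y)
    (hz : D w y z) (hz' : D y w z') : ∃ S ⊆ V, w ∉ S ∧ y ∉ S ∧ z ∈ S ∧ z' ∉ S ∧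
    ∀ x x' x'', D x x' x'' → x ≠ w → x ≠ y → x' ≠ w → x' ≠ y → (x ∈ S ↔ x' ∈ S) := by
  have hwy : w ≠ y := K.ne hz
  have acw := K.link_acyclic hw
  have acy := K.link_acyclic hy
  set κ : α → α → ℝ := fun x x' =>
    if (x = w ∧ Relation.TransGen (D w) y x') ∨ (x = y ∧ Relation.TransGen (D y) x' w)
    then 1 else 0 with hκ
  have κ0 : ∀ x x', x ≠ w → x ≠ y → κ x x' = 0 := fun x x' h h' => by simp [hκ, h, h']
  have κw : ∀ x, κ w x = if Relation.TransGen (D w) y x then 1 else 0 := fun x => by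
    simp [hκ, hwy]
  have κy : ∀ x, κ y x = if Relation.TransGen (D y) x w then 1 else 0 := fun x => by
    simp [hκ, hwy.symm]
  have κwy : κ w y = 0 := by rw [κw, if_neg (acw y)]
  have κyw : κ y w = 0 := by rw [κy, if_neg (acy w)]
  have stepw : ∀ x x', D w x x' → x ≠ y → κ w x = κ w x' := by
    intro x x' h hx
    rw [κw, κw]
    refine if_congr ⟨fun h' => h'.tail h, fun h' => ?_⟩ rfl rfl
    obtain ⟨c, hc, h2⟩ := Relation.TransGen.tail'_iff.1 h'
    rw [K.uniq_pred h2 h] at hc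
    rcases hc.cases_tail with e | ⟨d, hd, hd'⟩
    · exact absurd e hx
    · exact Relation.TransGen.tail' hd hd'
  have stepy : ∀ x x', D y x x' → x' ≠ w → κ y x = κ y x' := by
    intro x x' h hx
    rw [κy, κy]
    refine if_congr ⟨fun h' => ?_, fun h' => h'.head h⟩ rfl rfl
    obtain ⟨c, hc, h2⟩ := Relation.TransGen.head'_iff.1 h'
    rw [← K.uniq h hc] at h2
    rcases h2.cases_head with e | ⟨d, hd, hd'⟩
    · exact absurd e hx
    · exact Relation.TransGen.head' hd hd'
  have left_w : ∀ x, D w y x → κ w x = 1 := fun x h => by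
    rw [κw, if_pos (Relation.TransGen.single h)]
  have left_y : ∀ x, D w y x → κ y x = 1 := fun x h => by
    rw [κy, if_pos (Relation.TransGen.single (K.rot h))]
  have right_w : ∀ x, D y w x → κ w x = 0 := fun x h => by
    rw [κw, if_neg]
    exact fun h' => acw y (h'.tail (K.rot h))
  have right_y : ∀ x, D y w x → κ y x = 0 := fun x h => by
    rw [κy, if_neg]
    exact fun h' => acy w (h'.head h)
  have facew : ∀ x x', D w x x' → κ w x + κ x x' + κ x' w = κ x w + κ x' x + κ w x' := by
    intro x x' h
    by_cases hx : x = y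
    · subst hx
      rw [κwy, κyw, left_w _ h, left_y _ h, κ0 x' w (K.ne3 h) (K.ne2 h).symm,
        κ0 x' x (K.ne3 h) (K.ne2 h).symm]
      norm_num
    · by_cases hx' : x' = y
      · subst hx'
        have h' := K.rot2 h
        rw [κwy, κyw, right_w _ h', right_y _ h', κ0 x w (K.ne h).symm hx,
          κ0 x x' (K.ne h).symm hx]
      · rw [κ0 x _ (K.ne h).symm hx, κ0 x _ (K.ne h).symm hx, κ0 x' _ (K.ne3 h) hx',
          κ0 x' _ (K.ne3 h) hx', stepw x x' h hx]
        ring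
  have facey : ∀ x x', D y x x' → κ y x + κ x x' + κ x' y = κ x y + κ x' x + κ y x' := by
    intro x x' h
    by_cases hx : x = w
    · subst hx
      have := facew _ _ (K.rot h)
      linarith
    · by_cases hx' : x' = w
      · subst hx'
        have := facew _ _ (K.rot2 h)
        linarith
      · rw [κ0 x _ hx (K.ne h).symm, κ0 x _ hx (K.ne h).symm, κ0 x' _ hx' (K.ne3 h),
          κ0 x' _ hx' (K.ne3 h), stepy x x' h hx']
        ring
  obtain ⟨f, hf⟩ := K.pot (fun x x' => κ x x' - κ x' x) (fun x x' => by ring) (by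
    intro x x' x'' h
    by_cases h1 : x = w
    · subst h1; linarith [facew _ _ h]
    by_cases h2 : x' = w
    · subst h2; linarith [facew _ _ (K.rot h)]
    by_cases h3 : x'' = w
    · subst h3; linarith [facew _ _ (K.rot2 h)]
    by_cases h4 : x = y
    · subst h4; linarith [facey _ _ h]
    by_cases h5 : x' = y
    · subst h5; linarith [facey _ _ (K.rot h)]
    by_cases h6 : x'' = y
    · subst h6; linarith [facey _ _ (K.rot2 h)]
    simp [κ0, h1, h2, h3, h4, h5, h6])
  have fy : f y = f w := by have := hf _ _ _ hz; rw [κwy, κyw] at this; linarith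
  refine ⟨V.filter (fun x => f x ≠ f w), Finset.filter_subset _ _, ?_, ?_, ?_, ?_, ?_⟩
  · simp
  · simp [fy]
  · rw [Finset.mem_filter]
    refine ⟨K.mem3 hz, fun h => ?_⟩
    have := hf _ _ _ (K.rot2 hz)
    rw [left_w _ hz, κ0 z w (K.ne3 hz) (K.ne2 hz).symm] at this
    linarith
  · simp only [Finset.mem_filter, not_and, not_not]
    intro _
    have := hf _ _ _ (K.rot hz')
    rw [right_w _ hz', κ0 z' w (K.ne2 hz').symm (K.ne3 hz')] at this
    linarith
  · intro x x' x'' h h1 h2 h3 h4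
    have := hf _ _ _ h
    rw [κ0 _ _ h1 h2, κ0 _ _ h3 h4] at this
    have e : f x' = f x := by linarith
    simp [Finset.mem_filter, K.mem h, K.mem2 h, e]

/-- Every disc has a boundary vertex off a given boundary edge that is not an end of a chord. -/
theorem exists_chordless : ∀ (n : ℕ) (V : Finset α) (D : α → α → α → Prop), V.card = n →
    TriDisc V D → ∀ a b c, D a b c → ¬ Side D b a →
    ∃ w, (∃ t, Bd D t w) ∧ w ≠ a ∧ w ≠ b ∧
      ∀ y, Side D w y → Side D y w → ∀ t, ¬ Bd D t y := by
  intro n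
  induction n using Nat.strong_induction_on with
  | _ n ih =>
  intro V D hn K a b c habc hba
  obtain ⟨w, hw⟩ := K.exists_bd_out (w := b) (t := a) ⟨⟨c, habc⟩, hba⟩
  by_cases hch : ∀ y, Side D w y → Side D y w → ∀ t, ¬ Bd D t y
  · exact ⟨w, ⟨b, hw⟩, by rintro rfl; exact hba hw.1, (K.bd_ne hw).symm, hch⟩
  push Not at hch
  obtain ⟨y, ⟨z, hz⟩, ⟨z', hz'⟩, t, hy⟩ := hch
  -- cut off the side of the chord that does not contain the base face
  have main : ∀ w y z z' (S : Finset α), S ⊆ V → w ∉ S → y ∉ S → z ∈ S → z' ∉ S →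
      D w y z → D y w z' →
      (∀ x x' x'', D x x' x'' → x ≠ w → x ≠ y → x' ≠ w → x' ≠ y → (x ∈ S ↔ x' ∈ S)) →
      a ∉ S → b ∉ S → ∃ w, (∃ t, Bd D t w) ∧ w ≠ a ∧ w ≠ b ∧
        ∀ y, Side D w y → Side D y w → ∀ t, ¬ Bd D t y := by
    intro w y z z' S hSV hw hy hzS hz'S hz hz' hS haS hbS
    have K2 := K.cut hSV hw hy hS hz hzS
    set D2 : α → α → α → Prop := fun p q r => D p q r ∧ (p ∈ S ∨ q ∈ S ∨ r ∈ S) with hD2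
    have hside : ∀ p q, (p ∈ S ∨ q ∈ S) → (Side D2 p q ↔ Side D p q) := by
      intro p q hpq
      exact ⟨fun ⟨r, h⟩ => ⟨r, h.1⟩, fun ⟨r, h⟩ => ⟨r, h, by tauto⟩⟩
    have hbd : ∀ p q, (p ∈ S ∨ q ∈ S) → (Bd D2 p q ↔ Bd D p q) := by
      intro p q hpq
      unfold Bd
      rw [hside p q hpq, hside q p hpq.symm]
    have hyw : ¬ Side D2 y w := by
      rintro ⟨r, h, h'⟩
      rw [← K.uniq hz' h] at h'
      tauto
    have hcard : (S ∪ {w, y}).card < n := by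
      rw [← hn]
      refine Finset.card_lt_card ⟨?_, fun h => ?_⟩
      · intro x hx
        simp only [Finset.mem_union, Finset.mem_insert, Finset.mem_singleton] at hx
        rcases hx with hx | rfl | rfl
        · exact hSV hx
        · exact K.mem hz
        · exact K.mem2 hz
      · have := h (K.mem3 hz')
        simp only [Finset.mem_union, Finset.mem_insert, Finset.mem_singleton] at this
        rcases this with h | h | h
        · exact hz'S h
        · exact (K.ne2 hz').symm h
        · exact K.ne3 hz' h
    have hbase : D2 w y z := ⟨hz, by tauto⟩
    obtain ⟨v, ⟨t, ht⟩, hvw, hvy, hv⟩ := ih _ hcard _ D2 rfl K2 w y z hbase hyw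
    have hvS : v ∈ S := by
      have := (K2.bd_mem ht).2
      simpa [hvw, hvy] using this
    refine ⟨v, ⟨t, (hbd _ _ (Or.inr hvS)).1 ht⟩, by rintro rfl; exact haS hvS,
      by rintro rfl; exact hbS hvS, fun x h1 h2 t' ht' => ?_⟩
    have h1' := (hside _ _ (Or.inl hvS)).2 h1
    have h2' := (hside _ _ (Or.inr hvS)).2 h2
    suffices h : ∃ s, Bd D2 s x by
      obtain ⟨s, hs⟩ := h
      exact hv x h1' h2' s hs
    by_cases hxS : x ∈ S
    · exact ⟨t', (hbd _ _ (Or.inr hxS)).2 ht'⟩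
    · have hx : x ∈ S ∪ {w, y} := by
        obtain ⟨r, hr⟩ := h2'
        exact K2.mem hr
      simp only [Finset.mem_union, Finset.mem_insert, Finset.mem_singleton] at hx
      rcases hx with hx | rfl | rfl
      · exact absurd hx hxS
      · exact K2.exists_bd_in ⟨⟨z, hbase⟩, hyw⟩
      · exact ⟨w, ⟨z, hbase⟩, hyw⟩
  obtain ⟨S, hSV, hwS, hyS, hzS, hz'S, hS⟩ := K.exists_separation hw hy hz hz'
  by_cases hab : a ∈ S ∨ b ∈ S
  · refine main y w z' z (V.filter (fun x => x ∉ S ∧ x ≠ w ∧ x ≠ y)) (Finset.filter_subset _ _)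
      (by simp) (by simp) ?_ (by simp [hzS]) hz' hz ?_ ?_ ?_
    · rw [Finset.mem_filter]
      exact ⟨K.mem3 hz', hz'S, (K.ne2 hz').symm, K.ne3 hz'⟩
    · intro x x' x'' h h1 h2 h3 h4
      simp [Finset.mem_filter, K.mem h, K.mem2 h, hS x x' x'' h h2 h1 h4 h3, h1, h2, h3, h4]
    all_goals
      simp only [Finset.mem_filter, not_and]
      intro _ h1 h2 h3
      first
      | exact h3 (by
          by_contra h4
          have hb : b ∈ S := by tauto
          exact h1 ((hS a b c habc h2 h4 (by rintro rfl; exact hwS hb)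
            (by rintro rfl; exact hyS hb)).2 hb))
      | exact h3 (by
          by_contra h4
          have ha : a ∈ S := by tauto
          exact h1 ((hS a b c habc (by rintro rfl; exact hwS ha)
            (by rintro rfl; exact hyS ha) h2 h4).1 ha))
  · push Not at hab
    exact main w y z z' S hSV hwS hyS hzS hz'S hz hz' hS hab.1 hab.2

end TriDisc

end

section

namespace TriDisc

variable {α : Type*} {V : Finset α} {D : α → α → α → Prop}

theorem link_of_ear (K : TriDisc V D) {x y z t : α} (h : D x y z) (hyx : ¬ Side D y x)
    (hxz : ¬ Side D x z) (ht : Nbr D x t) : t = y ∨ t = z := by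
  refine K.link_closed x (fun t => t = y ∨ t = z) (fun p q hpq => ⟨?_, ?_⟩)
    (Or.inl ⟨z, h⟩) ht (Or.inl rfl)
  · rintro (rfl | rfl)
    · exact Or.inr (K.uniq hpq h)
    · exact absurd ⟨q, hpq⟩ hxz
  · rintro (rfl | rfl)
    · exact absurd ⟨p, K.rot2 hpq⟩ hyx
    · exact Or.inl (K.uniq_pred hpq h)

/-- A face without neighboring faces is the whole disc. -/
theorem subset_of_isolated_face (K : TriDisc V D) {x y z : α} (h : D x y z)
    (hxy : ¬ Side D y x) (hyz : ¬ Side D z y) (hzx : ¬ Side D x z) : V ⊆ {x, y, z} := by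
  intro t ht
  have := K.conn_closed (fun t => t = x ∨ t = y ∨ t = z) (fun p q r hpq => ?_) (K.mem h) ht
    (Or.inl rfl)
  · simpa using this
  · rintro (rfl | rfl | rfl)
    · have := K.link_of_ear h hxy hzx (Or.inl ⟨r, hpq⟩)
      tauto
    · have := K.link_of_ear (K.rot h) hyz hxy (Or.inl ⟨r, hpq⟩)
      tauto
    · have := K.link_of_ear (K.rot2 h) hzx hyz (Or.inl ⟨r, hpq⟩)
      tauto

/-- Removing a boundary vertex that is not an end of a chord. -/
theorem erase (K : TriDisc V D) {w t : α} (hw : Bd D t w)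
    (hch : ∀ y, Side D w y → Side D y w → ∀ t, ¬ Bd D t y)
    (hopp : ∀ x y, D w x y → ∃ z, D y x z ∧ z ≠ w) :
    TriDisc (V.erase w) (fun p q r => D p q r ∧ p ≠ w ∧ q ≠ w ∧ r ≠ w) := by
  have acw := K.link_acyclic hw
  refine ⟨fun h => Finset.mem_erase.2 ⟨h.2.1, K.mem h.1⟩, fun h => ⟨K.rot h.1, by tauto⟩,
    fun h => K.ne h.1, fun h h' => K.uniq h.1 h'.1, ?_, ?_, ?_⟩
  · intro f hf
    obtain ⟨s, hs⟩ := K.exists_bd_out hw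
    have hl : ∀ x y, D w x y → f x = f y := by
      intro x y h
      obtain ⟨z, hz, hzw⟩ := hopp x y h
      exact (hf y x z ⟨hz, K.ne3 h, (K.ne h).symm, hzw⟩).symm
    have hl' : ∀ x, Nbr D w x → f x = f s := fun x hx => K.link w f hl x s hx (Or.inl hs.1)
    have := K.conn (Function.update f w (f s)) (fun x y z h => by
      by_cases hx : x = w
      · subst hx
        rw [Function.update_self, Function.update_of_ne (K.ne h).symm]
        exact (hl' y (Or.inl ⟨z, h⟩)).symm
      by_cases hy : y = w
      · subst hy
        rw [Function.update_self, Function.update_of_ne (K.ne h)]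
        exact hl' x (Or.inr ⟨z, h⟩)
      rw [Function.update_of_ne hx, Function.update_of_ne hy]
      by_cases hz : z = w
      · subst hz
        exact hl _ _ (K.rot2 h)
      · exact hf x y z ⟨h, hx, hy, hz⟩)
    intro x hx y hy
    have := this x (Finset.mem_of_mem_erase hx) y (Finset.mem_of_mem_erase hy)
    rwa [Function.update_of_ne (Finset.ne_of_mem_erase hx),
      Function.update_of_ne (Finset.ne_of_mem_erase hy)] at this
  · intro v g hg x y hx hy
    have hvw : v ≠ w := by
      rcases hx with ⟨z, h⟩ | ⟨z, h⟩
      · exact h.2.1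
      · exact h.2.2.1
    have hN : ∀ x, Nbr (fun p q r => D p q r ∧ p ≠ w ∧ q ≠ w ∧ r ≠ w) v x →
        Nbr D v x ∧ x ≠ w := by
      rintro x (⟨z, h⟩ | ⟨z, h⟩)
      · exact ⟨Or.inl ⟨z, h.1⟩, h.2.2.1⟩
      · exact ⟨Or.inr ⟨z, h.1⟩, h.2.1⟩
    refine K.link_erase (z := w) ?_ g (fun p q h hp hq => hg p q ⟨h, hvw, hp, hq⟩)
      (hN x hx).1 (hN y hy).1 (hN x hx).2 (hN y hy).2
    by_cases h1 : Side D v w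
    · by_cases h2 : Side D w v
      · right; right
        have hb := hch v h2 h1
        intro p hp
        by_contra hn
        rcases hp with hp | hp
        · obtain ⟨q, hq⟩ := K.exists_bd_in (w := v) (t := p) ⟨hp, fun h => hn ⟨hp, h⟩⟩
          exact hb q hq
        · exact hb p ⟨hp, fun h => hn ⟨h, hp⟩⟩
      · exact Or.inr (Or.inl h2)
    · exact Or.inl h1
  · intro e he hclosed
    set g : α → ℝ := fun x => ∑ y ∈ V, if Relation.ReflTransGen (D w) y x then
      ∑ z ∈ V, (if D w z y then e z y else 0) else 0 with hg
    have hstep : ∀ x y, D w x y → g y - g x = e x y := by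
      intro x y h
      have h1 : ∀ t, Relation.ReflTransGen (D w) t y ↔ Relation.ReflTransGen (D w) t x ∨ t = y := by
        intro t
        constructor
        · intro h'
          rcases h'.cases_tail with rfl | ⟨c, hc, hcy⟩
          · exact Or.inr rfl
          · rw [K.uniq_pred hcy h] at hc
            exact Or.inl hc
        · rintro (h' | rfl)
          · exact h'.tail h
          · exact Relation.ReflTransGen.refl
      have h2 : ¬ Relation.ReflTransGen (D w) y x := fun h' => acw y (Relation.TransGen.tail' h' h)
      have h3 : ∑ z ∈ V, (if D w z y then e z y else 0) = e x y := by
        rw [Finset.sum_eq_single x, if_pos h]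
        · intro b _ hb
          rw [if_neg]
          exact fun h' => hb (K.uniq_pred h' h)
        · exact fun h' => absurd (K.mem2 h) h'
      have h4 : g y - g x = ∑ t ∈ V, if t = y then e x y else 0 := by
        simp only [hg]
        rw [← Finset.sum_sub_distrib]
        refine Finset.sum_congr rfl fun t _ => ?_
        by_cases ht : t = y
        · subst ht
          rw [if_pos Relation.ReflTransGen.refl, if_neg h2, if_pos rfl, h3, sub_zero]
        · rw [if_neg ht, if_congr ((h1 t).trans (or_iff_left ht)) rfl rfl, sub_self]
      rw [h4, Finset.sum_ite_eq' V y, if_pos (K.mem3 h)]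
    set e' : α → α → ℝ := fun x y => if x = w then (if y = w then 0 else g y) else
      if y = w then - g x else e x y with he'
    have hface : ∀ x y, D w x y → e' w x + e' x y + e' y w = 0 := by
      intro x y h
      simp only [he', if_pos, if_neg (K.ne h).symm, if_neg (K.ne3 h)]
      linarith [hstep x y h]
    obtain ⟨f, hf⟩ := K.pot e' (fun x y => by
        simp only [he']
        split_ifs
        · simp
        · simp
        · simp
        · exact he _ _) (fun x y z h => by
        by_cases hx : x = w
        · subst hx; exact hface _ _ h
        by_cases hy : y = w
        · subst hy; linarith [hface _ _ (K.rot h)]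
        by_cases hz : z = w
        · subst hz; linarith [hface _ _ (K.rot2 h)]
        simp only [he', if_neg hx, if_neg hy, if_neg hz]
        exact hclosed _ _ _ ⟨h, hx, hy, hz⟩)
    refine ⟨f, fun x y z h => ?_⟩
    rw [hf _ _ _ h.1]
    simp only [he', if_neg h.2.1, if_neg h.2.2.1]

end TriDisc

/-- Twice the signed area of the triangle `p q r`. -/
def det3 (p q r : ℝ × ℝ) : ℝ := (q.1 - p.1) * (r.2 - p.2) - (q.2 - p.2) * (r.1 - p.1)

theorem det3_rot (p q r : ℝ × ℝ) : det3 q r p = det3 p q r := by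
  unfold det3; ring

/-- A straight-line realization of a disc with positively oriented faces whose upper boundary,
opposite to the base `a b`, is monotone. -/
structure Realizes {α : Type*} (V : Finset α) (D : α → α → α → Prop) (a b : α)
    (P : α → ℝ × ℝ) : Prop where
  inj : ∀ x ∈ V, ∀ y ∈ V, P x = P y → x = y
  base : (P a).1 < (P b).1
  face : ∀ x y z, D x y z → 0 < det3 (P x) (P y) (P z)
  top : ∀ x y, Bd D x y → ¬ (x = a ∧ y = b) → (P y).1 < (P x).1

namespace TriDisc

variable {α : Type*}

theorem realizes_triangle {V : Finset α} {D : α → α → α → Prop} (K : TriDisc V D) {a b c : α}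
    (h : D a b c) (hba : ¬ Side D b a) (hV : V ⊆ {a, b, c}) : ∃ P, Realizes V D a b P := by
  have hab := K.ne h
  have hbc := K.ne2 h
  have hca := K.ne3 h
  have hbac : ¬ D b a c := fun h => hba ⟨c, h⟩
  have hV' : ∀ {x}, x ∈ V → x = a ∨ x = b ∨ x = c := fun hx => by simpa using hV hx
  obtain ⟨P, hPa, hPb, hPc⟩ : ∃ P : α → ℝ × ℝ, P a = (0, 0) ∧ P b = (1, 0) ∧ P c = (1 / 2, 1) :=
    ⟨fun x => if x = a then (0, 0) else if x = b then (1, 0) else (1 / 2, 1), by simp,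
      by simp [hab.symm], by simp [hca, hbc.symm]⟩
  have hcb : ¬ Side D c b := by
    rintro ⟨r, hr⟩
    rcases hV' (K.mem3 hr) with rfl | rfl | rfl
    · exact hbac (K.rot hr)
    · exact K.ne2 hr rfl
    · exact K.ne3 hr rfl
  have hac : ¬ Side D a c := by
    rintro ⟨r, hr⟩
    rcases hV' (K.mem3 hr) with rfl | rfl | rfl
    · exact K.ne3 hr rfl
    · exact hbac (K.rot2 hr)
    · exact K.ne2 hr rfl
  refine ⟨P, ?_, by simp [hPa, hPb], ?_, ?_⟩
  · intro x hx y hy hxy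
    rcases hV' hx with rfl | rfl | rfl <;> rcases hV' hy with rfl | rfl | rfl <;>
      first
      | rfl
      | (exfalso; rw [hPa, hPb] at hxy; norm_num at hxy)
      | (exfalso; rw [hPa, hPc] at hxy; norm_num at hxy)
      | (exfalso; rw [hPb, hPc] at hxy; norm_num at hxy)
  · intro x y z hxyz
    have h1 := K.ne hxyz
    have h2 : Side D x y := ⟨z, hxyz⟩
    rcases hV' (K.mem hxyz) with rfl | rfl | rfl <;>
    rcases hV' (K.mem2 hxyz) with rfl | rfl | rfl <;>
    first
    | exact absurd rfl h1
    | exact absurd h2 hba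
    | exact absurd h2 hcb
    | exact absurd h2 hac
    | skip
    · rw [K.uniq hxyz h, hPa, hPb, hPc]; norm_num [det3]
    · rw [K.uniq hxyz (K.rot h), hPa, hPb, hPc]; norm_num [det3]
    · rw [K.uniq hxyz (K.rot2 h), hPa, hPb, hPc]; norm_num [det3]
  · intro x y hxy hne
    have h1 := K.bd_ne hxy
    rcases hV' (K.bd_mem hxy).1 with rfl | rfl | rfl <;>
    rcases hV' (K.bd_mem hxy).2 with rfl | rfl | rfl <;>
    first
    | exact absurd rfl h1
    | exact absurd hxy.1 hba
    | exact absurd hxy.1 hcb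
    | exact absurd hxy.1 hac
    | exact absurd ⟨rfl, rfl⟩ hne
    | skip
    · rw [hPb, hPc]; norm_num
    · rw [hPc, hPa]; norm_num

theorem eventually_linear_pos {c : ℝ} (hc : 0 < c) (d : ℝ) :
    ∀ᶠ Y in Filter.atTop, 0 < c * Y + d := by
  filter_upwards [Filter.eventually_gt_atTop (-d / c)] with Y hY
  rw [div_lt_iff₀ hc] at hY
  linarith

/-- Every combinatorial disc has a straight-line realization. -/
theorem exists_realizes : ∀ (n : ℕ) (V : Finset α) (D : α → α → α → Prop), V.card = n →
    TriDisc V D → ∀ a b c, D a b c → ¬ Side D b a → ∃ P, Realizes V D a b P := by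
  intro n
  induction n using Nat.strong_induction_on with
  | _ n ih =>
  intro V D hn K a b c habc hba
  obtain ⟨w, ⟨p, hp⟩, hwa, hwb, hch⟩ := exists_chordless n V D hn K a b c habc hba
  have acw := K.link_acyclic hp
  have hnoboth : ∀ x y, D w x y → ¬ D w y x := fun x y h h' =>
    acw x (Relation.TransGen.head h (Relation.TransGen.single h'))
  by_cases hopp : ∀ x y, D w x y → ∃ z, D y x z ∧ z ≠ w
  swap
  · push Not at hopp
    obtain ⟨x, y, hxy, hz⟩ := hopp
    have hyx : ¬ Side D y x := by
      rintro ⟨z, h⟩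
      rw [hz z h] at h
      exact hnoboth _ _ hxy (K.rot2 h)
    have hbd : Bd D x y := ⟨⟨w, K.rot hxy⟩, hyx⟩
    obtain ⟨t, ht⟩ := K.exists_bd_in hbd
    have hxw : ¬ Side D x w := fun h => hch x ⟨y, hxy⟩ h t ht
    have hwy : ¬ Side D w y := fun h => hch y h ⟨x, K.rot2 hxy⟩ x hbd
    have hV := K.subset_of_isolated_face hxy hxw hyx hwy
    have hsub : ({a, b, c} : Finset α) ⊆ V := by
      intro t ht
      simp only [Finset.mem_insert, Finset.mem_singleton] at ht
      rcases ht with rfl | rfl | rfl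
      · exact K.mem habc
      · exact K.mem2 habc
      · exact K.mem3 habc
    have hc3 : ({a, b, c} : Finset α).card = 3 :=
      Finset.card_eq_three.2 ⟨a, b, c, K.ne habc, (K.ne3 habc).symm, K.ne2 habc, rfl⟩
    have := Finset.eq_of_subset_of_card_le hsub
      (((Finset.card_le_card hV).trans Finset.card_le_three).trans hc3.ge)
    exact K.realizes_triangle habc hba this.ge
  have K' := K.erase hp hch hopp
  set D' : α → α → α → Prop := fun p q r => D p q r ∧ p ≠ w ∧ q ≠ w ∧ r ≠ w with hD'
  have hcw : c ≠ w := by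
    rintro rfl
    obtain ⟨z, hz, _⟩ := hopp a b (K.rot2 habc)
    exact hba ⟨z, hz⟩
  have hlt : (V.erase w).card < n := by
    rw [← hn]
    exact Finset.card_erase_lt_of_mem (K.bd_mem hp).2
  obtain ⟨P, hP⟩ := ih _ hlt (V.erase w) D' rfl K' a b c ⟨habc, hwa.symm, hwb.symm, hcw⟩
    (fun ⟨z, h⟩ => hba ⟨z, h.1⟩)
  obtain ⟨s, hs⟩ := K.exists_bd_out hp
  have hmono : ∀ x y, D w x y → (P x).1 < (P y).1 := by
    intro x y h
    obtain ⟨z, hz, hzw⟩ := hopp x y h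
    refine hP.top y x ⟨⟨z, hz, K.ne3 h, (K.ne h).symm, hzw⟩, ?_⟩ ?_
    · rintro ⟨z', h', _, _, h''⟩
      exact h'' (K.uniq h' (K.rot h))
    · rintro ⟨rfl, rfl⟩
      exact hba ⟨w, K.rot h⟩
  have hsp : (P s).1 < (P p).1 := by
    have h1 : Relation.ReflTransGen (D w) s p := by
      refine K.link_closed w (fun x => Relation.ReflTransGen (D w) s x) (fun x y h => ⟨fun h' =>
        h'.tail h, fun h' => ?_⟩) (Or.inl hs.1) (Or.inr hp.1) Relation.ReflTransGen.refl
      rcases h'.cases_tail with rfl | ⟨d, hd, hd'⟩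
      · exact absurd ⟨x, K.rot2 h⟩ hs.2
      · rwa [K.uniq_pred h hd']
    have h2 : ∀ y, Relation.TransGen (D w) s y → (P s).1 < (P y).1 := by
      intro y h
      induction h with
      | single h => exact hmono _ _ h
      | tail _ h ih => exact ih.trans (hmono _ _ h)
    rcases Relation.reflTransGen_iff_eq_or_transGen.1 h1 with rfl | h
    · exact absurd hs.1 hp.2
    · exact h2 _ h
  set m := ((P s).1 + (P p).1) / 2 with hm
  have ev1 : ∀ᶠ Y in Filter.atTop, ∀ x ∈ V, (P x).2 < Y :=
    (Filter.eventually_all_finset V).2 fun x _ => Filter.eventually_gt_atTop _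
  have ev2 : ∀ᶠ Y in Filter.atTop, ∀ x ∈ V, ∀ y ∈ V, D w x y →
      0 < det3 (m, Y) (P x) (P y) := by
    refine (Filter.eventually_all_finset V).2 fun x _ =>
      (Filter.eventually_all_finset V).2 fun y _ => ?_
    by_cases h : D w x y
    · filter_upwards [eventually_linear_pos (sub_pos.2 (hmono x y h))
        (((P x).1 - m) * (P y).2 - (P x).2 * ((P y).1 - m))] with Y hY _
      unfold det3
      linarith
    · exact Filter.Eventually.of_forall fun _ h' => absurd h' h
  obtain ⟨Y, hY1, hY2⟩ := (ev1.and ev2).exists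
  have hPw : ∀ x, x ≠ w → Function.update P w (m, Y) x = P x := fun x hx =>
    Function.update_of_ne hx _ _
  have hww : Function.update P w (m, Y) w = (m, Y) := Function.update_self _ _ _
  refine ⟨Function.update P w (m, Y), ?_, ?_, ?_, ?_⟩
  · intro x hx y hy hxy
    by_cases hxw : x = w <;> by_cases hyw : y = w
    · rw [hxw, hyw]
    · rw [hxw, hww, hPw y hyw] at hxy
      have := hY1 y hy
      rw [← hxy] at this
      exact absurd this (lt_irrefl _)
    · rw [hyw, hww, hPw x hxw] at hxy
      have := hY1 x hx
      rw [hxy] at this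
      exact absurd this (lt_irrefl _)
    · rw [hPw x hxw, hPw y hyw] at hxy
      exact hP.inj x (Finset.mem_erase.2 ⟨hxw, hx⟩) y (Finset.mem_erase.2 ⟨hyw, hy⟩) hxy
  · rw [hPw a hwa.symm, hPw b hwb.symm]
    exact hP.base
  · have hface : ∀ x y, D w x y → 0 < det3 (Function.update P w (m, Y) w)
        (Function.update P w (m, Y) x) (Function.update P w (m, Y) y) := by
      intro x y h
      rw [hww, hPw x (K.ne h).symm, hPw y (K.ne3 h)]
      exact hY2 x (K.mem2 h) y (K.mem3 h) h
    intro x y z h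
    by_cases hx : x = w
    · subst hx; exact hface _ _ h
    by_cases hy : y = w
    · subst hy; rw [← det3_rot]; exact hface _ _ (K.rot h)
    by_cases hz : z = w
    · subst hz; rw [det3_rot]; exact hface _ _ (K.rot2 h)
    rw [hPw x hx, hPw y hy, hPw z hz]
    exact hP.face x y z ⟨h, hx, hy, hz⟩
  · intro x y hxy hne
    by_cases hx : x = w
    · subst hx
      rw [K.bd_out_unique hxy hs, hww, hPw s (K.bd_ne hs).symm]
      change (P s).1 < m
      rw [hm]; linarith
    by_cases hy : y = w
    · subst hy
      rw [K.bd_in_unique hxy hp, hww, hPw p (K.bd_ne hp)]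
      change m < (P p).1
      rw [hm]; linarith
    rw [hPw x hx, hPw y hy]
    refine hP.top x y ⟨?_, fun ⟨z, h⟩ => hxy.2 ⟨z, h.1⟩⟩ hne
    obtain ⟨z, hz⟩ := hxy.1
    refine ⟨z, hz, hx, hy, ?_⟩
    rintro rfl
    obtain ⟨z', h', _⟩ := hopp x y (K.rot2 hz)
    exact hxy.2 ⟨z', h'⟩

end TriDisc

end

section

theorem det3_swap (p q r : ℝ × ℝ) : det3 q p r = - det3 p q r := by
  unfold det3; ring

theorem det3_self (p r : ℝ × ℝ) : det3 p p r = 0 := by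
  unfold det3; ring

theorem det3_left (p q : ℝ × ℝ) : det3 p q p = 0 := by
  unfold det3; ring

theorem det3_right (p q : ℝ × ℝ) : det3 p q q = 0 := by
  unfold det3; ring

theorem det3_comb (p q x y : ℝ × ℝ) {s t : ℝ} (h : s + t = 1) :
    det3 p q (s • x + t • y) = s * det3 p q x + t * det3 p q y := by
  obtain rfl : s = 1 - t := by linarith
  simp only [det3, Prod.fst_add, Prod.snd_add, Prod.smul_fst, Prod.smul_snd, smul_eq_mul]
  ring

theorem det3_sum (p q r z : ℝ × ℝ) : det3 p q z + det3 q r z + det3 r p z = det3 p q r := by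
  unfold det3; ring

theorem det3_bary (p q r z : ℝ × ℝ) :
    det3 p q r • z = det3 q r z • p + det3 r p z • q + det3 p q z • r := by
  ext <;> simp only [det3, Prod.fst_add, Prod.snd_add, Prod.smul_fst, Prod.smul_snd,
    smul_eq_mul] <;> ring

theorem det3_add_smul (p q z v : ℝ × ℝ) (t : ℝ) :
    det3 p q (z + t • v) = det3 p q z + t * ((q.1 - p.1) * v.2 - (q.2 - p.2) * v.1) := by
  simp only [det3, Prod.fst_add, Prod.snd_add, Prod.smul_fst, Prod.smul_snd, smul_eq_mul]
  ring

@[fun_prop]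
theorem continuous_det3 (p q : ℝ × ℝ) : Continuous (det3 p q) := by
  unfold det3; fun_prop

theorem det3_segment {p q z : ℝ × ℝ} (h : z ∈ segment ℝ p q) : det3 p q z = 0 := by
  obtain ⟨s, t, _, _, hst, rfl⟩ := h
  rw [det3_comb _ _ _ _ hst, det3_left, det3_right]
  ring

/-- The closed triangle with positively oriented corners `p q r`. -/
def cTri (p q r : ℝ × ℝ) : Set (ℝ × ℝ) := {z | 0 ≤ det3 p q z ∧ 0 ≤ det3 q r z ∧ 0 ≤ det3 r p z}

/-- The open triangle with positively oriented corners `p q r`. -/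
def oTri (p q r : ℝ × ℝ) : Set (ℝ × ℝ) := {z | 0 < det3 p q z ∧ 0 < det3 q r z ∧ 0 < det3 r p z}

theorem cTri_rot (p q r : ℝ × ℝ) : cTri q r p = cTri p q r := by
  ext z; simp only [cTri, Set.mem_ofPred_eq]; tauto

theorem oTri_rot (p q r : ℝ × ℝ) : oTri q r p = oTri p q r := by
  ext z; simp only [oTri, Set.mem_ofPred_eq]; tauto

theorem oTri_subset_cTri (p q r : ℝ × ℝ) : oTri p q r ⊆ cTri p q r :=
  fun _ h => ⟨h.1.le, h.2.1.le, h.2.2.le⟩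

theorem isOpen_oTri (p q r : ℝ × ℝ) : IsOpen (oTri p q r) :=
  (isOpen_lt continuous_const (continuous_det3 _ _)).inter
    ((isOpen_lt continuous_const (continuous_det3 _ _)).inter
      (isOpen_lt continuous_const (continuous_det3 _ _)))

theorem isClosed_cTri (p q r : ℝ × ℝ) : IsClosed (cTri p q r) :=
  (isClosed_le continuous_const (continuous_det3 _ _)).inter
    ((isClosed_le continuous_const (continuous_det3 _ _)).inter
      (isClosed_le continuous_const (continuous_det3 _ _)))

theorem convex_det3_pos (p q : ℝ × ℝ) : Convex ℝ {z | 0 < det3 p q z} := by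
  intro x hx y hy s t hs ht hst
  simp only [Set.mem_ofPred_eq] at *
  rw [det3_comb _ _ _ _ hst]
  rcases hs.eq_or_lt with rfl | hs
  · obtain rfl : t = 1 := by linarith
    simpa using hy
  · have := mul_pos hs hx
    have := mul_nonneg ht hy.le
    linarith

theorem convex_det3_nonneg (p q : ℝ × ℝ) : Convex ℝ {z | 0 ≤ det3 p q z} := by
  intro x hx y hy s t hs ht hst
  simp only [Set.mem_ofPred_eq] at *
  rw [det3_comb _ _ _ _ hst]
  exact add_nonneg (mul_nonneg hs hx) (mul_nonneg ht hy)

theorem convex_oTri (p q r : ℝ × ℝ) : Convex ℝ (oTri p q r) :=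
  (convex_det3_pos p q).inter ((convex_det3_pos q r).inter (convex_det3_pos r p))

theorem convex_cTri (p q r : ℝ × ℝ) : Convex ℝ (cTri p q r) :=
  (convex_det3_nonneg p q).inter ((convex_det3_nonneg q r).inter (convex_det3_nonneg r p))

theorem bary_eq {p q r : ℝ × ℝ} (h : 0 < det3 p q r) (z : ℝ × ℝ) :
    z = (det3 q r z / det3 p q r) • p + (det3 r p z / det3 p q r) • q +
      (det3 p q z / det3 p q r) • r := by
  have := det3_bary p q r z
  have h' : z = (det3 p q r)⁻¹ • (det3 p q r • z) := by
    rw [smul_smul, inv_mul_cancel₀ h.ne', one_smul]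
  rw [this] at h'
  rw [smul_add, smul_add, smul_smul, smul_smul, smul_smul] at h'
  simpa only [div_eq_inv_mul] using h'

theorem convexHull_eq_cTri {p q r : ℝ × ℝ} (h : 0 < det3 p q r) :
    convexHull ℝ ({p, q, r} : Set (ℝ × ℝ)) = cTri p q r := by
  have h1 : 0 < det3 q r p := by rwa [det3_rot]
  have h2 : 0 < det3 r p q := by rwa [det3_rot, det3_rot]
  apply Set.Subset.antisymm
  · refine convexHull_min ?_ (convex_cTri p q r)
    rintro z (rfl | rfl | rfl)
    · exact ⟨(det3_left _ _).ge, h1.le, (det3_right _ _).ge⟩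
    · exact ⟨(det3_right _ _).ge, (det3_left _ _).ge, h2.le⟩
    · exact ⟨h.le, (det3_right _ _).ge, (det3_left _ _).ge⟩
  · rintro z ⟨hz1, hz2, hz3⟩
    have hc := convex_convexHull ℝ ({p, q, r} : Set (ℝ × ℝ))
    have hsub := subset_convexHull ℝ ({p, q, r} : Set (ℝ × ℝ))
    rw [bary_eq h z]
    have hs := det3_sum p q r z
    have := hc.sum_mem (t := Finset.univ)
      (w := ![det3 q r z / det3 p q r, det3 r p z / det3 p q r, det3 p q z / det3 p q r])
      (z := ![p, q, r]) (by
        intro i _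
        fin_cases i
        · exact div_nonneg hz2 h.le
        · exact div_nonneg hz3 h.le
        · exact div_nonneg hz1 h.le) (by
        simp only [Fin.sum_univ_three, Matrix.cons_val]
        rw [← add_div, ← add_div, div_eq_one_iff_eq h.ne']
        linarith) (by
        intro i _
        fin_cases i
        · exact hsub (by simp)
        · exact hsub (by simp)
        · exact hsub (by simp))
    simpa [Fin.sum_univ_three] using this

theorem interior_det3_nonneg {p q r z : ℝ × ℝ} (h : 0 < det3 p q r) {S : Set (ℝ × ℝ)}
    (hS : ∀ z ∈ S, 0 ≤ det3 p q z) (hz : z ∈ interior S) : 0 < det3 p q z := by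
  have hc : Filter.Tendsto (fun t : ℝ => z + t • (p - r)) (nhdsWithin 0 (Set.Ioi 0)) (nhds z) := by
    have : Continuous (fun t : ℝ => z + t • (p - r)) := by fun_prop
    have := this.tendsto 0
    simp only [zero_smul, add_zero] at this
    exact this.mono_left nhdsWithin_le_nhds
  obtain ⟨t, ht, ht0⟩ := ((hc.eventually (mem_interior_iff_mem_nhds.1 hz)).and
    self_mem_nhdsWithin).exists
  have h1 := hS _ ht
  rw [det3_add_smul] at h1
  have h2 : (q.1 - p.1) * (p - r).2 - (q.2 - p.2) * (p - r).1 = - det3 p q r := by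
    simp only [det3, Prod.fst_sub, Prod.snd_sub]; ring
  rw [h2] at h1
  have := mul_pos ht0 h
  linarith

theorem openTriangle_eq_oTri {p q r : ℝ × ℝ} (h : 0 < det3 p q r) :
    PlaneGraph.openTriangle p q r = oTri p q r := by
  unfold PlaneGraph.openTriangle
  rw [convexHull_eq_cTri h]
  apply Set.Subset.antisymm
  · intro z hz
    exact ⟨interior_det3_nonneg h (fun z hz => hz.1) hz,
      interior_det3_nonneg (r := p) (by rwa [det3_rot]) (fun z hz => hz.2.1) hz,
      interior_det3_nonneg (r := q) (by rwa [det3_rot, det3_rot]) (fun z hz => hz.2.2) hz⟩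
  · exact interior_maximal (oTri_subset_cTri p q r) (isOpen_oTri p q r)

theorem oTri_nonempty {p q r : ℝ × ℝ} (h : 0 < det3 p q r) : (oTri p q r).Nonempty := by
  refine ⟨(1 / 3 : ℝ) • p + (1 / 3 : ℝ) • q + (1 / 3 : ℝ) • r, ?_, ?_, ?_⟩ <;>
  · have h' : 0 < (1 / 3 : ℝ) * det3 p q r := by linarith
    convert h' using 1
    simp only [det3, Prod.fst_add, Prod.snd_add, Prod.smul_fst, Prod.smul_snd, smul_eq_mul]
    ring

theorem cTri_inter_open {p q r z : ℝ × ℝ} (h : 0 < det3 p q r) (hz : z ∈ cTri p q r)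
    {U : Set (ℝ × ℝ)} (hU : IsOpen U) (hzU : z ∈ U) : (U ∩ oTri p q r).Nonempty := by
  have h1 : interior (cTri p q r) = oTri p q r := by
    rw [← convexHull_eq_cTri h, ← openTriangle_eq_oTri h]; rfl
  have h2 := (convex_cTri p q r).closure_interior_eq_closure_of_nonempty_interior
    (by rw [h1]; exact oTri_nonempty h)
  have h3 : z ∈ closure (oTri p q r) := by
    rw [← h1, h2]; exact subset_closure hz
  exact mem_closure_iff.1 h3 U hU hzU

theorem segment_subset_cTri {p q r : ℝ × ℝ} (h : 0 < det3 p q r) : segment ℝ p q ⊆ cTri p q r := by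
  rw [← convexHull_eq_cTri h, ← convexHull_pair]
  exact convexHull_mono (by intro x hx; simp only [Set.mem_insert_iff, Set.mem_singleton_iff] at *; tauto)

theorem mem_segment_of_det3 {p q r z : ℝ × ℝ} (h : 0 < det3 p q r) (hz : z ∈ cTri p q r)
    (h0 : det3 p q z = 0) : z ∈ segment ℝ p q := by
  refine ⟨det3 q r z / det3 p q r, det3 r p z / det3 p q r, div_nonneg hz.2.1 h.le,
    div_nonneg hz.2.2 h.le, ?_, ?_⟩
  · rw [← add_div, div_eq_one_iff_eq h.ne']
    linarith [det3_sum p q r z]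
  · conv_rhs => rw [bary_eq h z]
    rw [h0, zero_div, zero_smul, add_zero]

theorem frontier_oTri {p q r z : ℝ × ℝ} (h : 0 < det3 p q r) (hz : z ∈ closure (oTri p q r))
    (hz' : z ∉ oTri p q r) : z ∈ segment ℝ p q ∨ z ∈ segment ℝ q r ∨ z ∈ segment ℝ r p := by
  have hc : z ∈ cTri p q r :=
    (isClosed_cTri p q r).closure_subset_iff.2 (oTri_subset_cTri p q r) hz
  by_contra hn
  push Not at hn
  refine hz' ⟨hc.1.lt_of_ne fun h0 => hn.1 (mem_segment_of_det3 h hc h0.symm),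
    hc.2.1.lt_of_ne fun h0 => hn.2.1 (mem_segment_of_det3 (r := p) (by rwa [det3_rot]) ?_ h0.symm),
    hc.2.2.lt_of_ne fun h0 => hn.2.2
      (mem_segment_of_det3 (r := q) (by rwa [det3_rot, det3_rot]) ?_ h0.symm)⟩
  · rwa [cTri_rot]
  · rwa [cTri_rot, cTri_rot]

theorem isBounded_cTri {p q r : ℝ × ℝ} (h : 0 < det3 p q r) :
    Bornology.IsBounded (cTri p q r) := by
  rw [← convexHull_eq_cTri h]
  exact isBounded_convexHull.2 (Set.toFinite _).isBounded

/-- An open preconnected set whose boundary avoids `Y` is a component of `Y`. -/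
theorem connectedComponentIn_eq_of_closure {X : Type*} [TopologicalSpace X] {Y U : Set X} {x : X}
    (hU : IsOpen U) (hc : IsPreconnected U) (hUY : U ⊆ Y) (hcl : closure U ∩ Y ⊆ U) (hx : x ∈ U) :
    connectedComponentIn Y x = U := by
  apply Set.Subset.antisymm
  · refine isPreconnected_connectedComponentIn.subset_of_closure_inter_subset hU
      ⟨x, mem_connectedComponentIn (hUY hx), hx⟩ ?_
    exact fun y hy => hcl ⟨hy.1, connectedComponentIn_subset _ _ hy.2⟩
  · exact hc.subset_connectedComponentIn hx hUY

theorem dense_ne_zero {f : ℝ × ℝ → ℝ} (v : ℝ × ℝ) {c : ℝ} (hc : c ≠ 0)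
    (h : ∀ z (t : ℝ), f (z + t • v) = f z + t * c) : Dense {z | f z ≠ 0} := by
  intro z
  by_cases hz : f z = 0
  · have ht : Filter.Tendsto (fun t : ℝ => z + t • v) (nhdsWithin 0 (Set.Ioi 0)) (nhds z) := by
      have : Continuous (fun t : ℝ => z + t • v) := by fun_prop
      have := this.tendsto 0
      simp only [zero_smul, add_zero] at this
      exact this.mono_left nhdsWithin_le_nhds
    refine mem_closure_of_tendsto ht ?_
    filter_upwards [self_mem_nhdsWithin] with t ht0
    rw [h, hz, zero_add]
    exact mul_ne_zero (ne_of_gt ht0) hc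
  · exact subset_closure hz

/-- Points on no line through two of the given points and on no vertical line through one. -/
def Generic (S : Finset (ℝ × ℝ)) (z : ℝ × ℝ) : Prop :=
  ∀ p ∈ S, z.1 ≠ p.1 ∧ ∀ q ∈ S, p ≠ q → det3 p q z ≠ 0

theorem exists_generic (S : Finset (ℝ × ℝ)) {U : Set (ℝ × ℝ)} (hU : IsOpen U) (hne : U.Nonempty) :
    ∃ z ∈ U, Generic S z := by
  have h1 : Dense (⋂ p ∈ (S : Set (ℝ × ℝ)), {z : ℝ × ℝ | z.1 - p.1 ≠ 0}) := by
    refine dense_biInter_of_isOpen (fun p _ => ?_) S.countable_toSet (fun p _ => ?_)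
    · exact isOpen_ne_fun (by fun_prop) continuous_const
    · refine dense_ne_zero (1, 0) one_ne_zero (fun z t => ?_)
      simp; ring
  have o1 : IsOpen (⋂ p ∈ (S : Set (ℝ × ℝ)), {z : ℝ × ℝ | z.1 - p.1 ≠ 0}) :=
    S.finite_toSet.isOpen_biInter fun p _ => isOpen_ne_fun (by fun_prop) continuous_const
  have h2 : Dense (⋂ e ∈ ((S.offDiag : Finset _) : Set ((ℝ × ℝ) × (ℝ × ℝ))),
      {z : ℝ × ℝ | det3 e.1 e.2 z ≠ 0}) := by
    refine dense_biInter_of_isOpen (fun e _ => ?_) (Finset.countable_toSet _) (fun e he => ?_)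
    · exact isOpen_ne_fun (by fun_prop) continuous_const
    · refine dense_ne_zero (-(e.2.2 - e.1.2), e.2.1 - e.1.1)
        (c := (e.2.1 - e.1.1) ^ 2 + (e.2.2 - e.1.2) ^ 2) ?_ (fun z t => ?_)
      · intro h0
        have hne := (Finset.mem_offDiag.1 he).2.2
        apply hne
        have h1 : e.2.1 - e.1.1 = 0 := by nlinarith [sq_nonneg (e.2.1 - e.1.1), sq_nonneg (e.2.2 - e.1.2)]
        have h2 : e.2.2 - e.1.2 = 0 := by nlinarith [sq_nonneg (e.2.1 - e.1.1), sq_nonneg (e.2.2 - e.1.2)]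
        ext <;> linarith
      · rw [det3_add_smul]; ring
  obtain ⟨z, hz, hzU⟩ := (h2.inter_of_isOpen_right h1 o1).exists_mem_open hU hne
  refine ⟨z, hzU, fun p hp => ⟨?_, fun q hq hpq => ?_⟩⟩
  · have := Set.mem_iInter₂.1 hz.2 p hp
    exact fun h => this (sub_eq_zero.2 h)
  · exact Set.mem_iInter₂.1 hz.1 (p, q) (Finset.mem_offDiag.2 ⟨hp, hq, hpq⟩)

/-- The signed count of crossings of the edge `p q` with the vertical ray above `z`. -/
def crossing (p q z : ℝ × ℝ) : ℝ :=
  (if q.1 < z.1 ∧ z.1 < p.1 ∧ 0 < det3 p q z then 1 else 0) -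
  (if p.1 < z.1 ∧ z.1 < q.1 ∧ det3 p q z < 0 then 1 else 0)

theorem crossing_swap (p q z : ℝ × ℝ) : crossing q p z = - crossing p q z := by
  unfold crossing
  rw [det3_swap p q z]
  simp only [Left.neg_pos_iff, Left.neg_neg_iff]
  ring

theorem crossing_sum {p q r z : ℝ × ℝ} (h : 0 < det3 p q r) (hp : z.1 ≠ p.1) (hq : z.1 ≠ q.1)
    (hr : z.1 ≠ r.1) (hpq : det3 p q z ≠ 0) (hqr : det3 q r z ≠ 0) (hrp : det3 r p z ≠ 0) :
    crossing p q z + crossing q r z + crossing r p z = if z ∈ oTri p q r then 1 else 0 := by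
  have hs := det3_sum p q r z
  have hb : det3 q r z * (p.1 - z.1) + det3 r p z * (q.1 - z.1) + det3 p q z * (r.1 - z.1) = 0 := by
    unfold det3; ring
  have hmem : z ∈ oTri p q r ↔ 0 < det3 p q z ∧ 0 < det3 q r z ∧ 0 < det3 r p z := Iff.rfl
  rw [if_congr hmem rfl rfl]
  unfold crossing
  generalize det3 p q z = C at *
  generalize det3 q r z = A at *
  generalize det3 r p z = B at *
  rcases lt_or_gt_of_ne hp with hp | hp <;> rcases lt_or_gt_of_ne hq with hq | hq <;>
  rcases lt_or_gt_of_ne hr with hr | hr <;> rcases lt_or_gt_of_ne hpq with hC | hC <;>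
  rcases lt_or_gt_of_ne hqr with hA | hA <;> rcases lt_or_gt_of_ne hrp with hB | hB <;>
  simp only [hp, hq, hr, hC, hA, hB, not_lt_of_gt hp, not_lt_of_gt hq, not_lt_of_gt hr,
    not_lt_of_gt hC, not_lt_of_gt hA, not_lt_of_gt hB, and_true, and_false, if_true, if_false, and_self] <;>
  first
  | (norm_num; done)
  | (exfalso; linarith)
  | (exfalso
     have h1 := mul_pos (abs_pos.2 hqr) (abs_pos.2 (sub_ne_zero.2 hp.ne'))
     have h2 := mul_pos (abs_pos.2 hrp) (abs_pos.2 (sub_ne_zero.2 hq.ne'))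
     have h3 := mul_pos (abs_pos.2 hpq) (abs_pos.2 (sub_ne_zero.2 hr.ne'))
     simp only [abs_of_pos, abs_of_neg, hA, hB, hC, sub_pos.2 hp, sub_pos.2 hq, sub_pos.2 hr] at h1 h2 h3
     nlinarith)

end

section

theorem PlaneGraph.isClosed_drawing (G : PlaneGraph) : IsClosed G.drawing := by
  have : G.drawing = ⋃ e ∈ ((G.verts ×ˢ G.verts).filter (fun e => G.Adj e.1 e.2) :
      Set ((ℝ × ℝ) × (ℝ × ℝ))), segment ℝ e.1 e.2 := by
    ext x
    simp only [PlaneGraph.drawing, Set.mem_iUnion]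
    constructor
    · rintro ⟨p, q, h, hx⟩
      exact ⟨(p, q), by simpa [h] using G.mem_of_adj p q h, hx⟩
    · rintro ⟨e, he, hx⟩
      simp only [Finset.coe_filter] at he
      exact ⟨e.1, e.2, he.2, hx⟩
  rw [this]
  refine (Finset.finite_toSet _).isClosed_biUnion fun e _ => ?_
  rw [← convexHull_pair]
  exact (Set.toFinite _).isClosed_convexHull ℝ

/-- `x' y' z'` is a rotation of `x y z`. -/
def IsRot {α : Type*} (x y z x' y' z' : α) : Prop :=
  (x' = x ∧ y' = y ∧ z' = z) ∨ (x' = y ∧ y' = z ∧ z' = x) ∨ (x' = z ∧ y' = x ∧ z' = y)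

namespace TriDisc

variable {α : Type*} {V : Finset α} {D : α → α → α → Prop} {a b c : α} {P : α → ℝ × ℝ}

/-- The number of crossings of the boundary with the vertical ray above `z`. -/
def winding (V : Finset α) (D : α → α → α → Prop) (P : α → ℝ × ℝ) (z : ℝ × ℝ) : ℝ :=
  ∑ x ∈ V, ∑ y ∈ V, if Bd D x y then crossing (P x) (P y) z else 0

/-- The oriented faces whose interior contains `z`. -/
def facesAt (V : Finset α) (D : α → α → α → Prop) (P : α → ℝ × ℝ) (z : ℝ × ℝ) :
    Finset (α × α × α) :=
  (V ×ˢ V ×ˢ V).filter fun t =>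
    D t.1 t.2.1 t.2.2 ∧ z ∈ oTri (P t.1) (P t.2.1) (P t.2.2)

section
variable (K : TriDisc V D) (hP : Realizes V D a b P)
include K hP

theorem card_facesAt {z : ℝ × ℝ} (hz : Generic (V.image P) z) :
    ((facesAt V D P z).card : ℝ) = 3 * winding V D P z := by
  unfold winding
  rw [← K.sum_side_antisymm (fun x y => crossing (P x) (P y) z) (fun x y => crossing_swap _ _ _),
    ← K.sum_faces (fun x y => crossing (P x) (P y) z)]
  have hI : ∀ x ∈ V, P x ∈ V.image P := fun x hx => Finset.mem_image_of_mem P hx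
  have hne : ∀ x ∈ V, ∀ y ∈ V, x ≠ y → det3 (P x) (P y) z ≠ 0 := fun x hx y hy hxy =>
    (hz _ (hI x hx)).2 _ (hI y hy) fun h => hxy (hP.inj x hx y hy h)
  unfold facesAt
  rw [Finset.card_filter]
  push_cast
  rw [Finset.sum_product]
  refine Finset.sum_congr rfl fun x hx => ?_
  rw [Finset.sum_product]
  refine Finset.sum_congr rfl fun y hy => Finset.sum_congr rfl fun w hw => ?_
  by_cases h : D x y w
  · rw [if_pos h, crossing_sum (hP.face _ _ _ h) (hz _ (hI x hx)).1 (hz _ (hI y hy)).1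
      (hz _ (hI w hw)).1 (hne x hx y hy (K.ne h)) (hne y hy w hw (K.ne2 h))
      (hne w hw x hx (K.ne3 h))]
    simp [h]
  · simp [h]

/-- The boundary edges other than the base `(a, b)`. -/
def upper (V : Finset α) (D : α → α → α → Prop) (a b : α) : Finset (α × α) :=
  ((V ×ˢ V).filter fun e => Bd D e.1 e.2).erase (a, b)

omit hP in
theorem mem_upper {e : α × α} : e ∈ upper V D a b ↔ Bd D e.1 e.2 ∧ ¬ (e.1 = a ∧ e.2 = b) := by
  simp only [upper, Finset.mem_erase, Finset.mem_filter, Finset.mem_product, ne_eq, Prod.ext_iff]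
  exact ⟨fun h => ⟨h.2.2, h.1⟩, fun h => ⟨h.2, K.bd_mem h.1, h.1⟩⟩

omit hP in
theorem sum_bd (hab : Bd D a b) (F : α → α → ℝ) :
    ∑ x ∈ V, ∑ y ∈ V, (if Bd D x y then F x y else 0) = F a b +
      ∑ e ∈ upper V D a b, F e.1 e.2 := by
  have h : (a, b) ∈ (V ×ˢ V).filter fun e => Bd D e.1 e.2 := by
    simpa [hab] using K.bd_mem hab
  rw [upper, Finset.add_sum_erase _ (fun e => F e.1 e.2) h, Finset.sum_filter, Finset.sum_product]

/-- The upper boundary is a graph over the base. -/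
theorem sum_over (hab : Bd D a b) {z : ℝ × ℝ} (hz : Generic (V.image P) z) :
    ∑ e ∈ upper V D a b,
      (if (P e.2).1 < z.1 ∧ z.1 < (P e.1).1 then (1 : ℝ) else 0) =
    if (P a).1 < z.1 ∧ z.1 < (P b).1 then 1 else 0 := by
  have h := K.sum_bd_diff (fun x => if (P x).1 < z.1 then 1 else 0)
  have hI : ∀ x ∈ V, z.1 ≠ (P x).1 := fun x hx => (hz _ (Finset.mem_image_of_mem P hx)).1
  rw [K.sum_bd hab (fun x y => (if (P y).1 < z.1 then (1 : ℝ) else 0) -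
    (if (P x).1 < z.1 then 1 else 0))] at h
  have hA := hI a (K.bd_mem hab).1
  have hB := hI b (K.bd_mem hab).2
  have hbase : (if (P b).1 < z.1 then (1 : ℝ) else 0) - (if (P a).1 < z.1 then 1 else 0) =
      - if (P a).1 < z.1 ∧ z.1 < (P b).1 then 1 else 0 := by
    have := hP.base
    rcases lt_or_gt_of_ne hA with h1 | h1 <;> rcases lt_or_gt_of_ne hB with h2 | h2 <;>
      simp [h1, h2, h1.not_gt, h2.not_gt]
    linarith
  rw [hbase] at h
  rw [neg_add_eq_zero] at h
  rw [h]
  refine Finset.sum_congr rfl fun e he => ?_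
  rw [K.mem_upper] at he
  have h1 := hI _ (K.bd_mem he.1).1
  have h2 := hI _ (K.bd_mem he.1).2
  have := hP.top _ _ he.1 he.2
  rcases lt_or_gt_of_ne h1 with h1 | h1 <;> rcases lt_or_gt_of_ne h2 with h2 | h2 <;>
    simp [h1, h2, h1.not_gt, h2.not_gt]
  linarith

theorem winding_eq (hab : Bd D a b) (z : ℝ × ℝ) :
    winding V D P z =
      ∑ e ∈ upper V D a b,
        (if (P e.2).1 < z.1 ∧ z.1 < (P e.1).1 ∧ 0 < det3 (P e.1) (P e.2) z then (1 : ℝ) else 0) -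
      if (P a).1 < z.1 ∧ z.1 < (P b).1 ∧ det3 (P a) (P b) z < 0 then 1 else 0 := by
  unfold winding
  rw [K.sum_bd hab (fun x y => crossing (P x) (P y) z), add_comm, sub_eq_add_neg]
  congr 1
  · refine Finset.sum_congr rfl fun e he => ?_
    rw [K.mem_upper] at he
    have := hP.top _ _ he.1 he.2
    rw [crossing, if_neg (fun h : (P e.1).1 < z.1 ∧ z.1 < (P e.2).1 ∧ _ => by linarith [h.1, h.2.1]),
      sub_zero]
  · have := hP.base
    rw [crossing, if_neg (fun h : (P b).1 < z.1 ∧ z.1 < (P a).1 ∧ _ => by linarith [h.1, h.2.1]),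
      zero_sub]

theorem sum_upper_le (hab : Bd D a b) {z : ℝ × ℝ} (hz : Generic (V.image P) z) :
    ∑ e ∈ upper V D a b,
        (if (P e.2).1 < z.1 ∧ z.1 < (P e.1).1 ∧ 0 < det3 (P e.1) (P e.2) z then (1 : ℝ) else 0) ≤
      if (P a).1 < z.1 ∧ z.1 < (P b).1 then 1 else 0 := by
  rw [← K.sum_over hP hab hz]
  refine Finset.sum_le_sum fun e _ => ?_
  split_ifs <;> first | tauto | simp

theorem winding_le_one (hab : Bd D a b) {z : ℝ × ℝ} (hz : Generic (V.image P) z) :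
    winding V D P z ≤ 1 := by
  have h := K.sum_upper_le hP hab hz
  rw [K.winding_eq hP hab]
  split_ifs at * <;> linarith

theorem winding_le_zero_of_below (hab : Bd D a b) {z : ℝ × ℝ} (hz : Generic (V.image P) z)
    (hz' : det3 (P a) (P b) z < 0) : winding V D P z ≤ 0 := by
  have h := K.sum_upper_le hP hab hz
  rw [K.winding_eq hP hab]
  split_ifs at * <;> first | linarith | tauto

theorem winding_le_zero_of_beside (hab : Bd D a b) {z : ℝ × ℝ} (hz : Generic (V.image P) z)
    (h1 : z.1 < (P a).1 ∨ (P b).1 < z.1) : winding V D P z ≤ 0 := by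
  have h := K.sum_upper_le hP hab hz
  rw [K.winding_eq hP hab]
  split_ifs at * <;> first | linarith | (exfalso; rcases h1 with h1 | h1 <;> linarith)

theorem winding_le_zero_of_above (hab : Bd D a b) {z : ℝ × ℝ} (hz : Generic (V.image P) z)
    {x y : α} (hxy : Bd D x y) (hn : ¬ (x = a ∧ y = b)) (h1 : (P y).1 < z.1) (h2 : z.1 < (P x).1)
    (h3 : det3 (P x) (P y) z < 0) : winding V D P z ≤ 0 := by
  have hm : (x, y) ∈ upper V D a b := K.mem_upper.2 ⟨hxy, hn⟩
  have h : ∑ e ∈ upper V D a b,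
        (if (P e.2).1 < z.1 ∧ z.1 < (P e.1).1 ∧ 0 < det3 (P e.1) (P e.2) z then (1 : ℝ) else 0) + 1 ≤
      ∑ e ∈ upper V D a b, (if (P e.2).1 < z.1 ∧ z.1 < (P e.1).1 then (1 : ℝ) else 0) := by
    rw [← Finset.add_sum_erase _ _ hm, ← Finset.add_sum_erase (a := (x, y)) _
      (fun e => if (P e.2).1 < z.1 ∧ z.1 < (P e.1).1 then (1 : ℝ) else 0) hm]
    rw [if_neg (fun h => by linarith [h.2.2]), if_pos ⟨h1, h2⟩, zero_add, add_comm]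
    gcongr with e he
    split_ifs <;> first | tauto | simp
  rw [K.sum_over hP hab hz] at h
  rw [K.winding_eq hP hab]
  split_ifs at * <;> linarith

theorem exists_of_winding_le_zero (hab : Bd D a b) {z : ℝ × ℝ} (hz : Generic (V.image P) z)
    (h : winding V D P z ≤ 0) (h1 : (P a).1 < z.1) (h2 : z.1 < (P b).1) :
    det3 (P a) (P b) z < 0 ∨ ∃ x y, Bd D x y ∧ ¬ (x = a ∧ y = b) ∧ (P y).1 < z.1 ∧
      z.1 < (P x).1 ∧ det3 (P x) (P y) z < 0 := by
  by_contra hn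
  push Not at hn
  obtain ⟨hn1, hn2⟩ := hn
  rw [K.winding_eq hP hab, if_neg (fun h => by linarith [h.2.2]), sub_zero] at h
  have hs := K.sum_over hP hab hz
  rw [if_pos ⟨h1, h2⟩] at hs
  have : ∑ e ∈ upper V D a b, (if (P e.2).1 < z.1 ∧ z.1 < (P e.1).1 then (1 : ℝ) else 0) =
      ∑ e ∈ upper V D a b,
        (if (P e.2).1 < z.1 ∧ z.1 < (P e.1).1 ∧ 0 < det3 (P e.1) (P e.2) z then (1 : ℝ) else 0) := by
    refine Finset.sum_congr rfl fun e he => ?_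
    rw [K.mem_upper] at he
    by_cases hc : (P e.2).1 < z.1 ∧ z.1 < (P e.1).1
    · have h3 := hn2 _ _ he.1 (fun h h' => he.2 ⟨h, h'⟩) hc.1 hc.2
      have hb := K.bd_mem he.1
      have h4 := (hz _ (Finset.mem_image_of_mem P hb.1)).2 _ (Finset.mem_image_of_mem P hb.2)
        (fun h => K.bd_ne he.1 (hP.inj _ hb.1 _ hb.2 h))
      rw [if_pos hc, if_pos ⟨hc.1, hc.2, h3.lt_of_ne' h4⟩]
    · rw [if_neg hc, if_neg fun h => hc ⟨h.1, h.2.1⟩]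
  linarith

theorem notMem_oTri_of_winding {z : ℝ × ℝ} (hz : Generic (V.image P) z)
    (h : winding V D P z ≤ 0) {x y w : α} (hD : D x y w) : z ∉ oTri (P x) (P y) (P w) := by
  intro hm
  have hc := K.card_facesAt hP hz
  have : (x, y, w) ∈ facesAt V D P z := by
    simp [facesAt, K.mem hD, K.mem2 hD, K.mem3 hD, hD, hm]
  have : 0 < ((facesAt V D P z).card : ℝ) := by exact_mod_cast Finset.card_pos.2 ⟨_, this⟩
  linarith

theorem isRot_of_mem_oTri (hab : Bd D a b) {z : ℝ × ℝ} (hz : Generic (V.image P) z)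
    {x y w x' y' w' : α} (hD : D x y w) (hD' : D x' y' w') (h : z ∈ oTri (P x) (P y) (P w))
    (h' : z ∈ oTri (P x') (P y') (P w')) : IsRot x y w x' y' w' := by
  have hc := K.card_facesAt hP hz
  have h1 := K.winding_le_one hP hab hz
  have h3 : (facesAt V D P z).card ≤ 3 := by
    have : ((facesAt V D P z).card : ℝ) ≤ 3 := by linarith
    exact_mod_cast this
  by_contra hn
  have hsub : ({(x', y', w'), (x, y, w), (y, w, x), (w, x, y)} : Finset (α × α × α)) ⊆
      facesAt V D P z := by
    have h2 : z ∈ oTri (P y) (P w) (P x) := by rwa [oTri_rot]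
    have h3 : z ∈ oTri (P w) (P x) (P y) := by rwa [← oTri_rot]
    intro t ht
    simp only [Finset.mem_insert, Finset.mem_singleton] at ht
    rcases ht with rfl | rfl | rfl | rfl <;>
      simp [facesAt, K.mem hD, K.mem2 hD, K.mem3 hD, K.mem hD', K.mem2 hD', K.mem3 hD',
        K.rot hD, K.rot2 hD, *]
  have := Finset.card_le_card hsub
  have hxy := K.ne hD
  have hyw := K.ne2 hD
  have hwx := K.ne3 hD
  simp only [IsRot, not_or] at hn
  rw [Finset.card_insert_of_notMem (by simp only [Finset.mem_insert, Finset.mem_singleton, Prod.mk.injEq]; tauto),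
    Finset.card_insert_of_notMem (by simp only [Finset.mem_insert, Finset.mem_singleton, Prod.mk.injEq]; tauto),
    Finset.card_insert_of_notMem (by simp only [Finset.mem_singleton, Prod.mk.injEq]; tauto),
    Finset.card_singleton] at this
  omega

theorem isRot_of_mem_cTri (hab : Bd D a b) {z : ℝ × ℝ}
    {x y w x' y' w' : α} (hD : D x y w) (hD' : D x' y' w') (h : z ∈ oTri (P x) (P y) (P w))
    (h' : z ∈ cTri (P x') (P y') (P w')) : IsRot x y w x' y' w' := by
  obtain ⟨z', hz', hg⟩ := exists_generic (V.image P) ((isOpen_oTri _ _ _).inter (isOpen_oTri _ _ _))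
    (cTri_inter_open (hP.face _ _ _ hD') h' (isOpen_oTri _ _ _) h)
  exact K.isRot_of_mem_oTri hP hab hg hD hD' hz'.1 hz'.2

/-- An open set whose generic points have winding number at most zero misses all closed faces. -/
theorem notMem_cTri_of_open {U : Set (ℝ × ℝ)} (hU : IsOpen U)
    (hw : ∀ z ∈ U, Generic (V.image P) z → winding V D P z ≤ 0) {z : ℝ × ℝ} (hz : z ∈ U)
    {x y w : α} (hD : D x y w) : z ∉ cTri (P x) (P y) (P w) := by
  intro hm
  obtain ⟨z', hz', hg⟩ := exists_generic (V.image P) (hU.inter (isOpen_oTri _ _ _))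
    (cTri_inter_open (hP.face _ _ _ hD) hm hU hz)
  exact K.notMem_oTri_of_winding hP hg (hw _ hz'.1 hg) hD hz'.2

/-- Near an interior point of an edge there are only the faces at this edge. -/
theorem face_of_mem_edge (hab : Bd D a b) {x y w x' y' w' : α} (hD : D x y w) (hD' : D x' y' w')
    {s t : ℝ} (hs : 0 < s) (ht : 0 < t) (hst : s + t = 1)
    (h : s • P x + t • P y ∈ cTri (P x') (P y') (P w')) :
    IsRot x y w x' y' w' ∨ ∃ v, D y x v ∧ IsRot y x v x' y' w' := by
  set z₀ := s • P x + t • P y with hz₀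
  have hf := hP.face _ _ _ hD
  have h1 : 0 < det3 (P y) (P w) z₀ := by
    rw [hz₀, det3_comb _ _ _ _ hst, det3_left, mul_zero, add_zero, det3_rot]
    exact mul_pos hs hf
  have h2 : 0 < det3 (P w) (P x) z₀ := by
    rw [hz₀, det3_comb _ _ _ _ hst, det3_right, mul_zero, zero_add, det3_rot, det3_rot]
    exact mul_pos ht hf
  have hmem := (fun v (hv : v ∈ V) => Finset.mem_image_of_mem P hv)
  have hne : ∀ z, Generic (V.image P) z → det3 (P x) (P y) z ≠ 0 := fun z hz =>
    (hz _ (hmem x (K.mem hD))).2 _ (hmem y (K.mem2 hD))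
      fun h => K.ne hD (hP.inj _ (K.mem hD) _ (K.mem2 hD) h)
  by_cases hside : Side D y x
  · obtain ⟨v, hv⟩ := hside
    have hfv := hP.face _ _ _ hv
    have h3 : 0 < det3 (P x) (P v) z₀ := by
      rw [hz₀, det3_comb _ _ _ _ hst, det3_left, mul_zero, zero_add, det3_rot]
      exact mul_pos ht hfv
    have h4 : 0 < det3 (P v) (P y) z₀ := by
      rw [hz₀, det3_comb _ _ _ _ hst, det3_right, mul_zero, add_zero, det3_rot, det3_rot]
      exact mul_pos hs hfv
    let U := {z | 0 < det3 (P y) (P w) z ∧ 0 < det3 (P w) (P x) z ∧ 0 < det3 (P x) (P v) z ∧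
      0 < det3 (P v) (P y) z}
    have hU : IsOpen U := by
      refine IsOpen.inter ?_ (IsOpen.inter ?_ (IsOpen.inter ?_ ?_)) <;>
        exact isOpen_lt continuous_const (continuous_det3 _ _)
    obtain ⟨z, hz, hg⟩ := exists_generic (V.image P) (hU.inter (isOpen_oTri _ _ _))
      (cTri_inter_open (hP.face _ _ _ hD') h hU ⟨h1, h2, h3, h4⟩)
    rcases lt_or_gt_of_ne (hne z hg) with h0 | h0
    · refine Or.inr ⟨v, hv, K.isRot_of_mem_oTri hP hab hg hv hD' ⟨?_, hz.1.2.2.1, hz.1.2.2.2⟩ hz.2⟩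
      rw [det3_swap]; linarith
    · exact Or.inl (K.isRot_of_mem_oTri hP hab hg hD hD' ⟨h0, hz.1.1, hz.1.2.1⟩ hz.2)
  · left
    have hB : Bd D x y := ⟨⟨w, hD⟩, hside⟩
    have key : ∃ U, IsOpen U ∧ z₀ ∈ U ∧ ∀ z ∈ U, Generic (V.image P) z →
        det3 (P x) (P y) z < 0 → winding V D P z ≤ 0 := by
      have hx : z₀.1 = s * (P x).1 + t * (P y).1 := by simp [hz₀]
      by_cases hba : x = a ∧ y = b
      · obtain ⟨rfl, rfl⟩ := hba
        refine ⟨{z | (P x).1 < z.1} ∩ {z | z.1 < (P y).1},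
          (isOpen_lt continuous_const continuous_fst).inter
            (isOpen_lt continuous_fst continuous_const), ?_, fun z hz hg h0 =>
              K.winding_le_zero_of_below hP hab hg h0⟩
        have := hP.base
        obtain rfl : s = 1 - t := by linarith
        constructor <;> simp only [Set.mem_ofPred_eq, hx] <;> nlinarith
      · refine ⟨{z | (P y).1 < z.1} ∩ {z | z.1 < (P x).1},
          (isOpen_lt continuous_const continuous_fst).inter
            (isOpen_lt continuous_fst continuous_const), ?_, fun z hz hg h0 =>
              K.winding_le_zero_of_above hP hab hg hB hba hz.1 hz.2 h0⟩
        have := hP.top _ _ hB hba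
        obtain rfl : s = 1 - t := by linarith
        constructor <;> simp only [Set.mem_ofPred_eq, hx] <;> nlinarith
    obtain ⟨U', hU', hz₀', hw⟩ := key
    let U := U' ∩ {z | 0 < det3 (P y) (P w) z ∧ 0 < det3 (P w) (P x) z}
    have hU : IsOpen U := by
      refine hU'.inter (IsOpen.inter ?_ ?_) <;>
        exact isOpen_lt continuous_const (continuous_det3 _ _)
    obtain ⟨z, hz, hg⟩ := exists_generic (V.image P) (hU.inter (isOpen_oTri _ _ _))
      (cTri_inter_open (hP.face _ _ _ hD') h hU ⟨hz₀', h1, h2⟩)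
    rcases lt_or_gt_of_ne (hne z hg) with h0 | h0
    · exact absurd hz.2 (K.notMem_oTri_of_winding hP hg (hw z hz.1.1 hg h0) hD')
    · exact K.isRot_of_mem_oTri hP hab hg hD hD' ⟨h0, hz.1.2.1, hz.1.2.2⟩ hz.2

end

end TriDisc

end

section

theorem cTri_cases {p q r z : ℝ × ℝ} (h : 0 < det3 p q r) (hc : z ∈ cTri p q r) :
    z ∈ oTri p q r ∨ z ∈ segment ℝ p q ∨ z ∈ segment ℝ q r ∨ z ∈ segment ℝ r p := by
  by_contra hn
  push Not at hn
  refine hn.1 ⟨hc.1.lt_of_ne fun h0 => hn.2.1 (mem_segment_of_det3 h hc h0.symm),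
    hc.2.1.lt_of_ne fun h0 => hn.2.2.1 (mem_segment_of_det3 (r := p) (by rwa [det3_rot])
      (by rwa [cTri_rot]) h0.symm),
    hc.2.2.lt_of_ne fun h0 => hn.2.2.2 (mem_segment_of_det3 (r := q) (by rwa [det3_rot, det3_rot])
      (by rwa [← cTri_rot]) h0.symm)⟩

theorem segment_cases {p q z : ℝ × ℝ} (h : z ∈ segment ℝ p q) :
    z = p ∨ z = q ∨ ∃ s t : ℝ, 0 < s ∧ 0 < t ∧ s + t = 1 ∧ z = s • p + t • q := by
  obtain ⟨s, t, hs, ht, hst, rfl⟩ := h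
  rcases hs.eq_or_lt with rfl | hs
  · right; left; obtain rfl : t = 1 := by linarith
    simp
  rcases ht.eq_or_lt with rfl | ht
  · left; obtain rfl : s = 1 := by linarith
    simp
  · exact Or.inr (Or.inr ⟨s, t, hs, ht, hst, rfl⟩)

/-- If a vertical ray misses the drawing, its starting point lies in an unbounded face. -/
theorem PlaneGraph.not_isBounded_of_ray (G : PlaneGraph) {z : ℝ × ℝ} {v : ℝ} (hv : |v| = 1)
    (h : ∀ t : ℝ, 0 ≤ t → z + t • ((0, v) : ℝ × ℝ) ∉ G.drawing) :
    ¬ Bornology.IsBounded (connectedComponentIn G.drawingᶜ z) := by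
  intro hb
  have hsub : (fun t : ℝ => z + t • ((0, v) : ℝ × ℝ)) '' Set.Ici 0 ⊆
      connectedComponentIn G.drawingᶜ z := by
    refine IsPreconnected.subset_connectedComponentIn ?_ ⟨0, Set.self_mem_Ici, by simp⟩ ?_
    · exact isPreconnected_Ici.image _ (by fun_prop)
    · rintro _ ⟨t, ht, rfl⟩
      exact h t ht
  obtain ⟨R, hR⟩ := (hb.subset hsub).exists_norm_le
  have ht : (0 : ℝ) ≤ |R| + |z.2| + 1 := by positivity
  have h1 := hR _ ⟨|R| + |z.2| + 1, ht, rfl⟩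
  have h2 := (norm_snd_le _).trans h1
  have h3 : |(|R| + |z.2| + 1) * v| - |z.2| ≤ |z.2 + (|R| + |z.2| + 1) * v| := by
    have := abs_sub_abs_le_abs_sub ((|R| + |z.2| + 1) * v) (-z.2)
    rw [abs_neg, sub_neg_eq_add, add_comm _ z.2] at this
    exact this
  simp only [Prod.snd_add, Prod.smul_snd, smul_eq_mul, Real.norm_eq_abs] at h2
  rw [abs_mul, hv, abs_of_nonneg ht] at h3
  linarith [le_abs_self R]

namespace TriDisc

variable {α : Type*} {V : Finset α} {D : α → α → α → Prop} {a b c : α} {P : α → ℝ × ℝ}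

theorem exists_face (K : TriDisc V D) (hD : D a b c) {v : α} (hv : v ∈ V) : ∃ y w, D v y w :=
  K.conn_closed (fun v => ∃ y w, D v y w) (fun _ _ _ h _ => ⟨_, _, K.rot h⟩) (K.mem hD) hv
    ⟨_, _, hD⟩

section
variable (K : TriDisc V D) (hP : Realizes V D a b P) (hab : Bd D a b)
include K hP hab

theorem corner_of_mem_segment {v x y w : α} (hv : v ∈ V) (hD : D x y w)
    (h : P v ∈ segment ℝ (P x) (P y)) : v = x ∨ v = y := by
  rcases segment_cases h with h | h | ⟨s, t, hs, ht, hst, h⟩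
  · exact Or.inl (hP.inj _ hv _ (K.mem hD) h)
  · exact Or.inr (hP.inj _ hv _ (K.mem2 hD) h)
  obtain ⟨y', w', hv'⟩ := K.exists_face hD hv
  have hm : P v ∈ cTri (P v) (P y') (P w') :=
    segment_subset_cTri (hP.face _ _ _ hv') (left_mem_segment ℝ _ _)
  rw [h] at hm
  have h0 := det3_segment (by assumption : P v ∈ segment ℝ (P x) (P y))
  rcases K.face_of_mem_edge hP hab hD hv' hs ht hst (by convert hm using 2) with hr | ⟨u, hu, hr⟩
  · rcases hr with ⟨rfl, -⟩ | ⟨rfl, -⟩ | ⟨rfl, -⟩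
    · exact Or.inl rfl
    · exact Or.inr rfl
    · linarith [hP.face _ _ _ hD]
  · rcases hr with ⟨rfl, -⟩ | ⟨rfl, -⟩ | ⟨rfl, -⟩
    · exact Or.inr rfl
    · exact Or.inl rfl
    · have := hP.face _ _ _ hu
      rw [det3_swap] at this
      linarith

theorem edge_unique {x y w r s t : α} (hD : D x y w) (hD' : D r s t) {l m : ℝ} (hl : 0 < l)
    (hm : 0 < m) (hlm : l + m = 1) (h : l • P x + m • P y ∈ segment ℝ (P r) (P s)) :
    (r = x ∧ s = y) ∨ (r = y ∧ s = x) := by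
  have hf := hP.face _ _ _ hD
  have h0 := det3_segment h
  have key : ∀ {x y w}, D x y w → ∀ {l m : ℝ}, 0 < l → 0 < m → l + m = 1 →
      det3 (P r) (P s) (l • P x + m • P y) = 0 → IsRot x y w r s t → r = x ∧ s = y := by
    intro x y w hD l m hl hm hlm h0 hr
    have hf := hP.face _ _ _ hD
    rcases hr with ⟨rfl, rfl, -⟩ | ⟨rfl, rfl, -⟩ | ⟨rfl, rfl, -⟩
    · exact ⟨rfl, rfl⟩
    · rw [det3_comb _ _ _ _ hlm, det3_left, mul_zero, add_zero, det3_rot] at h0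
      exact absurd h0 (mul_pos hl hf).ne'
    · rw [det3_comb _ _ _ _ hlm, det3_right, mul_zero, zero_add, det3_rot, det3_rot] at h0
      exact absurd h0 (mul_pos hm hf).ne'
  rcases K.face_of_mem_edge hP hab hD hD' hl hm hlm
    (segment_subset_cTri (hP.face _ _ _ hD') h) with hr | ⟨u, hu, hr⟩
  · exact Or.inl (key hD hl hm hlm h0 hr)
  · right
    rw [add_comm] at h0
    exact key hu hm hl (by rw [add_comm]; exact hlm) h0 hr

theorem segment_disjoint_oTri {x y w r s t : α} (hD : D x y w) (hD' : D r s t) {z : ℝ × ℝ}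
    (hz : z ∈ oTri (P x) (P y) (P w)) : z ∉ segment ℝ (P r) (P s) := by
  intro h
  have h0 := det3_segment h
  rcases K.isRot_of_mem_cTri hP hab hD hD' hz (segment_subset_cTri (hP.face _ _ _ hD') h) with
    ⟨rfl, rfl, -⟩ | ⟨rfl, rfl, -⟩ | ⟨rfl, rfl, -⟩
  · exact hz.1.ne' h0
  · exact hz.2.1.ne' h0
  · exact hz.2.2.ne' h0

end

/-- The straight-line drawing of the one-skeleton. -/
def graph (V : Finset α) (D : α → α → α → Prop) (P : α → ℝ × ℝ)
    (K : TriDisc V D) (hP : Realizes V D a b P) : PlaneGraph where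
  verts := V.image P
  Adj := fun p q => ∃ x y, Nbr D x y ∧ p = P x ∧ q = P y
  symm := fun _ _ ⟨x, y, h, hx, hy⟩ => ⟨y, x, h.symm, hy, hx⟩
  loopless := fun _ ⟨x, y, h, hx, hy⟩ =>
    K.nbr_ne h (hP.inj _ (K.nbr_mem h) _ (K.nbr_mem h.symm) (hy ▸ hx))
  mem_of_adj := fun _ _ ⟨x, y, h, hx, hy⟩ =>
    ⟨hx ▸ Finset.mem_image_of_mem P (K.nbr_mem h.symm), hy ▸ Finset.mem_image_of_mem P (K.nbr_mem h)⟩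

section
variable (K : TriDisc V D) (hP : Realizes V D a b P)

theorem graph_adj {x y : α} (hx : x ∈ V) (hy : y ∈ V) :
    (graph V D P K hP).Adj (P x) (P y) ↔ Nbr D x y := by
  constructor
  · rintro ⟨x', y', h, h1, h2⟩
    rwa [hP.inj _ hx _ (K.nbr_mem h.symm) h1, hP.inj _ hy _ (K.nbr_mem h) h2]
  · exact fun h => ⟨x, y, h, rfl, rfl⟩

theorem mem_drawing {z : ℝ × ℝ} :
    z ∈ (graph V D P K hP).drawing ↔ ∃ x y w, D x y w ∧ z ∈ segment ℝ (P x) (P y) := by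
  constructor
  · rintro ⟨_, _, ⟨x, y, ⟨w, h⟩ | ⟨w, h⟩, rfl, rfl⟩, hz⟩
    · exact ⟨x, y, w, h, hz⟩
    · exact ⟨y, x, w, h, by rwa [segment_symm]⟩
  · rintro ⟨x, y, w, h, hz⟩
    exact ⟨_, _, ⟨x, y, Or.inl ⟨w, h⟩, rfl, rfl⟩, hz⟩

theorem graph_isEmbedded (hab : Bd D a b) : (graph V D P K hP).IsEmbedded := by
  have key : ∀ p q, (graph V D P K hP).Adj p q → ∀ v ∈ V, P v ∈ segment ℝ p q →
      P v = p ∨ P v = q := by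
    rintro _ _ ⟨x, y, ⟨w, h⟩ | ⟨w, h⟩, rfl, rfl⟩ v hv hz
    · rcases K.corner_of_mem_segment hP hab hv h hz with rfl | rfl <;> simp
    · rw [segment_symm] at hz
      rcases K.corner_of_mem_segment hP hab hv h hz with rfl | rfl <;> simp
  refine ⟨?_, ?_⟩
  · intro p q r s hpq hrs z hz hz'
    have hv : ∀ p q, (graph V D P K hP).Adj p q → ∀ z, z = p ∨ z = q → ∃ v ∈ V, z = P v := by
      rintro _ _ ⟨x, y, h, rfl, rfl⟩ z (rfl | rfl)
      · exact ⟨x, K.nbr_mem h.symm, rfl⟩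
      · exact ⟨y, K.nbr_mem h, rfl⟩
    by_cases h1 : z = p ∨ z = q
    · obtain ⟨v, hv, rfl⟩ := hv p q hpq z h1
      exact Or.inr ⟨h1, key r s hrs v hv hz'⟩
    by_cases h2 : z = r ∨ z = s
    · obtain ⟨v, hv, rfl⟩ := hv r s hrs z h2
      exact Or.inr ⟨key p q hpq v hv hz, h2⟩
    left
    push Not at h1
    rcases segment_cases hz with h | h | ⟨l, m, hl, hm, hlm, rfl⟩
    · exact absurd h h1.1
    · exact absurd h h1.2
    obtain ⟨x, y, hxy, rfl, rfl⟩ := hpq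
    obtain ⟨x', y', hxy', rfl, rfl⟩ := hrs
    have main : ∀ {x y x' y' : α} {l m : ℝ}, Side D x y → Side D x' y' → 0 < l → 0 < m →
        l + m = 1 → l • P x + m • P y ∈ segment ℝ (P x') (P y') →
        ({P x, P y} : Set (ℝ × ℝ)) = {P x', P y'} := by
      rintro x y x' y' l m ⟨w, h⟩ ⟨w', h'⟩ hl hm hlm hz
      rcases K.edge_unique hP hab h h' hl hm hlm hz with ⟨rfl, rfl⟩ | ⟨rfl, rfl⟩
      · rfl
      · exact Set.pair_comm _ _
    rcases hxy with h | h <;> rcases hxy' with h' | h'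
    · exact main h h' hl hm hlm hz'
    · rw [Set.pair_comm (P x')]
      exact main h h' hl hm hlm (by rwa [segment_symm])
    · rw [Set.pair_comm (P x)]
      exact main h h' hm hl (by linarith) (by rwa [add_comm])
    · rw [Set.pair_comm (P x), Set.pair_comm (P x')]
      exact main h h' hm hl (by linarith) (by rwa [segment_symm, add_comm])
  · intro p q v hpq hv' hz
    obtain ⟨v, hv, rfl⟩ := Finset.mem_image.1 hv'
    exact key p q hpq v hv hz

theorem graph_biconnected (hab : Bd D a b) : (graph V D P K hP).Biconnected := by
  obtain ⟨⟨c, hD⟩, -⟩ := hab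
  have ha := K.mem hD
  have hb := K.mem2 hD
  have hc := K.mem3 hD
  have hinj : Set.InjOn P V := fun x hx y hy h => hP.inj x hx y hy h
  have h3 : 3 ≤ V.card := by
    have : ({a, b, c} : Finset α) ⊆ V := by
      intro x; simp only [Finset.mem_insert, Finset.mem_singleton]
      rintro (rfl | rfl | rfl) <;> assumption
    have h := Finset.card_le_card this
    rwa [Finset.card_eq_three.2 ⟨a, b, c, K.ne hD, (K.ne3 hD).symm, K.ne2 hD, rfl⟩] at h
  have hadj : ∀ {x y w}, D x y w → (graph V D P K hP).Adj (P x) (P y) :=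
    fun h => ⟨_, _, Or.inl ⟨_, h⟩, rfl, rfl⟩
  refine ⟨?_, ⟨⟨P a, Finset.mem_image_of_mem P ha⟩, ?_⟩, ?_⟩
  · change 3 ≤ (V.image P).card
    rwa [Finset.card_image_of_injOn hinj]
  · intro p hp q hq
    obtain ⟨x, hx, rfl⟩ := Finset.mem_image.1 hp
    obtain ⟨y, hy, rfl⟩ := Finset.mem_image.1 hq
    exact K.conn_closed (fun y => (graph V D P K hP).Reachable (P x) (P y))
      (fun y z w h hr => hr.tail (hadj h)) hx hy Relation.ReflTransGen.refl
  · intro v hv'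
    obtain ⟨v, hv, rfl⟩ := Finset.mem_image.1 hv'
    constructor
    · change (V.image P \ {P v}).Nonempty
      rw [← Finset.card_pos, Finset.sdiff_singleton_eq_erase, Finset.card_erase_of_mem
        (Finset.mem_image_of_mem P hv), Finset.card_image_of_injOn hinj]
      omega
    · intro p hp q hq
      change p ∈ V.image P \ {P v} at hp
      change q ∈ V.image P \ {P v} at hq
      rw [Finset.mem_sdiff, Finset.mem_singleton] at hp hq
      obtain ⟨hp, hpv⟩ := hp
      obtain ⟨hq, hqv⟩ := hq
      obtain ⟨x, hx, rfl⟩ := Finset.mem_image.1 hp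
      obtain ⟨y, hy, rfl⟩ := Finset.mem_image.1 hq
      let R : α → Prop := fun t => ((graph V D P K hP).deleteVerts {P v}).Reachable (P x) (P t)
      have hR : ∀ {s t w}, D s t w → s ≠ v → t ≠ v → (R s → R t) ∧ (R t → R s) := by
        intro s t w h hs ht
        have hs' : P s ≠ P v := fun h' => hs (hP.inj _ (K.mem h) _ hv h')
        have ht' : P t ≠ P v := fun h' => ht (hP.inj _ (K.mem2 h) _ hv h')
        have : ((graph V D P K hP).deleteVerts {P v}).Adj (P s) (P t) :=
          ⟨hadj h, by simpa using hs', by simpa using ht'⟩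
        exact ⟨fun hr => hr.tail this, fun hr => hr.tail (PlaneGraph.symm _ _ _ this)⟩
      have := K.conn_closed (fun t => if t = v then ∀ s, Nbr D v s → R s else R t) ?_ hx hy ?_
      · have hyv : y ≠ v := fun h => hqv (h ▸ rfl)
        simpa [hyv] using this
      · intro s t w h hs
        by_cases hsv : s = v
        · subst hsv
          rw [if_pos rfl] at hs
          rw [if_neg (K.ne h).symm]
          exact hs t (K.nbr_left h)
        · rw [if_neg hsv] at hs
          split_ifs with htv
          · subst htv
            intro r hr
            refine K.link_closed t R (fun x y hxy => ?_) (K.nbr_right (K.rot h)) hr hs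
            exact iff_iff_implies_and_implies.2
              (hR (K.rot hxy) (K.ne hxy).symm (K.ne3 hxy))
          · exact (hR h hsv htv).1 hs
      · have hxv : x ≠ v := fun h => hpv (h ▸ rfl)
        rw [if_neg hxv]
        exact Relation.ReflTransGen.refl

theorem drawing_subset_cTri {z : ℝ × ℝ} (hz : z ∈ (graph V D P K hP).drawing) :
    ∃ x y w, D x y w ∧ z ∈ cTri (P x) (P y) (P w) := by
  obtain ⟨x, y, w, h, hz⟩ := (K.mem_drawing hP).1 hz
  exact ⟨x, y, w, h, segment_subset_cTri (hP.face _ _ _ h) hz⟩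

theorem not_isBounded_of_open {U : Set (ℝ × ℝ)} (hU : IsOpen U)
    (hw : ∀ z ∈ U, Generic (V.image P) z → winding V D P z ≤ 0) {v : ℝ} (hv : |v| = 1) {z : ℝ × ℝ}
    (h : ∀ t : ℝ, 0 ≤ t → z + t • ((0, v) : ℝ × ℝ) ∈ U) :
    ¬ Bornology.IsBounded (connectedComponentIn (graph V D P K hP).drawingᶜ z) := by
  refine PlaneGraph.not_isBounded_of_ray _ hv fun t ht hd => ?_
  obtain ⟨x, y, w, hD, hm⟩ := K.drawing_subset_cTri hP hd
  exact K.notMem_cTri_of_open hP hU hw (h t ht) hD hm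

theorem not_isBounded_of_winding (hab : Bd D a b) {z : ℝ × ℝ} (hz : Generic (V.image P) z)
    (h : winding V D P z ≤ 0) :
    ¬ Bornology.IsBounded (connectedComponentIn (graph V D P K hP).drawingᶜ z) := by
  have hza := (hz _ (Finset.mem_image_of_mem P (K.bd_mem hab).1)).1
  have hzb := (hz _ (Finset.mem_image_of_mem P (K.bd_mem hab).2)).1
  by_cases hs : z.1 < (P a).1 ∨ (P b).1 < z.1
  · refine K.not_isBounded_of_open hP (U := {z | z.1 < (P a).1} ∪ {z | (P b).1 < z.1})
      ((isOpen_lt continuous_fst continuous_const).union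
        (isOpen_lt continuous_const continuous_fst))
      (fun z hz hg => K.winding_le_zero_of_beside hP hab hg hz) (v := 1) (by simp) fun t ht => ?_
    simpa using hs
  push Not at hs
  have h1 := hs.1.lt_of_ne' hza
  have h2 := hs.2.lt_of_ne hzb
  rcases K.exists_of_winding_le_zero hP hab hz h h1 h2 with h3 | ⟨x, y, hB, hn, h3, h4, h5⟩
  · refine K.not_isBounded_of_open hP
      (U := {z | (P a).1 < z.1} ∩ ({z | z.1 < (P b).1} ∩ {z | det3 (P a) (P b) z < 0}))
      ((isOpen_lt continuous_const continuous_fst).inter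
        ((isOpen_lt continuous_fst continuous_const).inter
          (isOpen_lt (continuous_det3 _ _) continuous_const)))
      (fun z hz hg => K.winding_le_zero_of_below hP hab hg hz.2.2)
      (v := -1) (by simp) fun t ht => ⟨by simpa using h1, by simpa using h2, ?_⟩
    simp only [Set.mem_ofPred_eq]
    rw [det3_add_smul]
    nlinarith [hP.base]
  · refine K.not_isBounded_of_open hP
      (U := {z | (P y).1 < z.1} ∩ ({z | z.1 < (P x).1} ∩ {z | det3 (P x) (P y) z < 0}))
      ((isOpen_lt continuous_const continuous_fst).inter
        ((isOpen_lt continuous_fst continuous_const).inter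
          (isOpen_lt (continuous_det3 _ _) continuous_const)))
      (fun z hz hg => K.winding_le_zero_of_above hP hab hg hB hn hz.1 hz.2.1 hz.2.2)
      (v := 1) (by simp) fun t ht => ⟨by simpa using h3, by simpa using h4, ?_⟩
    simp only [Set.mem_ofPred_eq]
    rw [det3_add_smul]
    nlinarith [hP.top _ _ hB hn]

theorem graph_innerFacesTriangles (hab : Bd D a b) :
    (graph V D P K hP).InnerFacesTriangles := by
  rintro _ ⟨z, hz, rfl⟩ hbd
  by_cases hc : ∃ x y w, D x y w ∧ z ∈ cTri (P x) (P y) (P w)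
  · obtain ⟨x, y, w, hD, hm⟩ := hc
    have hD2 := K.rot hD
    have hD3 := K.rot2 hD
    have hf := hP.face _ _ _ hD
    have hzo : z ∈ oTri (P x) (P y) (P w) := by
      rcases cTri_cases hf hm with h | h | h | h
      · exact h
      · exact absurd ((K.mem_drawing hP).2 ⟨_, _, _, hD, h⟩) hz
      · exact absurd ((K.mem_drawing hP).2 ⟨_, _, _, hD2, h⟩) hz
      · exact absurd ((K.mem_drawing hP).2 ⟨_, _, _, hD3, h⟩) hz
    refine ⟨P x, Finset.mem_image_of_mem P (K.mem hD), P y, Finset.mem_image_of_mem P (K.mem2 hD),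
      P w, Finset.mem_image_of_mem P (K.mem3 hD), ⟨_, _, Or.inl ⟨_, hD⟩, rfl, rfl⟩,
      ⟨_, _, Or.inl ⟨_, hD2⟩, rfl, rfl⟩, ⟨_, _, Or.inr ⟨_, hD3⟩, rfl, rfl⟩, ?_⟩
    rw [openTriangle_eq_oTri hf]
    refine connectedComponentIn_eq_of_closure (isOpen_oTri _ _ _)
      (convex_oTri _ _ _).isPreconnected ?_ ?_ hzo
    · intro z' hz' hd
      obtain ⟨r, s, t, hD', hs⟩ := (K.mem_drawing hP).1 hd
      exact K.segment_disjoint_oTri hP hab hD hD' hz' hs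
    · rintro z' ⟨hcl, hnd⟩
      by_contra ho
      rcases frontier_oTri hf hcl ho with h | h | h
      · exact hnd ((K.mem_drawing hP).2 ⟨_, _, _, hD, h⟩)
      · exact hnd ((K.mem_drawing hP).2 ⟨_, _, _, hD2, h⟩)
      · exact hnd ((K.mem_drawing hP).2 ⟨_, _, _, hD3, h⟩)
  · exfalso
    let T : Finset (α × α × α) := (V ×ˢ V ×ˢ V).filter fun t => D t.1 t.2.1 t.2.2
    have hclosed : IsClosed (⋃ t ∈ (T : Set (α × α × α)), cTri (P t.1) (P t.2.1) (P t.2.2)) :=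
      T.finite_toSet.isClosed_biUnion fun t _ => isClosed_cTri _ _ _
    have hopen : IsOpen (connectedComponentIn (graph V D P K hP).drawingᶜ z) :=
      (PlaneGraph.isClosed_drawing _).isOpen_compl.connectedComponentIn
    have hzT : z ∉ ⋃ t ∈ (T : Set (α × α × α)), cTri (P t.1) (P t.2.1) (P t.2.2) := by
      intro h
      simp only [Set.mem_iUnion] at h
      obtain ⟨t, ht, hm⟩ := h
      simp only [T, Finset.coe_filter, Finset.mem_product] at ht
      exact hc ⟨_, _, _, ht.2, hm⟩
    obtain ⟨z', ⟨hz', hzT'⟩, hg⟩ := exists_generic (V.image P) (hopen.inter hclosed.isOpen_compl)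
      ⟨z, mem_connectedComponentIn hz, hzT⟩
    have hw : winding V D P z' ≤ 0 := by
      have h0 : facesAt V D P z' = ∅ := by
        refine Finset.eq_empty_of_forall_notMem fun t ht => hzT' ?_
        simp only [facesAt, Finset.mem_filter] at ht
        simp only [Set.mem_iUnion]
        refine ⟨t, ?_, oTri_subset_cTri _ _ _ ht.2.2⟩
        simp only [T, Finset.coe_filter]
        exact ⟨ht.1, ht.2.1⟩
      have := K.card_facesAt hP hg
      rw [h0] at this
      simp at this
      exact this.le
    refine K.not_isBounded_of_winding hP hab hg hw ?_
    rwa [connectedComponentIn_eq hz'] at hbd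

/-- Every triangulated disc is the complex of inner faces of a near-triangulation. -/
theorem exists_nearTriangulation (K : TriDisc V D) {a b : α} (hab : Bd D a b) :
    ∃ (H : PlaneGraph) (P : α → ℝ × ℝ), H.IsNearTriangulation ∧ Set.BijOn P V H.verts ∧
      ∀ x ∈ V, ∀ y ∈ V, Nbr D x y ↔ H.Adj (P x) (P y) := by
  obtain ⟨⟨c, hc⟩, hn⟩ := id hab
  obtain ⟨P, hP⟩ := exists_realizes _ V D rfl K a b c hc hn
  refine ⟨graph V D P K hP, P, ⟨K.graph_isEmbedded hP hab, K.graph_biconnected hP hab,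
    K.graph_innerFacesTriangles hP hab⟩, ?_, fun x hx y hy => (K.graph_adj hP hx hy).symm⟩
  change Set.BijOn P V (V.image P : Finset (ℝ × ℝ))
  rw [Finset.coe_image]
  exact Set.InjOn.bijOn_image fun x hx y hy h => hP.inj x hx y hy h

end

end TriDisc

end

section

/-- The map identifying `v` with `u`. -/
def merge {α : Type*} (u v x : α) : α := if x = v then u else x

/-- The faces after the contraction of the edge `(u, v)` to the vertex `u`. -/
def Contract {α : Type*} (D : α → α → α → Prop) (u v x y z : α) : Prop :=
  x ≠ y ∧ y ≠ z ∧ z ≠ x ∧ ∃ x' y' z', D x' y' z' ∧ merge u v x' = x ∧ merge u v y' = y ∧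
    merge u v z' = z

section
variable {α : Type*} {V : Finset α} {D : α → α → α → Prop} {u v : α}

theorem merge_of_ne {x : α} (h : x ≠ v) : merge u v x = x := if_neg h

theorem merge_self : merge u v v = u := if_pos rfl

theorem merge_ne (huv : u ≠ v) (x : α) : merge u v x ≠ v := by
  unfold merge
  split_ifs with h
  · exact huv
  · exact h

theorem merge_eq_iff {x w : α} (hw : w ≠ u) (hv : w ≠ v) : merge u v x = w ↔ x = w := by
  unfold merge
  split_ifs with h
  · subst h
    exact ⟨fun h => absurd h.symm hw, fun h => absurd h.symm hv⟩
  · rfl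

theorem eq_or_eq_of_merge {x : α} (h : merge u v x = u) : x = u ∨ x = v := by
  unfold merge at h
  split_ifs at h with h'
  · exact Or.inr h'
  · exact Or.inl h

theorem Contract.rot (K : TriDisc V D) {x y z : α} (h : Contract D u v x y z) :
    Contract D u v y z x := by
  obtain ⟨h1, h2, h3, x', y', z', hD, hx, hy, hz⟩ := h
  exact ⟨h2, h3, h1, y', z', x', K.rot hD, hy, hz, hx⟩

/-- Hypotheses making the edge `(u, v)` contractible. -/
structure Collapsible (V : Finset α) (D : α → α → α → Prop) (u v : α) : Prop where
  disc : TriDisc V D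
  anti : ∀ {x y z}, D x y z → ¬ D y x z
  two_sided : ∀ {x}, Nbr D v x → Side D v x ∧ Side D x v
  adj : Nbr D v u
  facial : ∀ {t}, Nbr D u t → Nbr D v t → D u v t ∨ D v u t

namespace Collapsible

variable (C : Collapsible V D u v)
include C

theorem ne : u ≠ v := C.disc.nbr_ne C.adj

theorem nbr_contract {x y : α} (h : Nbr D x y) (hne : merge u v x ≠ merge u v y) :
    Nbr (Contract D u v) (merge u v x) (merge u v y) := by
  have K := C.disc
  have huv := C.ne
  have key : ∀ t, D u v t ∨ D v u t → Nbr (Contract D u v) u t := by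
    rintro t (h | h)
    · obtain ⟨r, hr⟩ := (C.two_sided (K.nbr_left (K.rot h))).2
      have hru : r ≠ u := by
        rintro rfl
        exact C.anti (K.rot h) hr
      exact Or.inr ⟨r, K.ne3 h, hru.symm, K.ne3 hr, t, v, r, hr, merge_of_ne (K.ne2 h).symm,
        merge_self, merge_of_ne (K.ne2 hr).symm⟩
    · obtain ⟨r, hr⟩ := (C.two_sided (K.nbr_right h)).1
      have hru : r ≠ u := by
        rintro rfl
        exact C.anti (K.rot2 h) (K.rot2 hr |> K.rot2 |> K.rot2)
      exact Or.inl ⟨r, K.ne2 h, K.ne2 hr, hru, v, t, r, hr, merge_self,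
        merge_of_ne (K.ne3 h), merge_of_ne (K.ne3 hr)⟩
  have main : ∀ {x y}, Side D x y → merge u v x ≠ merge u v y →
      Nbr (Contract D u v) (merge u v x) (merge u v y) := by
    rintro x y ⟨z, hz⟩ hne
    have hcase : ∀ {p q r}, D p q r → merge u v p = merge u v q →
        D u v r ∧ merge u v p = u ∨ D v u r ∧ merge u v p = u := by
      intro p q r h he
      have hpq := K.ne h
      unfold merge at he ⊢
      split_ifs at he ⊢ with h1 h2 h2
      · exact absurd (h1.trans h2.symm) hpq
      · subst h1; subst he; exact Or.inr ⟨h, rfl⟩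
      · subst h2; subst he; exact Or.inl ⟨h, rfl⟩
      · exact absurd he hpq
    by_cases h1 : merge u v y = merge u v z
    · have hx : x ≠ v := fun h => by
        rcases hcase (K.rot hz) h1 with ⟨h', -⟩ | ⟨h', -⟩
        · exact K.ne2 h' h.symm
        · exact K.ne3 h' h
      rcases hcase (K.rot hz) h1 with ⟨h', he⟩ | ⟨h', he⟩
      · rw [he, merge_of_ne hx]; exact (key _ (Or.inl h')).symm
      · rw [he, merge_of_ne hx]; exact (key _ (Or.inr h')).symm
    by_cases h2 : merge u v z = merge u v x
    · have hy : y ≠ v := fun h => by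
        rcases hcase (K.rot2 hz) h2 with ⟨h', -⟩ | ⟨h', -⟩
        · exact K.ne2 h' h.symm
        · exact K.ne3 h' h
      rcases hcase (K.rot2 hz) h2 with ⟨h', he⟩ | ⟨h', he⟩
      · rw [← h2, he, merge_of_ne hy]; exact key _ (Or.inl h')
      · rw [← h2, he, merge_of_ne hy]; exact key _ (Or.inr h')
    · exact Or.inl ⟨_, hne, h1, h2, x, y, z, hz, rfl, rfl, rfl⟩
  rcases h with h | h
  · exact main h hne
  · exact (main h hne.symm).symm

omit C in
theorem exists_of_nbr_contract {x y : α} (h : Nbr (Contract D u v) x y) :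
    ∃ x' y', Nbr D x' y' ∧ merge u v x' = x ∧ merge u v y' = y := by
  rcases h with ⟨_, _, _, _, x', y', z', hD, hx, hy, _⟩ | ⟨_, _, _, _, y', x', z', hD, hy, hx, _⟩
  · exact ⟨x', y', Or.inl ⟨z', hD⟩, hx, hy⟩
  · exact ⟨x', y', Or.inr ⟨z', hD⟩, hx, hy⟩

omit C in
theorem ne_of_nbr_contract {x y : α} (h : Nbr (Contract D u v) x y) : x ≠ y := by
  rcases h with ⟨_, h, _⟩ | ⟨_, h, _⟩
  · exact h
  · exact h.symm

theorem nbr_contract_iff {x y : α} (hx : x ≠ v) (hy : y ≠ v) :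
    Nbr (Contract D u v) x y ↔
      x ≠ y ∧ (Nbr D x y ∨ (x = u ∧ Nbr D v y) ∨ (y = u ∧ Nbr D v x)) := by
  have K := C.disc
  constructor
  · intro h
    refine ⟨ne_of_nbr_contract h, ?_⟩
    obtain ⟨x', y', h', hx', hy'⟩ := exists_of_nbr_contract h
    have hne := ne_of_nbr_contract h
    by_cases h1 : x' = v
    · subst h1
      rw [merge_self] at hx'
      by_cases h2 : y' = x'
      · exact absurd h2 (K.nbr_ne h')
      · rw [merge_of_ne h2] at hy'
        subst hy'
        exact Or.inr (Or.inl ⟨hx'.symm, h'⟩)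
    · rw [merge_of_ne h1] at hx'
      subst hx'
      by_cases h2 : y' = v
      · subst h2
        rw [merge_self] at hy'
        exact Or.inr (Or.inr ⟨hy'.symm, h'.symm⟩)
      · rw [merge_of_ne h2] at hy'
        subst hy'
        exact Or.inl h'
  · rintro ⟨hne, h | ⟨rfl, h⟩ | ⟨rfl, h⟩⟩
    · have := C.nbr_contract h (by rwa [merge_of_ne hx, merge_of_ne hy])
      rwa [merge_of_ne hx, merge_of_ne hy] at this
    · have := C.nbr_contract h (by rwa [merge_self, merge_of_ne hy])
      rwa [merge_self, merge_of_ne hy] at this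
    · have := C.nbr_contract h (by rw [merge_self, merge_of_ne hx]; exact hne.symm)
      rw [merge_self, merge_of_ne hx] at this
      exact this.symm

theorem contract_uniq {x y z z' : α} (h : Contract D u v x y z) (h' : Contract D u v x y z') :
    z = z' := by
  have K := C.disc
  obtain ⟨hxy, hyz, hzx, x1, y1, z1, h1, rfl, rfl, rfl⟩ := h
  obtain ⟨-, hyz', hzx', x2, y2, z2, h2, hx, hy, rfl⟩ := h'
  by_cases hx' : x2 = x1
  · subst hx'
    by_cases hy' : y2 = y1
    · subst hy'
      rw [K.uniq h1 h2]
    · exfalso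
      have hyu : (y1 = u ∧ y2 = v) ∨ (y1 = v ∧ y2 = u) := by
        unfold merge at hy
        split_ifs at hy with h3 h4 h4
        · exact absurd (h3.trans h4.symm) hy'
        · exact Or.inl ⟨hy.symm, h3⟩
        · exact Or.inr ⟨h4, hy⟩
        · exact absurd hy hy'
      have hf : D u v x2 ∨ D v u x2 := by
        rcases hyu with ⟨rfl, rfl⟩ | ⟨rfl, rfl⟩
        · exact C.facial (K.nbr_right (K.rot h1)) (K.nbr_right (K.rot h2))
        · exact C.facial (K.nbr_right (K.rot h2)) (K.nbr_right (K.rot h1))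
      have hbad : ∀ p q r, (p = u ∧ q = v ∨ p = v ∧ q = u) → D x2 p r → D p q x2 →
          merge u v r = merge u v p := by
        intro p q r hpq hr hf
        have := K.uniq hr (K.rot2 hf)
        rw [this]
        rcases hpq with ⟨rfl, rfl⟩ | ⟨rfl, rfl⟩ <;> simp [merge]
      rcases hyu with ⟨rfl, rfl⟩ | ⟨rfl, rfl⟩ <;> rcases hf with hf | hf
      · exact hyz (hbad _ _ _ (Or.inl ⟨rfl, rfl⟩) h1 hf).symm
      · exact hyz' (hy ▸ (hbad _ _ _ (Or.inr ⟨rfl, rfl⟩) h2 hf).symm)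
      · exact hyz' (hy ▸ (hbad _ _ _ (Or.inl ⟨rfl, rfl⟩) h2 hf).symm)
      · exact hyz (hbad _ _ _ (Or.inr ⟨rfl, rfl⟩) h1 hf).symm
  · exfalso
    have hxu : (x1 = u ∧ x2 = v) ∨ (x1 = v ∧ x2 = u) := by
      unfold merge at hx
      split_ifs at hx with h3 h4 h4
      · exact absurd (h3.trans h4.symm) hx'
      · exact Or.inl ⟨hx.symm, h3⟩
      · exact Or.inr ⟨h4, hx⟩
      · exact absurd hx hx'
    have hy' : y2 = y1 := by
      have hu : merge u v x1 = u := by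
        rcases hxu with ⟨rfl, rfl⟩ | ⟨rfl, rfl⟩ <;> simp [merge]
      rw [hu] at hxy
      unfold merge at hy hxy
      split_ifs at hy hxy with h3 h4 h4
      · exact absurd rfl hxy
      · exact absurd hy (fun h => hxy (by tauto))
      · exact absurd rfl hxy
      · exact hy
    subst hy'
    have hf : D u v y2 ∨ D v u y2 := by
      rcases hxu with ⟨rfl, rfl⟩ | ⟨rfl, rfl⟩
      · exact C.facial (K.nbr_left h1) (K.nbr_left h2)
      · exact C.facial (K.nbr_left h2) (K.nbr_left h1)
    have hbad : ∀ p q r, (p = u ∧ q = v ∨ p = v ∧ q = u) → D p y2 r → D q p y2 →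
        merge u v r = merge u v p := by
      intro p q r hpq hr hf
      have := K.uniq hr (K.rot hf)
      rw [this]
      rcases hpq with ⟨rfl, rfl⟩ | ⟨rfl, rfl⟩ <;> simp [merge]
    rcases hxu with ⟨rfl, rfl⟩ | ⟨rfl, rfl⟩ <;> rcases hf with hf | hf
    · exact hzx' (hx ▸ (hbad _ _ _ (Or.inr ⟨rfl, rfl⟩) h2 hf))
    · exact hzx (hbad _ _ _ (Or.inl ⟨rfl, rfl⟩) h1 hf)
    · exact hzx (hbad _ _ _ (Or.inr ⟨rfl, rfl⟩) h1 hf)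
    · exact hzx' (hx ▸ (hbad _ _ _ (Or.inl ⟨rfl, rfl⟩) h2 hf))

theorem contract_link (w : α) (g : α → ℝ) (hg : ∀ x y, Contract D u v w x y → g x = g y)
    {x y : α} (hx : Nbr (Contract D u v) w x) (hy : Nbr (Contract D u v) w y) : g x = g y := by
  have K := C.disc
  have huv := C.ne
  have hwv : w ≠ v := by
    obtain ⟨w', -, -, h, -⟩ := exists_of_nbr_contract hx
    exact h ▸ merge_ne huv w'
  by_cases hwu : w = u
  · subst hwu
    obtain ⟨s, hs⟩ : Side D w v := (C.two_sided C.adj).2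
    have hv : ∀ x y, Nbr D v x → Nbr D v y → x ≠ w → y ≠ w → g x = g y := by
      intro x y hx hy hxw hyw
      refine K.link_erase (Or.inr (Or.inr fun x hx => C.two_sided hx)) g ?_ hx hy hxw hyw
      intro x y h hx hy
      exact hg x y ⟨hx.symm, K.ne2 h, hy, v, x, y, h, merge_self, merge_of_ne (K.ne h).symm,
        merge_of_ne (K.ne3 h)⟩
    have hsv : Nbr D v s := K.nbr_left (K.rot hs)
    have hsw : s ≠ w := K.ne3 hs
    have hall : ∀ x, Nbr D w x → Function.update g v (g s) x = g s := by
      intro x hx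
      have := K.link w (Function.update g v (g s)) ?_ x s hx (K.nbr_right hs)
      · rw [this, Function.update_of_ne (K.ne2 hs).symm]
      intro x y h
      by_cases hxv : x = v
      · subst hxv
        rw [K.uniq h hs, Function.update_self, Function.update_of_ne (K.ne2 hs).symm]
      by_cases hyv : y = v
      · subst hyv
        rw [Function.update_self, Function.update_of_ne hxv]
        exact hv _ _ (K.nbr_right (K.rot2 h)) hsv (K.ne h).symm hsw
      · rw [Function.update_of_ne hxv, Function.update_of_ne hyv]
        exact hg x y ⟨K.ne h, K.ne2 h, K.ne3 h, w, x, y, h, merge_of_ne hwv, merge_of_ne hxv,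
          merge_of_ne hyv⟩
    have hfin : ∀ x, Nbr (Contract D w v) w x → g x = g s := by
      intro x hx
      have hxw := (ne_of_nbr_contract hx).symm
      obtain ⟨w', x', h, hw', hx'⟩ := exists_of_nbr_contract hx
      have hxv : x ≠ v := hx' ▸ merge_ne huv x'
      rw [merge_eq_iff hxw hxv] at hx'
      subst hx'
      rcases eq_or_eq_of_merge hw' with rfl | rfl
      · have := hall x' h
        rwa [Function.update_of_ne hxv] at this
      · exact hv _ _ h hsv hxw hsw
    rw [hfin x hx, hfin y hy]
  · have hall := K.link w (fun t => g (merge u v t)) ?_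
    · obtain ⟨w', x', h, hw', rfl⟩ := exists_of_nbr_contract hx
      obtain ⟨w'', y', h', hw'', rfl⟩ := exists_of_nbr_contract hy
      rw [merge_eq_iff hwu hwv] at hw' hw''
      subst hw'
      rw [hw''] at h'
      exact hall _ _ h h'
    · intro x y h
      by_cases he : merge u v x = merge u v y
      · simp only [he]
      · exact hg _ _ ⟨fun h' => K.ne h ((merge_eq_iff hwu hwv).1 h'.symm).symm, he,
          fun h' => K.ne3 h ((merge_eq_iff hwu hwv).1 h'), w, x, y, h, merge_of_ne hwv, rfl, rfl⟩

theorem triDisc : TriDisc (V.erase v) (Contract D u v) := by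
  have K := C.disc
  have huv := C.ne
  refine ⟨?_, fun h => h.rot K, fun h => h.1, C.contract_uniq, ?_, ?_, ?_⟩
  · rintro x y z ⟨-, -, -, x', y', z', h, rfl, -, -⟩
    refine Finset.mem_erase.2 ⟨merge_ne huv _, ?_⟩
    unfold merge
    split_ifs
    · exact K.nbr_mem C.adj
    · exact K.mem h
  · intro f hf x hx y hy
    rw [Finset.mem_erase] at hx hy
    have := K.conn (fun t => f (merge u v t)) ?_ x hx.2 y hy.2
    · simpa only [merge_of_ne hx.1, merge_of_ne hy.1] using this
    · intro x y z h
      by_cases he : merge u v x = merge u v y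
      · simp only [he]
      · rcases C.nbr_contract (Or.inl ⟨z, h⟩) he with ⟨z', h'⟩ | ⟨z', h'⟩
        · exact hf _ _ _ h'
        · exact (hf _ _ _ h').symm
  · intro w g hg x y hx hy
    exact C.contract_link w g hg hx hy
  · intro e he hc
    have h0 : ∀ x, e x x = 0 := fun x => by linarith [he x x]
    obtain ⟨f, hf⟩ := K.pot (fun x y => e (merge u v x) (merge u v y)) (fun x y => he _ _) (by
      intro x y z h
      by_cases h1 : merge u v x = merge u v y
      · rw [h1, h0, he (merge u v y) (merge u v z)]; ring
      by_cases h2 : merge u v y = merge u v z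
      · rw [h2, h0, he (merge u v x) (merge u v z)]; ring
      by_cases h3 : merge u v z = merge u v x
      · rw [h3, h0, he (merge u v x) (merge u v y)]; ring
      · exact hc _ _ _ ⟨h1, h2, h3, x, y, z, h, rfl, rfl, rfl⟩)
    refine ⟨f, ?_⟩
    have hfuv : f v = f u := by
      rcases C.adj with ⟨t, ht⟩ | ⟨t, ht⟩
      · have := hf _ _ _ ht
        rw [merge_self, merge_of_ne huv, h0] at this
        linarith
      · have := hf _ _ _ ht
        rw [merge_self, merge_of_ne huv, h0] at this
        linarith
    have hm : ∀ x, f (merge u v x) = f x := by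
      intro x
      unfold merge
      split_ifs with h
      · rw [h, hfuv]
      · rfl
    rintro x y z ⟨-, -, -, x', y', z', h, rfl, rfl, -⟩
    rw [hm, hm]
    exact hf _ _ _ h

theorem bd_contract {a b : α} (hab : Bd D a b) (hau : a ≠ u) (hbu : b ≠ u) (hav : a ≠ v)
    (hbv : b ≠ v) : Bd (Contract D u v) a b := by
  have K := C.disc
  obtain ⟨⟨c, hc⟩, hn⟩ := hab
  constructor
  · exact ⟨_, K.ne hc, fun h => K.ne2 hc ((merge_eq_iff hbu hbv).1 h.symm).symm,
      fun h => K.ne3 hc ((merge_eq_iff hau hav).1 h), a, b, c, hc, merge_of_ne hav,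
      merge_of_ne hbv, rfl⟩
  · rintro ⟨z, -, -, -, b', a', z', h, hb', ha', -⟩
    rw [merge_eq_iff hau hav] at ha'
    rw [merge_eq_iff hbu hbv] at hb'
    subst ha'; subst hb'
    exact hn ⟨_, h⟩

end Collapsible

end

end

section

theorem cTri_subset_closure {p q r : ℝ × ℝ} (h : 0 < det3 p q r) :
    cTri p q r ⊆ closure (oTri p q r) :=
  fun _ hz => mem_closure_iff.2 fun _ hU hzU => cTri_inter_open h hz hU hzU

theorem openTriangle_eq_empty {p q r : ℝ × ℝ} (hpq : p ≠ q) (h : det3 p q r = 0) :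
    PlaneGraph.openTriangle p q r = ∅ := by
  have hd : Dense {z : ℝ × ℝ | det3 p q z ≠ 0} := by
    refine dense_ne_zero (-(q.2 - p.2), q.1 - p.1)
      (c := (q.1 - p.1) ^ 2 + (q.2 - p.2) ^ 2) ?_ (fun z t => ?_)
    · intro h0
      apply hpq
      have h1 : q.1 - p.1 = 0 := by nlinarith [sq_nonneg (q.1 - p.1), sq_nonneg (q.2 - p.2)]
      have h2 : q.2 - p.2 = 0 := by nlinarith [sq_nonneg (q.1 - p.1), sq_nonneg (q.2 - p.2)]
      ext <;> linarith
    · rw [det3_add_smul]; ring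
  have hconv : Convex ℝ {z | det3 p q z = 0} := by
    intro x hx y hy s t _ _ hst
    simp only [Set.mem_ofPred_eq] at *
    rw [det3_comb _ _ _ _ hst, hx, hy]; ring
  have hsub : convexHull ℝ ({p, q, r} : Set (ℝ × ℝ)) ⊆ {z | det3 p q z = 0} := by
    refine convexHull_min ?_ hconv
    rintro x (rfl | rfl | rfl)
    exacts [det3_left _ _, det3_right _ _, h]
  by_contra hne
  obtain ⟨z, hz, hzi⟩ := hd.exists_mem_open isOpen_interior (Set.nonempty_iff_ne_empty.2 hne)
  exact hz (hsub (interior_subset hzi))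

theorem det3_mid_left (p q : ℝ × ℝ) {r : ℝ × ℝ} {s t : ℝ} (hst : s + t = 1) :
    det3 q r (s • p + t • q) = s * det3 p q r ∧ det3 r p (s • p + t • q) = t * det3 p q r := by
  rw [det3_comb _ _ _ _ hst, det3_comb _ _ _ _ hst, det3_left, det3_right, det3_rot, det3_rot,
    det3_rot]
  exact ⟨by ring, by ring⟩

/-- Near an inner point of a side, the inner side of the line lies in the triangle. -/
theorem eventually_mem_oTri {p q r : ℝ × ℝ} (h : 0 < det3 p q r) {s t : ℝ} (hs : 0 < s)
    (ht : 0 < t) (hst : s + t = 1) :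
    ∀ᶠ z in nhds (s • p + t • q), 0 < det3 p q z → z ∈ oTri p q r := by
  obtain ⟨h1, h2⟩ := det3_mid_left p q (r := r) hst
  have e1 : ∀ᶠ z in nhds (s • p + t • q), 0 < det3 q r z :=
    (continuous_det3 q r).continuousAt.eventually_const_lt (by rw [h1]; positivity)
  have e2 : ∀ᶠ z in nhds (s • p + t • q), 0 < det3 r p z :=
    (continuous_det3 r p).continuousAt.eventually_const_lt (by rw [h2]; positivity)
  filter_upwards [e1, e2] with z h1 h2 h3 using ⟨h3, h1, h2⟩

namespace PlaneGraph

/-- A positively oriented inner face of the plane graph. -/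
def Face (T : PlaneGraph) (p q r : ℝ × ℝ) : Prop :=
  T.Adj p q ∧ T.Adj q r ∧ T.Adj r p ∧ 0 < det3 p q r ∧ Disjoint (oTri p q r) T.drawing

variable {T : PlaneGraph} {p q r : ℝ × ℝ}

theorem Face.rot (h : T.Face p q r) : T.Face q r p := by
  refine ⟨h.2.1, h.2.2.1, h.1, ?_, ?_⟩
  · rw [det3_rot]; exact h.2.2.2.1
  · rw [oTri_rot]; exact h.2.2.2.2

theorem Face.pos (h : T.Face p q r) : 0 < det3 p q r := h.2.2.2.1

theorem Face.component (h : T.Face p q r) {z : ℝ × ℝ} (hz : z ∈ oTri p q r) :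
    connectedComponentIn T.drawingᶜ z = oTri p q r := by
  refine connectedComponentIn_eq_of_closure (isOpen_oTri _ _ _) (convex_oTri _ _ _).isPreconnected
    (fun x hx hd => h.2.2.2.2.le_bot ⟨hx, hd⟩) ?_ hz
  rintro z' ⟨hcl, hnd⟩
  by_contra ho
  rcases frontier_oTri h.pos hcl ho with h' | h' | h'
  · exact hnd ⟨_, _, h.1, h'⟩
  · exact hnd ⟨_, _, h.2.1, h'⟩
  · exact hnd ⟨_, _, h.2.2.1, h'⟩

theorem Face.eq_of_mem {p' q' r' z : ℝ × ℝ} (h : T.Face p q r) (h' : T.Face p' q' r')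
    (hz : z ∈ oTri p q r) (hz' : z ∈ oTri p' q' r') : oTri p q r = oTri p' q' r' := by
  rw [← h.component hz, ← h'.component hz']

theorem Face.uniq {r' : ℝ × ℝ} (h : T.Face p q r) (h' : T.Face p q r') : r = r' := by
  have hst : (1 / 2 : ℝ) + 1 / 2 = 1 := by norm_num
  have hp := h.pos
  have hp' := h'.pos
  have key : ∃ z ∈ oTri p q r, z ∈ oTri p q r' := by
    obtain ⟨U, hU, hUo, hm⟩ := eventually_nhds_iff.1
      (eventually_mem_oTri hp' (s := 1 / 2) (t := 1 / 2) (by norm_num) (by norm_num) hst)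
    obtain ⟨z, hz, hz'⟩ := cTri_inter_open hp (segment_subset_cTri hp
      ⟨1 / 2, 1 / 2, by norm_num, by norm_num, hst, rfl⟩) hUo hm
    exact ⟨z, hz', hU z hz hz'.1⟩
  obtain ⟨z, hz, hz'⟩ := key
  have heq := h.eq_of_mem h' hz hz'
  have corner : ∀ x : ℝ × ℝ, 0 < det3 p q x → x ∈ closure (oTri p q x) := fun x hx =>
    cTri_subset_closure hx ⟨hx.le, (det3_right _ _).ge, (det3_left _ _).ge⟩
  have c1 : r ∈ cTri p q r' := by
    have := corner r hp
    rw [heq] at this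
    exact closure_minimal (oTri_subset_cTri _ _ _) (isClosed_cTri _ _ _) this
  have c2 : r' ∈ cTri p q r := by
    have := corner r' hp'
    rw [← heq] at this
    exact closure_minimal (oTri_subset_cTri _ _ _) (isClosed_cTri _ _ _) this
  have e1 : det3 q r r' = 0 := by
    have h1 := c1.2.1
    have h2 := c2.2.1
    have : det3 q r' r = - det3 q r r' := by unfold det3; ring
    linarith
  have e2 : det3 r p r' = 0 := by
    have h1 := c1.2.2
    have h2 := c2.2.2
    have : det3 r' p r = - det3 r p r' := by unfold det3; ring
    linarith
  have hs := det3_sum p q r r'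
  have hb := bary_eq hp r'
  rw [e1, e2] at hb hs
  have : det3 p q r' = det3 p q r := by linarith
  rw [this, div_self hp.ne'] at hb
  simpa using hb.symm

theorem Face.anti (h : T.Face p q r) : ¬ T.Face q p r := by
  intro h'
  have h1 := h.pos
  have h2 := h'.pos
  rw [det3_swap] at h2
  linarith

/-- An inner point of an edge lies on no other edge. -/
theorem edge_eq_of_mem (hE : T.IsEmbedded) (hpq : T.Adj p q) {a b : ℝ × ℝ} (hab : T.Adj a b)
    {s t : ℝ} (hs : 0 < s) (ht : 0 < t) (hst : s + t = 1) (h : s • p + t • q ∈ segment ℝ a b) :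
    ({p, q} : Set (ℝ × ℝ)) = {a, b} := by
  have hne : p ≠ q := fun h => T.loopless p (h ▸ hpq)
  rcases hE.1 p q a b hpq hab _ ⟨s, t, hs.le, ht.le, hst, rfl⟩ h with he | ⟨he, _⟩
  · exact he
  · exfalso
    apply hne
    rcases he with he | he
    · have : t • (q - p) = 0 := by
        have : s • p + t • q - p = t • (q - p) := by
          obtain rfl : s = 1 - t := by linarith
          module
        rw [← this, he, sub_self]
      exact (sub_eq_zero.1 ((smul_eq_zero.1 this).resolve_left ht.ne')).symm
    · have : s • (p - q) = 0 := by
        have : s • p + t • q - q = s • (p - q) := by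
          obtain rfl : t = 1 - s := by linarith
          module
        rw [← this, he, sub_self]
      exact sub_eq_zero.1 ((smul_eq_zero.1 this).resolve_left hs.ne')

/-- Near an inner point of an edge, the drawing consists of that edge only. -/
theorem eventually_mem_edge (hE : T.IsEmbedded) (hpq : T.Adj p q) {s t : ℝ} (hs : 0 < s)
    (ht : 0 < t) (hst : s + t = 1) :
    ∀ᶠ z in nhds (s • p + t • q), z ∈ T.drawing → z ∈ segment ℝ p q := by
  set z0 := s • p + t • q with hz0
  let E : Finset ((ℝ × ℝ) × (ℝ × ℝ)) := (T.verts ×ˢ T.verts).filter fun e =>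
    T.Adj e.1 e.2 ∧ z0 ∉ segment ℝ e.1 e.2
  have hcl : IsClosed (⋃ e ∈ (E : Set ((ℝ × ℝ) × (ℝ × ℝ))), segment ℝ e.1 e.2) := by
    refine E.finite_toSet.isClosed_biUnion fun e _ => ?_
    rw [← convexHull_pair]
    exact (Set.toFinite _).isClosed_convexHull ℝ
  have hz : z0 ∉ ⋃ e ∈ (E : Set ((ℝ × ℝ) × (ℝ × ℝ))), segment ℝ e.1 e.2 := by
    simp only [Set.mem_iUnion, not_exists]
    intro e he
    simp only [E, Finset.coe_filter] at he
    exact he.2.2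
  filter_upwards [hcl.isOpen_compl.mem_nhds hz] with z hz
  rintro ⟨a, b, hab, hzab⟩
  by_cases h0 : z0 ∈ segment ℝ a b
  · rw [← convexHull_pair, edge_eq_of_mem hE hpq hab hs ht hst h0, convexHull_pair]
    exact hzab
  · exfalso
    refine hz ?_
    simp only [Set.mem_iUnion]
    refine ⟨(a, b), ?_, hzab⟩
    simp only [E, Finset.coe_filter, Finset.mem_product]
    exact ⟨T.mem_of_adj a b hab, hab, h0⟩

/-- Points just to the left of the line `p q`. -/
theorem exists_left (hne : p ≠ q) (z : ℝ × ℝ) (hz : det3 p q z = 0) {U : Set (ℝ × ℝ)}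
    (hU : IsOpen U) (hzU : z ∈ U) : ∃ x ∈ U, 0 < det3 p q x := by
  have hc : 0 < (q.1 - p.1) ^ 2 + (q.2 - p.2) ^ 2 := by
    by_contra h0
    apply hne
    have h1 : q.1 - p.1 = 0 := by nlinarith [sq_nonneg (q.1 - p.1), sq_nonneg (q.2 - p.2)]
    have h2 : q.2 - p.2 = 0 := by nlinarith [sq_nonneg (q.1 - p.1), sq_nonneg (q.2 - p.2)]
    ext <;> linarith
  have ht : Filter.Tendsto (fun t : ℝ => z + t • (-(q.2 - p.2), q.1 - p.1))
      (nhdsWithin 0 (Set.Ioi 0)) (nhds z) := by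
    have : Continuous (fun t : ℝ => z + t • ((-(q.2 - p.2), q.1 - p.1) : ℝ × ℝ)) := by fun_prop
    have := this.tendsto 0
    simp only [zero_smul, add_zero] at this
    exact this.mono_left nhdsWithin_le_nhds
  obtain ⟨t, ht1, ht2⟩ := ((ht.eventually (hU.mem_nhds hzU)).and self_mem_nhdsWithin).exists
  refine ⟨_, ht1, ?_⟩
  rw [det3_add_smul, hz, zero_add]
  have : (0 : ℝ) < t := ht2
  have h3 : (q.1 - p.1) * (q.1 - p.1) - (q.2 - p.2) * -(q.2 - p.2) =
    (q.1 - p.1) ^ 2 + (q.2 - p.2) ^ 2 := by ring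
  rw [h3]
  positivity

theorem exists_face_of_isBounded (hI : T.InnerFacesTriangles) {z : ℝ × ℝ} (hz : z ∉ T.drawing)
    (hb : Bornology.IsBounded (connectedComponentIn T.drawingᶜ z)) :
    ∃ a b c, T.Face a b c ∧ z ∈ oTri a b c := by
  obtain ⟨a, -, b, -, c, -, hab, hbc, hac, hF⟩ := hI _ ⟨z, hz, rfl⟩ hb
  have hne : a ≠ b := fun h => T.loopless a (h ▸ hab)
  have hzF : z ∈ connectedComponentIn T.drawingᶜ z := mem_connectedComponentIn hz
  have hsub : openTriangle a b c ⊆ T.drawingᶜ := hF ▸ connectedComponentIn_subset _ _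
  rw [hF] at hzF
  rcases lt_trichotomy (det3 a b c) 0 with h | h | h
  · have h' : 0 < det3 b a c := by rw [det3_swap]; linarith
    have he : openTriangle a b c = oTri b a c := by
      rw [← openTriangle_eq_oTri h']
      unfold openTriangle
      rw [Set.insert_comm]
    rw [he] at hzF hsub
    exact ⟨b, a, c, ⟨T.symm _ _ hab, hac, T.symm _ _ hbc, h',
      Set.disjoint_left.2 fun x hx => hsub hx⟩, hzF⟩
  · rw [openTriangle_eq_empty hne h] at hzF
    exact hzF.elim
  · rw [openTriangle_eq_oTri h] at hzF hsub
    exact ⟨a, b, c, ⟨hab, hbc, T.symm _ _ hac, h, Set.disjoint_left.2 fun x hx => hsub hx⟩, hzF⟩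

theorem mem_outerRegion_or (hI : T.InnerFacesTriangles) {z : ℝ × ℝ} (hz : z ∉ T.drawing) :
    z ∈ T.outerRegion ∨ ∃ a b c, T.Face a b c ∧ z ∈ oTri a b c := by
  by_cases hb : Bornology.IsBounded (connectedComponentIn T.drawingᶜ z)
  · exact Or.inr (exists_face_of_isBounded hI hz hb)
  · exact Or.inl ⟨hz, hb⟩

/-- If `z0` is an inner point of the edge `p q` in the closure of a face on the left of `p q`,
then `p q` is a side of that face. -/
theorem Face.side (hE : T.IsEmbedded) (hpq : T.Adj p q) {a b c : ℝ × ℝ} (h : T.Face a b c)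
    {s t : ℝ} (hs : 0 < s) (ht : 0 < t) (hst : s + t = 1)
    (hz : s • p + t • q ∈ closure (oTri a b c))
    {x : ℝ × ℝ} (hx : x ∈ oTri a b c) (hxl : 0 < det3 p q x) : ∃ r, T.Face p q r := by
  have hne : p ≠ q := fun h => T.loopless p (h ▸ hpq)
  have hm : s • p + t • q ∈ segment ℝ p q := ⟨s, t, hs.le, ht.le, hst, rfl⟩
  have hzn : s • p + t • q ∉ oTri a b c := fun h' =>
    h.2.2.2.2.le_bot ⟨h', _, _, hpq, hm⟩
  have aux : ∀ {a b c : ℝ × ℝ}, T.Face a b c → x ∈ oTri a b c → s • p + t • q ∈ segment ℝ a b →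
      ∃ r, T.Face p q r := by
    intro a b c h hx hseg
    have he := edge_eq_of_mem hE hpq h.1 hs ht hst hseg
    have hpm : p ∈ ({a, b} : Set (ℝ × ℝ)) := he ▸ Set.mem_insert _ _
    have hqm : q ∈ ({a, b} : Set (ℝ × ℝ)) := he ▸ Set.mem_insert_of_mem _ rfl
    rcases hpm with rfl | rfl <;> rcases hqm with rfl | rfl
    · exact absurd rfl hne
    · exact ⟨c, h⟩
    · have := hx.1
      rw [det3_swap] at this
      linarith
    · exact absurd rfl hne
  rcases frontier_oTri h.pos hz hzn with hseg | hseg | hseg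
  · exact aux h hx hseg
  · exact aux h.rot (by rwa [oTri_rot]) hseg
  · exact aux h.rot.rot (by rwa [oTri_rot, oTri_rot]) hseg

/-- The left side of an edge is an inner face or the outer region. -/
theorem face_or_outer (hE : T.IsEmbedded) (hI : T.InnerFacesTriangles) (hpq : T.Adj p q)
    {s t : ℝ} (hs : 0 < s) (ht : 0 < t) (hst : s + t = 1) :
    (∃ r, T.Face p q r) ∨
      ∀ᶠ z in nhds (s • p + t • q), 0 < det3 p q z → z ∈ T.outerRegion := by
  have hne : p ≠ q := fun h => T.loopless p (h ▸ hpq)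
  obtain ⟨ε, hε, hball⟩ := Metric.eventually_nhds_iff_ball.1 (eventually_mem_edge hE hpq hs ht hst)
  have hz0 : det3 p q (s • p + t • q) = 0 := det3_segment ⟨s, t, hs.le, ht.le, hst, rfl⟩
  set z0 := s • p + t • q
  let H : Set (ℝ × ℝ) := Metric.ball z0 ε ∩ {z | 0 < det3 p q z}
  have hHd : H ⊆ T.drawingᶜ := fun z hz hd => hz.2.ne' (det3_segment (hball z hz.1 hd))
  have hHc : IsPreconnected H := ((convex_ball z0 ε).inter (convex_det3_pos p q)).isPreconnected
  have hcl : z0 ∈ closure H := by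
    refine mem_closure_iff.2 fun U hU hzU => ?_
    obtain ⟨x, hx, hxd⟩ := exists_left hne z0 hz0 (hU.inter Metric.isOpen_ball)
      ⟨hzU, Metric.mem_ball_self hε⟩
    exact ⟨x, hx.1, hx.2, hxd⟩
  obtain ⟨x, hx⟩ : H.Nonempty := closure_nonempty_iff.1 ⟨z0, hcl⟩
  rcases mem_outerRegion_or hI (hHd hx) with ho | ⟨a, b, c, hF, hxF⟩
  · right
    filter_upwards [Metric.ball_mem_nhds z0 hε] with z hz hzd
    have hzH : z ∈ H := ⟨hz, hzd⟩
    refine ⟨hHd hzH, ?_⟩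
    rw [← connectedComponentIn_eq (hHc.subset_connectedComponentIn hx hHd hzH)]
    exact ho.2
  · left
    refine hF.side hE hpq hs ht hst (closure_mono ?_ hcl) hxF hx.2
    rw [← hF.component hxF]
    exact hHc.subset_connectedComponentIn hx hHd

theorem drawing_disjoint_outer {z : ℝ × ℝ} (hz : z ∈ T.drawing) : z ∉ interior T.outerRegion :=
  fun h => (interior_subset h).1 hz

/-- An edge without an inner face on its left lies on the frontier of the outer region. -/
theorem mem_frontier_of_not_face (hE : T.IsEmbedded) (hI : T.InnerFacesTriangles) (hpq : T.Adj p q)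
    (hn : ¬ ∃ r, T.Face p q r) {z : ℝ × ℝ} (hz : z ∈ segment ℝ p q) :
    z ∈ frontier T.outerRegion := by
  have hne : p ≠ q := fun h => T.loopless p (h ▸ hpq)
  refine ⟨?_, drawing_disjoint_outer ⟨p, q, hpq, hz⟩⟩
  have hsub : openSegment ℝ p q ⊆ closure T.outerRegion := by
    rintro _ ⟨s, t, hs, ht, hst, rfl⟩
    have hev := (face_or_outer hE hI hpq hs ht hst).resolve_left hn
    obtain ⟨U, hU, hUo, hm⟩ := eventually_nhds_iff.1 hev
    refine mem_closure_iff.2 fun W hW hzW => ?_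
    obtain ⟨x, hx, hxd⟩ := exists_left hne _ (det3_segment ⟨s, t, hs.le, ht.le, hst, rfl⟩)
      (hW.inter hUo) ⟨hzW, hm⟩
    exact ⟨x, hx.1, hU x hx.2 hxd⟩
  have := closure_mono hsub
  rw [closure_openSegment, closure_closure] at this
  exact this hz

end PlaneGraph

end

section

open Filter Topology Bornology

/-- The plane as complex numbers. -/
def toComplex : (ℝ × ℝ) ≃L[ℝ] ℂ := Complex.equivRealProdCLM.symm

/-- The oriented angle under which the segment `p q` is seen from `z`. -/
def viewAngle (p q z : ℝ × ℝ) : ℝ := (toComplex (q - z) / toComplex (p - z)).arg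

theorem toComplex_ne_zero {p z : ℝ × ℝ} (h : p ≠ z) : toComplex (p - z) ≠ 0 := by
  rw [Ne, EmbeddingLike.map_eq_zero_iff, sub_eq_zero]
  exact h

theorem continuous_toComplex_sub (p : ℝ × ℝ) : Continuous fun z => toComplex (p - z) :=
  toComplex.continuous.comp (continuous_const.sub continuous_id)

theorem mem_slitPlane_of_notMem {p q z : ℝ × ℝ} (h : z ∉ segment ℝ p q) :
    toComplex (q - z) / toComplex (p - z) ∈ Complex.slitPlane := by
  have hp : p ≠ z := fun e => h (e ▸ left_mem_segment ℝ p q)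
  by_contra hs
  rw [Complex.mem_slitPlane_iff] at hs
  push Not at hs
  obtain ⟨hre, him⟩ := hs
  set w := toComplex (q - z) / toComplex (p - z) with hw
  have hwr : w = ((w.re : ℝ) : ℂ) := by
    apply Complex.ext <;> simp [him]
  have h1 : toComplex (q - z) = toComplex (w.re • (p - z)) := by
    rw [map_smul, Complex.real_smul, ← hwr, hw, div_mul_cancel₀ _ (toComplex_ne_zero hp)]
  have h2 : q - z = w.re • (p - z) := toComplex.injective h1
  have hpos : 0 < 1 - w.re := by linarith
  refine h ⟨-w.re / (1 - w.re), 1 / (1 - w.re), div_nonneg (by linarith) hpos.le, by positivity, ?_, ?_⟩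
  · field_simp; ring
  · have h3 : (1 - w.re) • z = q - w.re • p := by
      have : q = w.re • (p - z) + z := by rw [← h2]; abel
      rw [this]; module
    have h4 : z = (1 - w.re)⁻¹ • (q - w.re • p) := by
      rw [← h3, smul_smul, inv_mul_cancel₀ hpos.ne', one_smul]
    conv_rhs => rw [h4]
    rw [div_eq_mul_inv, one_div]
    module

theorem continuousAt_viewAngle {p q z : ℝ × ℝ} (h : z ∉ segment ℝ p q) :
    ContinuousAt (viewAngle p q) z := by
  have hp : p ≠ z := fun e => h (e ▸ left_mem_segment ℝ p q)
  exact ContinuousAt.comp (g := Complex.arg)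
    (f := fun z => toComplex (q - z) / toComplex (p - z))
    (Complex.continuousAt_arg (mem_slitPlane_of_notMem h))
    ((continuous_toComplex_sub q).continuousAt.div (continuous_toComplex_sub p).continuousAt
      (toComplex_ne_zero hp))

/-- The change of the direction of `p` when moving from `z` to `z'`. -/
def turn (z p z' : ℝ × ℝ) : ℝ := (toComplex (p - z') / toComplex (p - z)).arg

theorem continuousAt_turn {p z : ℝ × ℝ} (h : p ≠ z) : ContinuousAt (turn z p) z := by
  refine ContinuousAt.comp (g := Complex.arg) (Complex.continuousAt_arg ?_)
    ((continuous_toComplex_sub p).continuousAt.div continuousAt_const (toComplex_ne_zero h))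
  rw [div_self (toComplex_ne_zero h)]
  exact Complex.one_mem_slitPlane

theorem turn_self {p z : ℝ × ℝ} (h : p ≠ z) : turn z p z = 0 := by
  rw [turn, div_self (toComplex_ne_zero h), Complex.arg_one]

theorem viewAngle_sub {p q z : ℝ × ℝ} (h : z ∉ segment ℝ p q) :
    ∀ᶠ z' in 𝓝 z, viewAngle p q z' - viewAngle p q z = turn z q z' - turn z p z' := by
  have hp : p ≠ z := fun e => h (e ▸ left_mem_segment ℝ p q)
  have hq : q ≠ z := fun e => h (e ▸ right_mem_segment ℝ p q)
  have hc : ContinuousAt (fun z' => viewAngle p q z' - viewAngle p q z -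
      (turn z q z' - turn z p z')) z :=
    ((continuousAt_viewAngle h).sub continuousAt_const).sub
      ((continuousAt_turn hq).sub (continuousAt_turn hp))
  have hlt : ∀ᶠ z' in 𝓝 z, |viewAngle p q z' - viewAngle p q z -
      (turn z q z' - turn z p z')| < 2 * Real.pi := by
    refine hc.abs.eventually_lt_const ?_
    simp only [turn_self hp, turn_self hq, sub_self, sub_self, abs_zero]
    positivity
  have hp' : ∀ᶠ z' in 𝓝 z, p ≠ z' := (isOpen_ne.eventually_mem hp.symm).mono fun _ h => Ne.symm h
  have hq' : ∀ᶠ z' in 𝓝 z, q ≠ z' := (isOpen_ne.eventually_mem hq.symm).mono fun _ h => Ne.symm h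
  filter_upwards [hlt, hp', hq'] with z' hlt hp' hq'
  have hang : ((viewAngle p q z' - viewAngle p q z : ℝ) : Real.Angle) =
      (turn z q z' - turn z p z' : ℝ) := by
    simp only [Real.Angle.coe_sub, viewAngle, turn]
    rw [Complex.arg_div_coe_angle (toComplex_ne_zero hq') (toComplex_ne_zero hp'),
      Complex.arg_div_coe_angle (toComplex_ne_zero hq) (toComplex_ne_zero hp),
      Complex.arg_div_coe_angle (toComplex_ne_zero hq') (toComplex_ne_zero hq),
      Complex.arg_div_coe_angle (toComplex_ne_zero hp') (toComplex_ne_zero hp)]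
    abel
  obtain ⟨k, hk⟩ := Real.Angle.angle_eq_iff_two_pi_dvd_sub.1 hang
  rw [hk, abs_mul, abs_of_pos (by positivity : 0 < 2 * Real.pi)] at hlt
  have hk1 : |(k : ℝ)| < 1 := by
    by_contra h1
    push Not at h1
    nlinarith [Real.pi_pos]
  have hk0 : k = 0 := by
    rw [← Int.abs_lt_one_iff]
    exact_mod_cast hk1
  rw [hk0, Int.cast_zero, mul_zero] at hk
  linarith

theorem tendsto_viewAngle_cobounded (p q : ℝ × ℝ) :
    Tendsto (viewAngle p q) (cobounded (ℝ × ℝ)) (𝓝 0) := by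
  have h1 : Tendsto (fun z => toComplex (p - z)) (cobounded (ℝ × ℝ)) (cobounded ℂ) :=
    toComplex.antilipschitz.tendsto_cobounded.comp (tendsto_const_sub_cobounded p)
  have h2 : Tendsto (fun z => 1 + toComplex (q - p) * (toComplex (p - z))⁻¹)
      (cobounded (ℝ × ℝ)) (𝓝 1) := by
    have := ((tendsto_inv₀_cobounded.comp h1).const_mul (toComplex (q - p))).const_add 1
    simpa using this
  have h3 : Tendsto (fun z => toComplex (q - z) / toComplex (p - z)) (cobounded (ℝ × ℝ)) (𝓝 1) := by
    refine h2.congr' ?_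
    have hne : ∀ᶠ z in cobounded (ℝ × ℝ), z ≠ p := by
      have : ({p} : Set (ℝ × ℝ))ᶜ ∈ cobounded (ℝ × ℝ) := isBounded_def.1 isBounded_singleton
      exact this
    filter_upwards [hne] with z hz
    have hz' := toComplex_ne_zero (p := p) (z := z) hz.symm
    field_simp
    rw [← map_add]
    congr 1
    abel
  have h4 := (Complex.continuousAt_arg Complex.one_mem_slitPlane).tendsto.comp h3
  rw [Complex.arg_one] at h4
  exact h4

/-- The vector `q - p` turned by a right angle to the left. -/
def leftNormal (p q : ℝ × ℝ) : ℝ × ℝ := (-(q.2 - p.2), q.1 - p.1)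

theorem viewAngle_mid {p q : ℝ × ℝ} (h : p ≠ q) (t : ℝ) :
    viewAngle p q ((1 / 2 : ℝ) • p + (1 / 2 : ℝ) • q + t • leftNormal p q) =
      (-(1 - 2 * t * Complex.I) / (1 + 2 * t * Complex.I)).arg := by
  unfold viewAngle
  congr 1
  have hd : toComplex (q - p) ≠ 0 := toComplex_ne_zero h.symm
  have hn : toComplex (leftNormal p q) = Complex.I * toComplex (q - p) := by
    apply Complex.ext <;> simp [toComplex, leftNormal, Complex.equivRealProdCLM_symm_apply]
  have e1 : toComplex (q - ((1 / 2 : ℝ) • p + (1 / 2 : ℝ) • q + t • leftNormal p q)) =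
      toComplex (q - p) * (1 / 2) * (1 - 2 * t * Complex.I) := by
    have : q - ((1 / 2 : ℝ) • p + (1 / 2 : ℝ) • q + t • leftNormal p q) =
      (1 / 2 : ℝ) • (q - p) - t • leftNormal p q := by module
    rw [this, map_sub, map_smul, map_smul, hn]
    simp only [Complex.real_smul]
    push_cast
    ring
  have e2 : toComplex (p - ((1 / 2 : ℝ) • p + (1 / 2 : ℝ) • q + t • leftNormal p q)) =
      toComplex (q - p) * (1 / 2) * -(1 + 2 * t * Complex.I) := by
    have : p - ((1 / 2 : ℝ) • p + (1 / 2 : ℝ) • q + t • leftNormal p q) =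
      (-(1 / 2) : ℝ) • (q - p) - t • leftNormal p q := by module
    rw [this, map_sub, map_smul, map_smul, hn]
    simp only [Complex.real_smul]
    push_cast
    ring
  rw [e1, e2, mul_div_mul_left _ _ (mul_ne_zero hd (by norm_num)), div_neg, neg_div]

theorem im_mid (t : ℝ) :
    (-(1 - 2 * t * Complex.I) / (1 + 2 * t * Complex.I)).im = 4 * t / (1 + 4 * t ^ 2) := by
  have : (0 : ℝ) < 1 + 4 * t ^ 2 := by positivity
  have hn : Complex.normSq (1 + 2 * t * Complex.I) = 1 + 4 * t ^ 2 := by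
    simp [Complex.normSq_apply]; ring
  rw [Complex.div_im, hn]
  simp
  ring

theorem continuous_mid : Continuous fun t : ℝ =>
    (-(1 - 2 * t * Complex.I) / (1 + 2 * t * Complex.I) : ℂ) := by
  refine Continuous.div (by fun_prop) (by fun_prop) fun t h => ?_
  have := congrArg Complex.re h
  simp at this

theorem tendsto_mid_right : Tendsto (fun t : ℝ =>
    (-(1 - 2 * t * Complex.I) / (1 + 2 * t * Complex.I) : ℂ).arg) (𝓝[>] 0) (𝓝 Real.pi) := by
  refine (Complex.tendsto_arg_nhdsWithin_im_nonneg_of_re_neg_of_im_zero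
    (z := -1) (by norm_num) (by norm_num)).comp (tendsto_nhdsWithin_iff.2 ⟨?_, ?_⟩)
  · have := continuous_mid.tendsto 0
    simp only [Complex.ofReal_zero, mul_zero, zero_mul, sub_zero, add_zero, div_one] at this
    exact this.mono_left nhdsWithin_le_nhds
  · filter_upwards [self_mem_nhdsWithin] with t ht
    have : (0 : ℝ) < t := ht
    change 0 ≤ Complex.im _
    rw [im_mid]
    positivity

theorem tendsto_mid_left : Tendsto (fun t : ℝ =>
    (-(1 - 2 * (-t : ℝ) * Complex.I) / (1 + 2 * (-t : ℝ) * Complex.I) : ℂ).arg) (𝓝[>] 0)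
      (𝓝 (-Real.pi)) := by
  refine (Complex.tendsto_arg_nhdsWithin_im_neg_of_re_neg_of_im_zero
    (z := -1) (by norm_num) (by norm_num)).comp (tendsto_nhdsWithin_iff.2 ⟨?_, ?_⟩)
  · have := (continuous_mid.comp continuous_neg).tendsto 0
    simp only [Function.comp_def, neg_zero, Complex.ofReal_zero, mul_zero, zero_mul, sub_zero,
      add_zero, div_one] at this
    exact this.mono_left nhdsWithin_le_nhds
  · filter_upwards [self_mem_nhdsWithin] with t ht
    have : (0 : ℝ) < t := ht
    change Complex.im _ < 0
    rw [im_mid]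
    have : 0 < 4 * t / (1 + 4 * t ^ 2) := by positivity
    have h2 : 4 * -t / (1 + 4 * (-t) ^ 2) = - (4 * t / (1 + 4 * t ^ 2)) := by ring
    rw [h2]
    linarith

theorem tendsto_viewAngle_jump {p q : ℝ × ℝ} (h : p ≠ q) :
    Tendsto (fun t : ℝ =>
      viewAngle p q ((1 / 2 : ℝ) • p + (1 / 2 : ℝ) • q + t • leftNormal p q) -
      viewAngle p q ((1 / 2 : ℝ) • p + (1 / 2 : ℝ) • q + (-t) • leftNormal p q)) (𝓝[>] 0)
      (𝓝 (2 * Real.pi)) := by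
  have := tendsto_mid_right.sub tendsto_mid_left
  simp only [viewAngle_mid h]
  convert this using 2
  ring

end

section

open Filter Topology Bornology

namespace PlaneGraph

variable {T : PlaneGraph} {p q r : ℝ × ℝ} {m e : ℝ × ℝ → ℝ × ℝ → ℝ}

/-- A real cycle of the graph: an antisymmetric flow on the edges without sources. -/
structure IsCycle (T : PlaneGraph) (m : ℝ × ℝ → ℝ × ℝ → ℝ) : Prop where
  anti : ∀ p q, m q p = - m p q
  adj : ∀ p q, m p q ≠ 0 → T.Adj p q
  div : ∀ p, ∑ q ∈ T.verts, m p q = 0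

/-- The total angle swept by the flow as seen from `z`. -/
def windingAngle (T : PlaneGraph) (m : ℝ × ℝ → ℝ × ℝ → ℝ) (z : ℝ × ℝ) : ℝ :=
  ∑ p ∈ T.verts, ∑ q ∈ T.verts, m p q * viewAngle p q z

theorem IsCycle.sum_sub (hm : T.IsCycle m) (φ : ℝ × ℝ → ℝ) :
    ∑ p ∈ T.verts, ∑ q ∈ T.verts, m p q * (φ q - φ p) = 0 := by
  have h1 : ∑ p ∈ T.verts, ∑ q ∈ T.verts, m p q * φ p = 0 := by
    refine Finset.sum_eq_zero fun p _ => ?_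
    rw [← Finset.sum_mul, hm.div, zero_mul]
  have h2 : ∑ p ∈ T.verts, ∑ q ∈ T.verts, m p q * φ q = 0 := by
    rw [Finset.sum_comm]
    refine Finset.sum_eq_zero fun q _ => ?_
    rw [← Finset.sum_mul, Finset.sum_congr rfl fun p _ => hm.anti q p, Finset.sum_neg_distrib,
      hm.div, neg_zero, zero_mul]
  simp only [mul_sub, Finset.sum_sub_distrib, h1, h2, sub_zero]

theorem IsCycle.eventually_eq (hm : T.IsCycle m) {z : ℝ × ℝ} (hz : z ∉ T.drawing) :
    ∀ᶠ z' in 𝓝 z, T.windingAngle m z' = T.windingAngle m z := by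
  have h1 : ∀ᶠ z' in 𝓝 z, ∀ p ∈ T.verts, ∀ q ∈ T.verts,
      m p q * (viewAngle p q z' - viewAngle p q z) = m p q * (turn z q z' - turn z p z') := by
    rw [eventually_all_finset]
    intro p _
    rw [eventually_all_finset]
    intro q _
    by_cases h0 : m p q = 0
    · simp [h0]
    · filter_upwards [viewAngle_sub fun h => hz ⟨p, q, hm.adj p q h0, h⟩] with z' h
      rw [h]
  filter_upwards [h1] with z' h
  have h2 := hm.sum_sub fun p => turn z p z'
  rw [← sub_eq_zero, windingAngle, windingAngle, ← Finset.sum_sub_distrib, ← h2]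
  refine Finset.sum_congr rfl fun p hp => ?_
  rw [← Finset.sum_sub_distrib]
  refine Finset.sum_congr rfl fun q hq => ?_
  rw [← mul_sub]
  exact h p hp q hq

theorem IsCycle.eq_of_isPreconnected (hm : T.IsCycle m) {C : Set (ℝ × ℝ)} (hC : IsPreconnected C)
    (hd : C ⊆ T.drawingᶜ) {x y : ℝ × ℝ} (hx : x ∈ C) (hy : y ∈ C) :
    T.windingAngle m x = T.windingAngle m y := by
  have : PreconnectedSpace C := isPreconnected_iff_preconnectedSpace.1 hC
  have hl : IsLocallyConstant fun c : C => T.windingAngle m c := by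
    rw [IsLocallyConstant.iff_eventually_eq]
    intro c
    exact continuous_subtype_val.continuousAt.eventually (hm.eventually_eq (hd c.2))
  exact hl.apply_eq_of_preconnectedSpace ⟨x, hx⟩ ⟨y, hy⟩

theorem IsCycle.windingAngle_outer (hm : T.IsCycle m) {z : ℝ × ℝ} (hz : z ∈ T.outerRegion) :
    T.windingAngle m z = 0 := by
  have hlim : Tendsto (T.windingAngle m) (cobounded (ℝ × ℝ)) (𝓝 0) := by
    have : Tendsto (T.windingAngle m) (cobounded (ℝ × ℝ))
        (𝓝 (∑ p ∈ T.verts, ∑ q ∈ T.verts, m p q * 0)) :=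
      tendsto_finsetSum _ fun p _ => tendsto_finsetSum _ fun q _ =>
        (tendsto_viewAngle_cobounded p q).const_mul _
    simpa using this
  by_contra h0
  apply hz.2
  have hev : ∀ᶠ x in cobounded (ℝ × ℝ), T.windingAngle m x ≠ T.windingAngle m z :=
    hlim.eventually_ne (Ne.symm h0)
  have hb : IsBounded {x | T.windingAngle m x = T.windingAngle m z} := isBounded_def.2 hev
  refine hb.subset fun x hx => ?_
  exact hm.eq_of_isPreconnected isPreconnected_connectedComponentIn
    (connectedComponentIn_subset _ _) hx (mem_connectedComponentIn hz.1)

/-- The centroid of a triangle. -/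
def centroid (p q r : ℝ × ℝ) : ℝ × ℝ := (1 / 3 : ℝ) • (p + q + r)

theorem centroid_rot (p q r : ℝ × ℝ) : centroid q r p = centroid p q r := by
  unfold centroid
  congr 1
  abel

theorem centroid_mem {p q r : ℝ × ℝ} (h : 0 < det3 p q r) : centroid p q r ∈ oTri p q r := by
  refine ⟨?_, ?_, ?_⟩ <;>
  · have h' : 0 < (1 / 3 : ℝ) * det3 p q r := by linarith
    convert h' using 1
    simp only [centroid, det3, Prod.fst_add, Prod.snd_add, Prod.smul_fst, Prod.smul_snd,
      smul_eq_mul]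
    ring

/-- The winding angle of the flow about the inner face on the left of `p q`; zero if there is
none. -/
def faceWinding (T : PlaneGraph) (m : ℝ × ℝ → ℝ × ℝ → ℝ) (p q : ℝ × ℝ) : ℝ :=
  ∑ r ∈ T.verts, if T.Face p q r then T.windingAngle m (centroid p q r) else 0

theorem faceWinding_eq (h : T.Face p q r) :
    T.faceWinding m p q = T.windingAngle m (centroid p q r) := by
  rw [faceWinding, Finset.sum_eq_single r, if_pos h]
  · intro r' _ hne
    exact if_neg fun h' => hne (h'.uniq h)
  · intro hr
    exact absurd (T.mem_of_adj _ _ h.2.1).2 hr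

theorem faceWinding_eq_zero (h : ¬ ∃ r, T.Face p q r) : T.faceWinding m p q = 0 :=
  Finset.sum_eq_zero fun r _ => if_neg fun h' => h ⟨r, h'⟩

theorem IsCycle.eventually_left (hE : T.IsEmbedded) (hI : T.InnerFacesTriangles)
    (hm : T.IsCycle m) (hpq : T.Adj p q) :
    ∀ᶠ z in 𝓝 ((1 / 2 : ℝ) • p + (1 / 2 : ℝ) • q), 0 < det3 p q z →
      T.windingAngle m z = T.faceWinding m p q := by
  have h2 : (0 : ℝ) < 1 / 2 := by norm_num
  have hst : (1 / 2 : ℝ) + 1 / 2 = 1 := by norm_num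
  by_cases hF : ∃ r, T.Face p q r
  · obtain ⟨r, hr⟩ := hF
    filter_upwards [eventually_mem_oTri hr.pos h2 h2 hst] with z hz hz'
    rw [faceWinding_eq hr]
    exact hm.eq_of_isPreconnected (convex_oTri p q r).isPreconnected
      (fun x hx hd => hr.2.2.2.2.le_bot ⟨hx, hd⟩) (hz hz') (centroid_mem hr.pos)
  · filter_upwards [(face_or_outer hE hI hpq h2 h2 hst).resolve_left hF] with z hz hz'
    rw [faceWinding_eq_zero hF, hm.windingAngle_outer (hz hz')]

theorem det3_leftNormal {p q z : ℝ × ℝ} (t : ℝ) :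
    det3 p q (z + t • leftNormal p q) =
      det3 p q z + t * ((q.1 - p.1) ^ 2 + (q.2 - p.2) ^ 2) := by
  rw [det3_add_smul, leftNormal]; ring

theorem IsCycle.jump (hE : T.IsEmbedded) (hI : T.InnerFacesTriangles) (hm : T.IsCycle m)
    (p q : ℝ × ℝ) :
    4 * Real.pi * m p q = T.faceWinding m p q - T.faceWinding m q p := by
  by_cases hpq : T.Adj p q
  swap
  · have h0 : m p q = 0 := by
      by_contra h
      exact hpq (hm.adj p q h)
    rw [h0, faceWinding_eq_zero fun ⟨r, hr⟩ => hpq hr.1,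
      faceWinding_eq_zero fun ⟨r, hr⟩ => hpq (T.symm _ _ hr.1)]
    ring
  have hne : p ≠ q := fun h => T.loopless p (h ▸ hpq)
  have h2 : (0 : ℝ) < 1 / 2 := by norm_num
  have hst : (1 / 2 : ℝ) + 1 / 2 = 1 := by norm_num
  set z0 := (1 / 2 : ℝ) • p + (1 / 2 : ℝ) • q with hz0
  have hdz : det3 p q z0 = 0 := det3_segment ⟨1 / 2, 1 / 2, h2.le, h2.le, hst, rfl⟩
  have hc : 0 < (q.1 - p.1) ^ 2 + (q.2 - p.2) ^ 2 := by
    by_contra h0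
    apply hne
    have h1 : q.1 - p.1 = 0 := by nlinarith [sq_nonneg (q.1 - p.1), sq_nonneg (q.2 - p.2)]
    have h2 : q.2 - p.2 = 0 := by nlinarith [sq_nonneg (q.1 - p.1), sq_nonneg (q.2 - p.2)]
    ext <;> linarith
  have t1 : Tendsto (fun t : ℝ => z0 + t • leftNormal p q) (𝓝[>] 0) (𝓝 z0) := by
    have : Continuous (fun t : ℝ => z0 + t • leftNormal p q) := by fun_prop
    have := this.tendsto 0
    simp only [zero_smul, add_zero] at this
    exact this.mono_left nhdsWithin_le_nhds
  have t2 : Tendsto (fun t : ℝ => z0 + (-t) • leftNormal p q) (𝓝[>] 0) (𝓝 z0) := by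
    have : Continuous (fun t : ℝ => z0 + (-t) • leftNormal p q) := by fun_prop
    have := this.tendsto 0
    simp only [neg_zero, zero_smul, add_zero] at this
    exact this.mono_left nhdsWithin_le_nhds
  have l1 : Tendsto (fun t : ℝ => T.windingAngle m (z0 + t • leftNormal p q) -
      T.windingAngle m (z0 + (-t) • leftNormal p q)) (𝓝[>] 0)
      (𝓝 (T.faceWinding m p q - T.faceWinding m q p)) := by
    refine tendsto_const_nhds.congr' ?_
    have e1 := t1.eventually (hm.eventually_left hE hI hpq)
    have e2 := hm.eventually_left hE hI (T.symm _ _ hpq)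
    rw [add_comm, ← hz0] at e2
    filter_upwards [e1, t2.eventually e2, self_mem_nhdsWithin] with t e1 e2 ht
    have ht : (0 : ℝ) < t := ht
    rw [e1, e2]
    · rw [det3_swap, det3_leftNormal, hdz, zero_add, neg_mul, neg_neg]
      positivity
    · rw [det3_leftNormal, hdz, zero_add]
      positivity
  let J : ℝ × ℝ → ℝ × ℝ → ℝ := fun a b =>
    if a = p ∧ b = q then 2 * Real.pi else if a = q ∧ b = p then -(2 * Real.pi) else 0
  have l2 : Tendsto (fun t : ℝ => T.windingAngle m (z0 + t • leftNormal p q) -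
      T.windingAngle m (z0 + (-t) • leftNormal p q)) (𝓝[>] 0)
      (𝓝 (∑ a ∈ T.verts, ∑ b ∈ T.verts, m a b * J a b)) := by
    simp only [windingAngle, ← Finset.sum_sub_distrib, ← mul_sub]
    refine tendsto_finsetSum _ fun a _ => tendsto_finsetSum _ fun b _ => ?_
    by_cases h0 : m a b = 0
    · simp [h0]
    have hab := hm.adj a b h0
    refine Tendsto.const_mul _ ?_
    by_cases h1 : a = p ∧ b = q
    · obtain ⟨rfl, rfl⟩ := h1
      simp only [J, and_self, if_true]
      exact tendsto_viewAngle_jump hne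
    by_cases h2' : a = q ∧ b = p
    · obtain ⟨rfl, rfl⟩ := h2'
      simp only [J, h1, and_self, if_true, if_false]
      have := (tendsto_viewAngle_jump hne.symm).neg
      refine this.congr fun t => ?_
      have hn : leftNormal b a = - leftNormal a b := by
        ext <;> simp [leftNormal]
      rw [hn, hz0, add_comm ((1 / 2 : ℝ) • a), smul_neg, smul_neg, neg_smul, neg_neg, neg_sub]
    · simp only [J, h1, h2', if_false]
      have hns : z0 ∉ segment ℝ a b := by
        intro h
        have he := edge_eq_of_mem hE hpq hab h2 h2 hst h
        have ha : a ∈ ({p, q} : Set (ℝ × ℝ)) := he ▸ Set.mem_insert _ _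
        have hb : b ∈ ({p, q} : Set (ℝ × ℝ)) := he ▸ Set.mem_insert_of_mem _ rfl
        have hne' : a ≠ b := fun h => T.loopless a (h ▸ hab)
        rcases ha with rfl | rfl <;> rcases hb with rfl | rfl <;> simp_all
      have hcont := (continuousAt_viewAngle hns).tendsto
      simpa using (hcont.comp t1).sub (hcont.comp t2)
  have hlim := tendsto_nhds_unique l1 l2
  rw [hlim]
  obtain ⟨hp, hq⟩ := T.mem_of_adj p q hpq
  have s1 : ∀ a b, m a b * J a b = (if a = p then if b = q then 2 * Real.pi * m p q else 0 else 0) +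
      (if a = q then if b = p then 2 * Real.pi * m p q else 0 else 0) := by
    intro a b
    by_cases h1 : a = p ∧ b = q
    · obtain ⟨rfl, rfl⟩ := h1
      simp [J, hne]; ring
    by_cases h2 : a = q ∧ b = p
    · obtain ⟨rfl, rfl⟩ := h2
      simp [J, hne.symm, hm.anti b a]; ring
    · simp only [J, h1, h2, if_false, mul_zero, ← ite_and, add_zero]
  simp only [s1, Finset.sum_add_distrib]
  simp [hp, hq]
  ring

theorem sum_rot (V : Finset (ℝ × ℝ)) (F : ℝ × ℝ → ℝ × ℝ → ℝ × ℝ → ℝ) :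
    ∑ p ∈ V, ∑ q ∈ V, ∑ r ∈ V, F q r p = ∑ p ∈ V, ∑ q ∈ V, ∑ r ∈ V, F p q r := by
  rw [Finset.sum_comm]
  exact Finset.sum_congr rfl fun q _ => Finset.sum_comm

theorem sum_faceWinding (he : ∀ p q r, T.Face p q r → e p q + e q r + e r p = 0) :
    ∑ p ∈ T.verts, ∑ q ∈ T.verts, T.faceWinding m p q * e p q = 0 := by
  let F : ℝ × ℝ → ℝ × ℝ → ℝ × ℝ → ℝ := fun p q r =>
    if T.Face p q r then T.windingAngle m (centroid p q r) * e p q else 0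
  have h1 : ∑ p ∈ T.verts, ∑ q ∈ T.verts, T.faceWinding m p q * e p q =
      ∑ p ∈ T.verts, ∑ q ∈ T.verts, ∑ r ∈ T.verts, F p q r := by
    refine Finset.sum_congr rfl fun p _ => Finset.sum_congr rfl fun q _ => ?_
    rw [faceWinding, Finset.sum_mul]
    refine Finset.sum_congr rfl fun r _ => ?_
    simp only [F, ite_mul, zero_mul]
  have h2 := sum_rot T.verts F
  have h3 := sum_rot T.verts fun p q r => F q r p
  have h4 : ∑ p ∈ T.verts, ∑ q ∈ T.verts, ∑ r ∈ T.verts, (F p q r + F q r p + F r p q) = 0 := by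
    refine Finset.sum_eq_zero fun p _ => Finset.sum_eq_zero fun q _ =>
      Finset.sum_eq_zero fun r _ => ?_
    by_cases h : T.Face p q r
    · simp only [F, if_pos h, if_pos h.rot, if_pos h.rot.rot, centroid_rot]
      rw [centroid_rot, ← mul_add, ← mul_add, he p q r h, mul_zero]
    · have h' : ¬ T.Face q r p := fun h' => h h'.rot.rot
      have h'' : ¬ T.Face r p q := fun h' => h h'.rot
      simp only [F, if_neg h, if_neg h', if_neg h'', add_zero]
  simp only [Finset.sum_add_distrib] at h4
  rw [h1]
  linarith

/-- Every cycle is a combination of the boundaries of the inner faces. -/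
theorem IsCycle.sum_eq_zero (hE : T.IsEmbedded) (hI : T.InnerFacesTriangles) (hm : T.IsCycle m)
    (ha : ∀ p q, e q p = - e p q) (he : ∀ p q r, T.Face p q r → e p q + e q r + e r p = 0) :
    ∑ p ∈ T.verts, ∑ q ∈ T.verts, m p q * e p q = 0 := by
  have h1 := sum_faceWinding (m := m) he
  have h2 : ∑ p ∈ T.verts, ∑ q ∈ T.verts, T.faceWinding m q p * e p q = 0 := by
    rw [Finset.sum_comm, ← neg_eq_zero, ← Finset.sum_neg_distrib, ← h1]
    refine Finset.sum_congr rfl fun p _ => ?_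
    rw [← Finset.sum_neg_distrib]
    refine Finset.sum_congr rfl fun q _ => ?_
    rw [ha]; ring
  have h3 : 4 * Real.pi * ∑ p ∈ T.verts, ∑ q ∈ T.verts, m p q * e p q = 0 := by
    rw [← sub_eq_zero.2 (h1.trans h2.symm), ← Finset.sum_sub_distrib, Finset.mul_sum]
    refine Finset.sum_congr rfl fun p _ => ?_
    rw [← Finset.sum_sub_distrib, Finset.mul_sum]
    refine Finset.sum_congr rfl fun q _ => ?_
    rw [← mul_assoc, hm.jump hE hI]; ring
  exact (mul_eq_zero.1 h3).resolve_left (by positivity)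

end PlaneGraph

end

section

open Filter Topology Bornology

namespace PlaneGraph

variable {T : PlaneGraph} {p q r : ℝ × ℝ} {e : ℝ × ℝ → ℝ × ℝ → ℝ}

/-- The unit flow along the edge from `b` to `c`. -/
def edgeFlow (b c p q : ℝ × ℝ) : ℝ :=
  (if p = b ∧ q = c then 1 else 0) - (if p = c ∧ q = b then 1 else 0)

theorem edgeFlow_anti (b c p q : ℝ × ℝ) : edgeFlow b c q p = - edgeFlow b c p q := by
  simp only [edgeFlow, and_comm (a := q = b), and_comm (a := q = c)]
  ring

theorem adj_of_edgeFlow_ne_zero {b c : ℝ × ℝ} (hbc : T.Adj b c) (h : edgeFlow b c p q ≠ 0) :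
    T.Adj p q := by
  by_cases h1 : p = b ∧ q = c
  · rw [h1.1, h1.2]; exact hbc
  by_cases h2 : p = c ∧ q = b
  · rw [h2.1, h2.2]; exact T.symm _ _ hbc
  · simp [edgeFlow, h1, h2] at h

theorem sum_edgeFlow {b c : ℝ × ℝ} (hbc : T.Adj b c) (p : ℝ × ℝ) :
    ∑ q ∈ T.verts, edgeFlow b c p q = (if p = b then 1 else 0) - (if p = c then 1 else 0) := by
  obtain ⟨hb, hc⟩ := T.mem_of_adj _ _ hbc
  simp [edgeFlow, Finset.sum_sub_distrib, ite_and, hb, hc]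

theorem sum_edgeFlow_mul {b c : ℝ × ℝ} (hbc : T.Adj b c) (ha : ∀ p q, e q p = - e p q) :
    ∑ p ∈ T.verts, ∑ q ∈ T.verts, edgeFlow b c p q * e p q = 2 * e b c := by
  obtain ⟨hb, hc⟩ := T.mem_of_adj _ _ hbc
  simp only [edgeFlow, sub_mul, Finset.sum_sub_distrib, ite_and, ite_mul, one_mul, zero_mul,
    Finset.sum_ite_irrel, Finset.sum_const_zero, Finset.sum_ite_eq', hb, hc, if_true]
  rw [ha b c]; ring

theorem Reachable.exists_flow {a b : ℝ × ℝ} (h : T.Reachable a b) :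
    ∃ m : ℝ × ℝ → ℝ × ℝ → ℝ, (∀ p q, m q p = - m p q) ∧ (∀ p q, m p q ≠ 0 → T.Adj p q) ∧
      ∀ p, ∑ q ∈ T.verts, m p q = (if p = a then 1 else 0) - (if p = b then 1 else 0) := by
  induction h with
  | refl => exact ⟨fun _ _ => 0, by simp, by simp, by simp⟩
  | @tail b c _ hbc ih =>
    obtain ⟨m, h1, h2, h3⟩ := ih
    refine ⟨fun p q => m p q + edgeFlow b c p q, fun p q => ?_, fun p q h => ?_, fun p => ?_⟩
    · simp only [h1 p q, edgeFlow_anti b c p q]; ring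
    · by_cases h0 : m p q = 0
      · exact adj_of_edgeFlow_ne_zero hbc (by simpa [h0] using h)
      · exact h2 p q h0
    · rw [Finset.sum_add_distrib, h3, sum_edgeFlow hbc]; ring

/-- A function on oriented edges summing to zero around every inner face is a gradient. -/
theorem exists_potential (hE : T.IsEmbedded) (hI : T.InnerFacesTriangles) (hc : T.Connected)
    (ha : ∀ p q, e q p = - e p q) (he : ∀ p q r, T.Face p q r → e p q + e q r + e r p = 0) :
    ∃ f : ℝ × ℝ → ℝ, ∀ p q, T.Adj p q → f q - f p = e p q := by
  obtain ⟨⟨a, hav⟩, hreach⟩ := hc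
  have hex : ∀ b, ∃ m : ℝ × ℝ → ℝ × ℝ → ℝ, b ∈ T.verts → (∀ p q, m q p = - m p q) ∧
      (∀ p q, m p q ≠ 0 → T.Adj p q) ∧
      ∀ p, ∑ q ∈ T.verts, m p q = (if p = a then 1 else 0) - (if p = b then 1 else 0) := by
    intro b
    by_cases hb : b ∈ T.verts
    · obtain ⟨m, hm⟩ := Reachable.exists_flow (hreach a hav b hb)
      exact ⟨m, fun _ => hm⟩
    · exact ⟨fun _ _ => 0, fun h => absurd h hb⟩
  choose m hm using hex
  refine ⟨fun b => 1 / 2 * ∑ p ∈ T.verts, ∑ q ∈ T.verts, m b p q * e p q, fun x y hxy => ?_⟩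
  obtain ⟨hx, hy⟩ := T.mem_of_adj x y hxy
  obtain ⟨x1, x2, x3⟩ := hm x hx
  obtain ⟨y1, y2, y3⟩ := hm y hy
  have hcyc : T.IsCycle fun p q => m x p q + edgeFlow x y p q - m y p q := by
    refine ⟨fun p q => ?_, fun p q h => ?_, fun p => ?_⟩
    · simp only [x1 p q, y1 p q, edgeFlow_anti x y p q]; ring
    · by_contra hn
      have e1 : m x p q = 0 := by_contra fun h => hn (x2 p q h)
      have e2 : m y p q = 0 := by_contra fun h => hn (y2 p q h)
      have e3 : edgeFlow x y p q = 0 := by_contra fun h => hn (adj_of_edgeFlow_ne_zero hxy h)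
      exact h (by rw [e1, e2, e3]; ring)
    · rw [Finset.sum_sub_distrib, Finset.sum_add_distrib, x3, y3, sum_edgeFlow hxy]; ring
  have hs := hcyc.sum_eq_zero hE hI ha he
  simp only [sub_mul, add_mul, Finset.sum_sub_distrib, Finset.sum_add_distrib,
    sum_edgeFlow_mul hxy ha] at hs
  linarith

theorem Connected.eq_of_adj (hc : T.Connected) {f : ℝ × ℝ → ℝ}
    (h : ∀ x y, T.Adj x y → f x = f y) {x y : ℝ × ℝ} (hx : x ∈ T.verts) (hy : y ∈ T.verts) :
    f x = f y := by
  have := hc.2 x hx y hy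
  unfold Reachable at this
  induction this with
  | refl => rfl
  | @tail b c _ hbc ih => exact (ih (T.mem_of_adj _ _ hbc).1).trans (h _ _ hbc)

theorem Biconnected.eq_of_adj (hB : T.Biconnected) {w : ℝ × ℝ} (hw : w ∈ T.verts) {f : ℝ × ℝ → ℝ}
    (h : ∀ x y, T.Adj x y → x ≠ w → y ≠ w → f x = f y) {x y : ℝ × ℝ} (hx : x ∈ T.verts)
    (hxw : x ≠ w) (hy : y ∈ T.verts) (hyw : y ≠ w) : f x = f y :=
  (hB.2.2 w hw).eq_of_adj (f := f)
    (fun x y hxy => h x y hxy.1 (fun e => hxy.2.1 (Finset.mem_singleton.2 e))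
      fun e => hxy.2.2 (Finset.mem_singleton.2 e))
    (Finset.mem_sdiff.2 ⟨hx, fun e => hxw (Finset.mem_singleton.1 e)⟩)
    (Finset.mem_sdiff.2 ⟨hy, fun e => hyw (Finset.mem_singleton.1 e)⟩)

/-- Every edge is a side of an inner face. -/
theorem exists_face_of_adj (hE : T.IsEmbedded) (hB : T.Biconnected) (hI : T.InnerFacesTriangles)
    (hpq : T.Adj p q) : Nbr T.Face p q := by
  by_contra hn
  unfold Nbr Side at hn
  push Not at hn
  have hne : p ≠ q := fun h => T.loopless p (h ▸ hpq)
  obtain ⟨hp, hq⟩ := T.mem_of_adj p q hpq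
  have h0 : ∀ x y z, T.Face x y z → edgeFlow p q x y = 0 := by
    intro x y z h
    by_cases h1 : x = p ∧ y = q
    · obtain ⟨rfl, rfl⟩ := h1
      exact absurd h (hn.1 z)
    by_cases h2 : x = q ∧ y = p
    · obtain ⟨rfl, rfl⟩ := h2
      exact absurd h (hn.2 z)
    · simp [edgeFlow, h1, h2]
  obtain ⟨f, hf⟩ := exists_potential (e := edgeFlow p q) hE hI hB.2.1 (edgeFlow_anti p q)
    fun x y z h => by rw [h0 _ _ _ h, h0 _ _ _ h.rot, h0 _ _ _ h.rot.rot]; ring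
  have h1 : f q - f p = 1 := by
    rw [hf p q hpq]
    simp [edgeFlow, hne]
  have hcard : (({p, q} : Finset (ℝ × ℝ))).card < T.verts.card :=
    lt_of_le_of_lt Finset.card_le_two hB.1
  obtain ⟨w, hw, hwn⟩ := Finset.exists_mem_notMem_of_card_lt_card hcard
  simp only [Finset.mem_insert, Finset.mem_singleton, not_or] at hwn
  have hconst : ∀ x y, T.Adj x y → ¬ (x = p ∧ y = q) → ¬ (x = q ∧ y = p) → f x = f y := by
    intro x y hxy h1 h2
    have := hf x y hxy
    simp only [edgeFlow, h1, h2, if_false, sub_zero] at this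
    linarith
  have hwq : f w = f q := hB.eq_of_adj hp (fun x y hxy hx hy =>
    hconst x y hxy (fun h => hx h.1) fun h => hy h.2) hw hwn.1 hq hne.symm
  have hwp : f w = f p := hB.eq_of_adj hq (fun x y hxy hx hy =>
    hconst x y hxy (fun h => hy h.2) fun h => hx h.1) hw hwn.2 hp hne
  linarith

theorem Face.ne (h : T.Face p q r) : p ≠ q := fun e => T.loopless p (e ▸ h.1)

theorem nbr_face_iff (hE : T.IsEmbedded) (hB : T.Biconnected) (hI : T.InnerFacesTriangles) :
    Nbr T.Face p q ↔ T.Adj p q := by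
  refine ⟨?_, exists_face_of_adj hE hB hI⟩
  rintro (⟨r, h⟩ | ⟨r, h⟩)
  · exact h.1
  · exact T.symm _ _ h.1

/-- The inner faces of a near-triangulation form a triangulated disc. -/
theorem IsNearTriangulation.triDisc (hT : T.IsNearTriangulation) : TriDisc T.verts T.Face := by
  obtain ⟨hE, hB, hI⟩ := hT
  have hnbr : ∀ {p q}, Nbr T.Face p q ↔ T.Adj p q := nbr_face_iff hE hB hI
  refine
    { mem := fun h => (T.mem_of_adj _ _ h.1).1
      rot := fun h => h.rot
      ne := fun h => h.ne
      uniq := fun h h' => h.uniq h'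
      conn := fun f hf x hx y hy => hB.2.1.eq_of_adj (f := f) (fun x y hxy => ?_) hx hy
      link := fun w g hg x y hx hy => ?_
      pot := fun e ha he => ?_ }
  · rcases hnbr.2 hxy with ⟨z, h⟩ | ⟨z, h⟩
    · exact hf _ _ _ h
    · exact (hf _ _ _ h).symm
  · rw [hnbr] at hx hy
    let e : ℝ × ℝ → ℝ × ℝ → ℝ := fun p q =>
      if p = w then (if q = w then 0 else g q) else if q = w then - g p else 0
    have e1 : ∀ p q r, T.Face p q r → p = w → e p q + e q r + e r p = 0 := by
      rintro p q r h rfl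
      have hq : q ≠ p := h.ne.symm
      have hr : r ≠ p := h.rot.rot.ne
      simp only [e, hq, hr, if_true, if_false]
      linarith [hg _ _ h]
    obtain ⟨f, hf⟩ := exists_potential (e := e) hE hI hB.2.1 (fun p q => by
        simp only [e]; split_ifs <;> simp) (fun p q r h => by
        by_cases hp : p = w
        · exact e1 p q r h hp
        by_cases hq : q = w
        · linarith [e1 q r p h.rot hq]
        by_cases hr : r = w
        · linarith [e1 r p q h.rot.rot hr]
        · simp [e, hp, hq, hr])
    have hxw : x ≠ w := fun h => T.loopless w (h ▸ hx)
    have hyw : y ≠ w := fun h => T.loopless w (h ▸ hy)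
    have h1 : f x = f y := by
      refine hB.eq_of_adj (T.mem_of_adj _ _ hx).1 (fun a b hab ha hb => ?_)
        (T.mem_of_adj _ _ hx).2 hxw (T.mem_of_adj _ _ hy).2 hyw
      have := hf a b hab
      simp only [e, ha, hb, if_false] at this
      linarith
    have h2 := hf w x hx
    have h3 := hf w y hy
    simp only [e, hxw, hyw, if_true, if_false] at h2 h3
    linarith
  · obtain ⟨f, hf⟩ := exists_potential hE hI hB.2.1 (fun p q => ha p q) he
    exact ⟨f, fun x y z h => hf x y h.1⟩

/-- Points close to an edge with inner faces on both sides do not lie in the outer region. -/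
theorem not_mem_frontier_of_faces {r' : ℝ × ℝ} (h : T.Face p q r) (h' : T.Face q p r') :
    (1 / 2 : ℝ) • p + (1 / 2 : ℝ) • q ∉ frontier T.outerRegion := by
  have h2 : (0 : ℝ) < 1 / 2 := by norm_num
  have hst : (1 / 2 : ℝ) + 1 / 2 = 1 := by norm_num
  have aux : ∀ {p q r : ℝ × ℝ}, T.Face p q r →
      ∀ᶠ z in 𝓝 ((1 / 2 : ℝ) • p + (1 / 2 : ℝ) • q), 0 ≤ det3 p q z → z ∉ T.outerRegion := by
    intro p q r h
    obtain ⟨h3, h4⟩ := det3_mid_left p q (r := r) hst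
    have hp := h.pos
    have e1 : ∀ᶠ z in 𝓝 ((1 / 2 : ℝ) • p + (1 / 2 : ℝ) • q), 0 < det3 q r z :=
      (continuous_det3 q r).continuousAt.eventually_const_lt (by rw [h3]; positivity)
    have e2 : ∀ᶠ z in 𝓝 ((1 / 2 : ℝ) • p + (1 / 2 : ℝ) • q), 0 < det3 r p z :=
      (continuous_det3 r p).continuousAt.eventually_const_lt (by rw [h4]; positivity)
    filter_upwards [e1, e2] with z h1 h2 h3 ho
    have hc : z ∈ cTri p q r := ⟨h3, h1.le, h2.le⟩
    rcases h3.eq_or_lt with h0 | h0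
    · exact ho.1 ⟨p, q, h.1, mem_segment_of_det3 hp hc h0.symm⟩
    · refine ho.2 ?_
      rw [h.component ⟨h0, h1, h2⟩]
      exact (isBounded_cTri hp).subset (oTri_subset_cTri _ _ _)
  have e1 := aux h
  have e2 := aux h'
  rw [add_comm] at e2
  intro hf
  have hcl := mem_closure_iff_frequently.1 (frontier_subset_closure hf)
  refine hcl ?_
  filter_upwards [e1, e2] with z h1 h2
  rcases le_total 0 (det3 p q z) with h | h
  · exact h1 h
  · refine h2 ?_
    rw [det3_swap]
    linarith

variable {h : ℕ} {u : ZMod h → ℝ × ℝ}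

theorem IsBoundaryCycle.exists_bd (hT : T.IsNearTriangulation) (hu : T.IsBoundaryCycle u)
    (i : ZMod h) : ∃ a b, Bd T.Face a b ∧ ((a = u i ∧ b = u (i + 1)) ∨ (b = u i ∧ a = u (i + 1))) := by
  obtain ⟨hE, hB, hI⟩ := hT
  have hadj := hu.2.2.2.1 i
  have hnbr := exists_face_of_adj hE hB hI hadj
  have hmid : (1 / 2 : ℝ) • u i + (1 / 2 : ℝ) • u (i + 1) ∈ frontier T.outerRegion :=
    hu.2.2.2.2.1 i ⟨1 / 2, 1 / 2, by norm_num, by norm_num, by norm_num, rfl⟩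
  rcases hnbr with hs | hs
  · refine ⟨u i, u (i + 1), ⟨hs, fun ⟨r', h'⟩ => ?_⟩, Or.inl ⟨rfl, rfl⟩⟩
    obtain ⟨r, hr⟩ := hs
    exact not_mem_frontier_of_faces hr h' hmid
  · refine ⟨u (i + 1), u i, ⟨hs, fun ⟨r', h'⟩ => ?_⟩, Or.inr ⟨rfl, rfl⟩⟩
    obtain ⟨r, hr⟩ := hs
    exact not_mem_frontier_of_faces h' hr hmid

theorem IsInteriorVtx.two_sided (hT : T.IsNearTriangulation) (hu : T.IsBoundaryCycle u)
    {v x : ℝ × ℝ} (hv : T.IsInteriorVtx u v) (hx : T.Adj v x) :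
    Side T.Face v x ∧ Side T.Face x v := by
  constructor
  · by_contra hn
    exact hv.2 (hu.2.2.2.2.2 v hv.1 (mem_frontier_of_not_face hT.1 hT.2.2 hx hn
      (left_mem_segment ℝ v x)))
  · by_contra hn
    exact hv.2 (hu.2.2.2.2.2 v hv.1 (mem_frontier_of_not_face hT.1 hT.2.2 (T.symm _ _ hx) hn
      (right_mem_segment ℝ x v)))

end PlaneGraph

end

section

open Filter Topology Bornology

theorem abs_det3_lt {p q r x y : ℝ × ℝ} (hx : x ∈ oTri p q r) (hy : y ∈ cTri p q r) :
    |det3 p x y| < det3 p q r := by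
  obtain ⟨x1, x2, x3⟩ := hx
  obtain ⟨y1, y2, y3⟩ := hy
  have hxs := det3_sum p q r x
  have hys := det3_sum p q r y
  have hD : 0 < det3 p q r := by linarith
  have key : det3 p q r * det3 p x y =
      det3 r p x * det3 p q y - det3 p q x * det3 r p y := by
    unfold det3; ring
  have h1 : det3 r p x * det3 p q y < det3 p q r * det3 p q r := by nlinarith
  have h2 : det3 p q x * det3 r p y < det3 p q r * det3 p q r := by nlinarith
  have h3 : 0 ≤ det3 r p x * det3 p q y := mul_nonneg x3.le y1
  have h4 : 0 ≤ det3 p q x * det3 r p y := mul_nonneg x1.le y3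
  rw [abs_lt]
  constructor
  · by_contra hn
    nlinarith
  · by_contra hn
    nlinarith

theorem exists_eq_comb_of_det3_eq_zero {p q r : ℝ × ℝ} (hpq : p ≠ q) (h : det3 p q r = 0) :
    ∃ t : ℝ, r = (1 - t) • p + t • q := by
  have h' : (q.1 - p.1) * (r.2 - p.2) = (q.2 - p.2) * (r.1 - p.1) := by
    unfold det3 at h; linarith
  by_cases h1 : q.1 - p.1 = 0
  · have h2 : q.2 - p.2 ≠ 0 := fun h2 => hpq (Prod.ext (by linarith) (by linarith))
    have h3 : r.1 - p.1 = 0 := by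
      rw [h1, zero_mul, zero_eq_mul] at h'
      exact h'.resolve_left h2
    refine ⟨(r.2 - p.2) / (q.2 - p.2), Prod.ext ?_ ?_⟩ <;>
      simp only [Prod.fst_add, Prod.snd_add, Prod.smul_fst, Prod.smul_snd, smul_eq_mul]
    · have e1 : q.1 = p.1 := by linarith
      have e2 : r.1 = p.1 := by linarith
      rw [e1, e2]; ring
    · field_simp; ring
  · refine ⟨(r.1 - p.1) / (q.1 - p.1), Prod.ext ?_ ?_⟩ <;>
      simp only [Prod.fst_add, Prod.snd_add, Prod.smul_fst, Prod.smul_snd, smul_eq_mul]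
    · field_simp; ring
    · field_simp; linarith

namespace PlaneGraph

variable {T : PlaneGraph} {p q r x y : ℝ × ℝ}

theorem det3_ne_zero_of_adj (hE : T.IsEmbedded) (hpq : T.Adj p q) (hqr : T.Adj q r)
    (hrp : T.Adj r p) : det3 p q r ≠ 0 := by
  intro h0
  have hpq' : p ≠ q := fun h => T.loopless p (h ▸ hpq)
  have hqr' : q ≠ r := fun h => T.loopless q (h ▸ hqr)
  have hrp' : r ≠ p := fun h => T.loopless r (h ▸ hrp)
  obtain ⟨hp, hq⟩ := T.mem_of_adj _ _ hpq
  have hr := (T.mem_of_adj _ _ hrp).1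
  obtain ⟨t, ht⟩ := exists_eq_comb_of_det3_eq_zero hpq' h0
  rcases lt_or_ge t 0 with h1 | h1
  · have hm : p ∈ segment ℝ q r := by
      refine ⟨-t / (1 - t), 1 / (1 - t), div_nonneg (by linarith) (by linarith),
        div_nonneg (by linarith) (by linarith), ?_, ?_⟩
      · have : 1 - t ≠ 0 := by linarith
        field_simp; ring
      · have : 1 - t ≠ 0 := by linarith
        rw [ht, smul_add, smul_smul, smul_smul, div_mul_cancel₀ _ this, one_smul,
          add_comm, add_assoc, ← add_smul]
        have e : 1 / (1 - t) * t + -t / (1 - t) = 0 := by field_simp; ring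
        rw [e, zero_smul, add_zero]
    rcases hE.2 q r p hqr hp hm with h | h
    · exact hpq' h
    · exact hrp' h.symm
  rcases le_or_gt t 1 with h2 | h2
  · rcases hE.2 p q r hpq hr ⟨1 - t, t, by linarith, h1, by ring, ht.symm⟩ with h | h
    · exact hrp' h
    · exact hqr' h.symm
  · have hm : q ∈ segment ℝ r p := by
      refine ⟨1 / t, (t - 1) / t, div_nonneg (by linarith) (by linarith),
        div_nonneg (by linarith) (by linarith), ?_, ?_⟩
      · have : t ≠ 0 := by linarith
        field_simp; ring
      · have : t ≠ 0 := by linarith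
        rw [ht, smul_add, smul_smul, smul_smul, div_mul_cancel₀ _ this, one_smul,
          add_comm, ← add_assoc, ← add_smul]
        have e : (t - 1) / t + 1 / t * (1 - t) = 0 := by field_simp; ring
        rw [e, zero_smul, zero_add]
    rcases hE.2 r p q hrp hq hm with h | h
    · exact hqr' h
    · exact hpq' h.symm

theorem segment_subset_drawing (h : T.Adj p q) : segment ℝ p q ⊆ T.drawing :=
  fun _ hz => ⟨p, q, h, hz⟩

theorem subset_oTri (hpq : T.Adj p q) (hqr : T.Adj q r) (hrp : T.Adj r p)
    (h : 0 < det3 p q r) {S : Set (ℝ × ℝ)} (hS : IsPreconnected S) (hSd : ∀ z ∈ S, z ∉ T.drawing)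
    (hne : (S ∩ oTri p q r).Nonempty) : S ⊆ oTri p q r := by
  refine hS.subset_of_closure_inter_subset (isOpen_oTri _ _ _) hne ?_
  rintro z ⟨hz, hzS⟩
  by_contra hn
  rcases frontier_oTri h hz hn with h' | h' | h'
  · exact hSd z hzS (segment_subset_drawing hpq h')
  · exact hSd z hzS (segment_subset_drawing hqr h')
  · exact hSd z hzS (segment_subset_drawing hrp h')

theorem oTri_inter_nonempty (h : 0 < det3 p q r) (h' : 0 < det3 p q x) :
    (oTri p q x ∩ oTri p q r).Nonempty := by
  have hst : (1 / 2 : ℝ) + 1 / 2 = 1 := by norm_num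
  have h2 : (0 : ℝ) < 1 / 2 := by norm_num
  have hne : p ≠ q := by rintro rfl; rw [det3_self] at h; exact lt_irrefl _ h
  obtain ⟨U, hU, hUo, hmU⟩ := eventually_nhds_iff.1
    ((eventually_mem_oTri h h2 h2 hst).and (eventually_mem_oTri h' h2 h2 hst))
  obtain ⟨z, hz, hl⟩ := exists_left hne _ (det3_segment ⟨_, _, h2.le, h2.le, hst, rfl⟩) hUo hmU
  exact ⟨z, (hU z hz).2 hl, (hU z hz).1 hl⟩

/-- The apex of a face inside a triangle of the graph lies strictly inside the triangle. -/
theorem Face.apex_mem_oTri (hE : T.IsEmbedded) (hf : T.Face p q x) (hqr : T.Adj q r)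
    (hrp : T.Adj r p) (h : 0 < det3 p q r) (hx : x ≠ r) : x ∈ oTri p q r := by
  have hsub : oTri p q x ⊆ oTri p q r :=
    subset_oTri hf.1 hqr hrp h (convex_oTri _ _ _).isPreconnected
      (fun z hz hd => hf.2.2.2.2.le_bot ⟨hz, hd⟩) (oTri_inter_nonempty h hf.pos)
  have hxc : x ∈ cTri p q x := by
    refine ⟨hf.pos.le, ?_, ?_⟩
    · rw [det3_right]
    · rw [det3_left]
  have hc : x ∈ cTri p q r :=
    (isClosed_cTri p q r).closure_subset_iff.2 (hsub.trans (oTri_subset_cTri p q r))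
      (cTri_subset_closure hf.pos hxc)
  have hv : x ∈ T.verts := (T.mem_of_adj _ _ hf.2.1).2
  have hxq : x ≠ q := hf.rot.ne.symm
  have hxp : x ≠ p := hf.rot.rot.ne
  refine ⟨hf.pos, hc.2.1.lt_of_ne fun h0 => ?_, hc.2.2.lt_of_ne fun h0 => ?_⟩
  · have := mem_segment_of_det3 (by rwa [det3_rot]) (by rwa [cTri_rot]) h0.symm
    rcases hE.2 q r x hqr hv this with h | h
    · exact hxq h
    · exact hx h
  · have := mem_segment_of_det3 (by rwa [det3_rot, det3_rot]) (by rwa [cTri_rot, cTri_rot])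
      h0.symm
    rcases hE.2 r p x hrp hv this with h | h
    · exact hx h
    · exact hxp h

theorem not_mem_oTri_corner : p ∉ oTri p q r ∧ q ∉ oTri p q r ∧ r ∉ oTri p q r := by
  refine ⟨fun h => ?_, fun h => ?_, fun h => ?_⟩
  · have := h.1; rw [det3_left] at this; exact lt_irrefl _ this
  · have := h.1; rw [det3_right] at this; exact lt_irrefl _ this
  · have := h.2.1; rw [det3_right] at this; exact lt_irrefl _ this

/-- A neighbor of a vertex strictly inside a triangle of the graph lies in the closed triangle. -/
theorem mem_cTri_of_adj (hE : T.IsEmbedded) (hpq : T.Adj p q) (hqr : T.Adj q r) (hrp : T.Adj r p)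
    (h : 0 < det3 p q r) (hx : x ∈ oTri p q r) (hxy : T.Adj x y) : y ∈ cTri p q r := by
  by_contra hn
  have aux : ∀ {a b z : ℝ × ℝ}, T.Adj a b → x ≠ a → x ≠ b → y ≠ a → y ≠ b → z ∈ segment ℝ a b →
      z ∉ segment ℝ x y := by
    intro a b z hab h1 h2 h3 h4 hz hz'
    rcases hE.1 a b x y hab hxy z hz hz' with he | ⟨ha, hb⟩
    · have : x ∈ ({a, b} : Set (ℝ × ℝ)) := by rw [he]; simp
      rcases this with h | h
      · exact h1 h
      · exact h2 h
    · rcases ha with rfl | rfl <;> rcases hb with hb | hb <;> tauto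
  obtain ⟨np, nq, nr⟩ := @not_mem_oTri_corner p q r
  have hxp : x ≠ p := fun e => np (e ▸ hx)
  have hxq : x ≠ q := fun e => nq (e ▸ hx)
  have hxr : x ≠ r := fun e => nr (e ▸ hx)
  have hp : p ∈ cTri p q r := segment_subset_cTri h (left_mem_segment ℝ p q)
  have hq : q ∈ cTri p q r := segment_subset_cTri h (right_mem_segment ℝ p q)
  have hr : r ∈ cTri p q r := by
    rw [← cTri_rot]
    exact segment_subset_cTri (by rwa [det3_rot]) (right_mem_segment ℝ q r)
  have hyp : y ≠ p := fun e => hn (e ▸ hp)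
  have hyq : y ≠ q := fun e => hn (e ▸ hq)
  have hyr : y ≠ r := fun e => hn (e ▸ hr)
  have hsub : segment ℝ x y ⊆ oTri p q r := by
    refine (convex_segment x y).isPreconnected.subset_of_closure_inter_subset (isOpen_oTri _ _ _)
      ⟨x, left_mem_segment ℝ x y, hx⟩ ?_
    rintro z ⟨hz, hzS⟩
    by_contra hn
    rcases frontier_oTri h hz hn with h' | h' | h'
    · exact aux hpq hxp hxq hyp hyq h' hzS
    · exact aux hqr hxq hxr hyq hyr h' hzS
    · exact aux hrp hxr hxp hyr hyp h' hzS
  exact hn (oTri_subset_cTri _ _ _ (hsub (right_mem_segment ℝ x y)))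

variable {h : ℕ} {u : ZMod h → ℝ × ℝ}

theorem IsBoundaryCycle.isInteriorVtx_of_mem_oTri (hu : T.IsBoundaryCycle u) (hpq : T.Adj p q)
    (hqr : T.Adj q r) (hrp : T.Adj r p) (hD : 0 < det3 p q r) (hv : x ∈ T.verts)
    (hx : x ∈ oTri p q r) : T.IsInteriorVtx u x := by
  refine ⟨hv, ?_⟩
  rintro ⟨j, rfl⟩
  have hf := hu.2.2.2.2.1 j (left_mem_segment ℝ _ _)
  obtain ⟨z, hz, hzo⟩ := mem_closure_iff.1 (frontier_subset_closure hf) _ (isOpen_oTri p q r) hx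
  refine hzo.2 ((isBounded_cTri hD).subset
    ((subset_oTri hpq hqr hrp hD isPreconnected_connectedComponentIn (fun w hw => ?_)
      ⟨z, mem_connectedComponentIn hzo.1, hz⟩).trans (oTri_subset_cTri _ _ _)))
  exact connectedComponentIn_subset _ _ hw

/-- A vertex with an interior neighbor has an interior neighbor such that the edge joining them
lies in no triangle other than the faces at this edge. -/
theorem exists_interior_neighbor_facial (hT : T.IsNearTriangulation) (hu : T.IsBoundaryCycle u)
    {w : ℝ × ℝ} (hw : ∃ v, T.IsInteriorVtx u v ∧ T.Adj w v) :
    ∃ v, T.IsInteriorVtx u v ∧ T.Adj w v ∧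
      ∀ t, T.Adj w t → T.Adj v t → T.Face w v t ∨ T.Face v w t := by
  by_contra hn
  push Not at hn
  have hE := hT.1
  let S : Finset ((ℝ × ℝ) × (ℝ × ℝ)) := (T.verts ×ˢ T.verts).filter fun e =>
    T.IsInteriorVtx u e.1 ∧ T.Adj w e.1 ∧ T.Adj w e.2 ∧ T.Adj e.1 e.2 ∧
      ¬ T.Face w e.1 e.2 ∧ ¬ T.Face e.1 w e.2
  have hS : ∀ v, T.IsInteriorVtx u v → T.Adj w v → ∃ t, (v, t) ∈ S := by
    intro v hv hwv
    obtain ⟨t, h1, h2, h3, h4⟩ := hn v hv hwv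
    exact ⟨t, Finset.mem_filter.2 ⟨Finset.mem_product.2 (T.mem_of_adj _ _ h2),
      hv, hwv, h1, h2, h3, h4⟩⟩
  obtain ⟨v, hv, hwv⟩ := hw
  obtain ⟨t, ht⟩ := hS v hv hwv
  obtain ⟨⟨v, b⟩, hvb, hmin⟩ := S.exists_min_image (fun e => |det3 w e.1 e.2|) ⟨_, ht⟩
  obtain ⟨-, hv, hwv, hwb, hvb, hf1, hf2⟩ := Finset.mem_filter.1 hvb
  simp only at hv hwv hwb hvb hf1 hf2 hmin
  have key : ∀ p r, (T.Adj w p ∧ T.Adj p r ∧ T.Adj r w ∧ 0 < det3 w p r) →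
      |det3 w v b| = det3 w p r → ∀ x, T.Adj w x → x ∈ oTri w p r → False := by
    rintro p r ⟨h1, h2, h3, h4⟩ he x hwx hx
    have hxi := hu.isInteriorVtx_of_mem_oTri h1 h2 h3 h4 (T.mem_of_adj _ _ hwx).2 hx
    obtain ⟨y, hy⟩ := hS x hxi hwx
    have hxy := (Finset.mem_filter.1 hy).2.2.2.2.1
    have := hmin _ hy
    rw [he] at this
    exact absurd (abs_det3_lt hx (mem_cTri_of_adj hE h1 h2 h3 h4 hx hxy)) (not_lt.2 this)
  obtain ⟨⟨x, hx⟩, ⟨x', hx'⟩⟩ := hv.two_sided hT hu (T.symm _ _ hwv)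
  have hbw := T.symm _ _ hwb
  rcases (det3_ne_zero_of_adj hE hwv hvb hbw).lt_or_gt with h0 | h0
  · have h1 : 0 < det3 v w b := by rw [det3_swap]; linarith
    have hm := hx.apex_mem_oTri hE hwb (T.symm _ _ hvb) h1 fun e => hf2 (e ▸ hx)
    refine key b v ⟨hwb, T.symm _ _ hvb, T.symm _ _ hwv, by rwa [det3_rot]⟩ ?_ x hx.2.1 ?_
    · rw [abs_of_neg h0, ← det3_swap, ← det3_rot]
    · rwa [oTri_rot]
  · exact key v b ⟨hwv, hvb, hbw, h0⟩ (abs_of_pos h0) x' (T.symm _ _ hx'.2.2.1)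
      (hx'.apex_mem_oTri hE hvb hbw h0 fun e => hf1 (e ▸ hx'))

theorem IsNearTriangulation.isContractible (hT : T.IsNearTriangulation) (hu : T.IsBoundaryCycle u)
    {w v : ℝ × ℝ} (hv : T.IsInteriorVtx u v) (hwv : T.Adj w v)
    (hf : ∀ t, T.Adj w t → T.Adj v t → T.Face w v t ∨ T.Face v w t) {i : ZMod h}
    (hi : w ≠ u i) (hi' : w ≠ u (i + 1)) : T.IsContractible w v := by
  have hnbr : ∀ {p q}, Nbr T.Face p q ↔ T.Adj p q := nbr_face_iff hT.1 hT.2.1 hT.2.2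
  have hC : Collapsible T.verts T.Face w v :=
    { disc := hT.triDisc
      anti := fun h => h.anti
      two_sided := fun h => hv.two_sided hT hu (hnbr.1 h)
      adj := hnbr.2 (T.symm _ _ hwv)
      facial := fun h1 h2 => hf _ (hnbr.1 h1) (hnbr.1 h2) }
  have hne : ∀ j, u j ≠ v := fun j e => hv.2 ⟨j, e⟩
  obtain ⟨a, b, hab, hor⟩ := hu.exists_bd hT i
  have hab' : Bd (Contract T.Face w v) a b := by
    rcases hor with ⟨rfl, rfl⟩ | ⟨rfl, rfl⟩
    · exact hC.bd_contract hab hi.symm hi'.symm (hne _) (hne _)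
    · exact hC.bd_contract hab hi'.symm hi.symm (hne _) (hne _)
  obtain ⟨H, P, hH, hP, hadj⟩ := hC.triDisc.exists_nearTriangulation hab'
  have hV : (T.contractEdge w v).verts =
      @Finset.erase _ (fun a b => Classical.propDecidable (a = b)) T.verts v := by
    ext z; simp [contractEdge]
  refine ⟨hwv, H, hH, P, by rw [hV]; exact hP, fun x hx y hy => ?_⟩
  have hx' := hV ▸ hx
  have hy' := hV ▸ hy
  rw [← hadj x hx' y hy', hC.nbr_contract_iff (Finset.ne_of_mem_erase hx)
    (Finset.ne_of_mem_erase hy)]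
  simp only [hnbr]
  exact ⟨fun h => ⟨h.1, h.2.2.2⟩, fun h => ⟨h.1, hx, hy, h.2⟩⟩

end PlaneGraph

end

/-- Let `T` be a near-triangulation of order `n ≥ 5` with boundary cycle
`C = (u_1, …, u_h, u_1)`, and let `u_i` be a boundary vertex.  If `u_i` has at least one
neighbor not on `C`, then there exists an interior vertex `v` such that the edge `(u_i, v)`
is contractible in `T`. -/
theorem contractible_edge_to_interior_neighbor (T : PlaneGraph) (h : ℕ)
    (u : ZMod h → ℝ × ℝ) (i : ZMod h)
    (hT : T.IsNearTriangulation) (hu : T.IsBoundaryCycle u) (hn : 5 ≤ T.verts.card)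
    (hnb : ∃ w ∈ T.verts, T.Adj (u i) w ∧ w ∉ Set.range u) :
    ∃ v : ℝ × ℝ, T.IsInteriorVtx u v ∧ T.IsContractible (u i) v := by
  obtain ⟨w, hw, hiw, hwu⟩ := hnb
  obtain ⟨v, hv, hiv, hf⟩ :=
    PlaneGraph.exists_interior_neighbor_facial hT hu ⟨w, ⟨hw, hwu⟩, hiw⟩
  have hh := hu.1
  have h1 : (1 : ZMod h) ≠ 0 := by
    have : Fact (1 < h) := ⟨by omega⟩
    exact one_ne_zero
  have h2 : (1 : ZMod h) + 1 ≠ 0 := by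
    intro h0
    have : ((2 : ℕ) : ZMod h) = 0 := by push_cast; rw [← h0]; norm_num
    have := Nat.le_of_dvd (by norm_num) ((ZMod.natCast_eq_zero_iff 2 h).1 this)
    omega
  refine ⟨v, hv, hT.isContractible hu hv hiv hf (i := i + 1) (fun e => ?_) fun e => ?_⟩
  · exact h1 (by simpa using hu.2.1 e)
  · exact h2 (by simpa [add_assoc] using hu.2.1 e)
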